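/- Let (Y_j)_{j∈ℤ} = ((Y_j^{(1)}, Y_j^{(2)}))_{j∈ℤ} be a stationary bivariate Gaussian process with E Y_j^{(p)} = 0, E (Y_j^{(p)})² = 1, and cross-correlations r^{(p,q)}(k) := E(Y_j^{(p)} Y_{j+k}^{(q)}) satisfying |r^{(p,q)}(k)| < 1 for k ≥ 1. Assume there are d_1, d_2 ∈ (−∞,0) ∪ (0,1/4) and functions L_{p,q} with L_{p,q}(k) → L_{p,q} ∈ ℝ as k → ∞ such that r^{(p,q)}(k) = L_{p,q}(k)·k^{d_p+d_q−1} for p,q ∈ {1,2} and all k ≥ 1. Fix h ∈ ℕ and let f_j := 1{Π̃(Y_j^{(1)},…,Y_{j+h−1}^{(1)}) = Π̃(Y_j^{(2)},…,Y_{j+h−1}^{(2)})}, p := E f_1, and p̂_n := (n−h)^{−1} Σ_{j=1}^{n−h} f_j. Then σ² := Σ_{k=−∞}^{∞} E[(f_1 − p)(f_{1+k} − p)] converges (absolutely), σ² ≥ 0, and n^{1/2}(p̂_n − p) converges in distribution to the centered normal distribution N(0, σ²) as n → ∞. -/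

import Mathlib

open MeasureTheory ProbabilityTheory Filter

/-- `π` is the ordinal pattern of `x = (x_0,…,x_m)`: the values `x_{π_0} ≥ … ≥ x_{π_m}` are
ordered decreasingly, with ties broken by `π_{i−1} < π_i` whenever `x_{π_{i−1}} = x_{π_i}`. -/
def IsOrdPat {m : ℕ} (x : Fin (m + 1) → ℝ) (π : Equiv.Perm (Fin (m + 1))) : Prop :=
  (∀ i : Fin m, x (π i.succ) ≤ x (π i.castSucc)) ∧
  (∀ i : Fin m, x (π i.castSucc) = x (π i.succ) → π i.castSucc < π i.succ)

/-- The vector of partial sums `(0, y_1, y_1+y_2, …, y_1+⋯+y_m)` of `y = (y_1,…,y_m)`;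
the map `Π̃` of the paper is `y ↦ Π(cumsum y)`. -/
def cumsum (m : ℕ) (y : Fin m → ℝ) : Fin (m + 1) → ℝ :=
  fun i => ∑ j : Fin m, if (j : ℕ) < (i : ℕ) then y j else 0

open scoped NNReal ENNReal Topology
set_option linter.unusedSectionVars false

/-- A linear space of centered jointly Gaussian random variables. -/
structure IsGaussianSpace {Ω : Type*} [MeasurableSpace Ω] (V : Submodule ℝ (Ω → ℝ))
    (P : Measure Ω) : Prop where
  measurable : ∀ u ∈ V, Measurable u
  law : ∀ u ∈ V, ∃ v : ℝ≥0, P.map u = gaussianReal 0 v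

namespace IsGaussianSpace

variable {Ω : Type*} [MeasurableSpace Ω] {P : Measure Ω} [IsProbabilityMeasure P]
  {V : Submodule ℝ (Ω → ℝ)} {u w : Ω → ℝ}

lemma memLp (hV : IsGaussianSpace V P) (hu : u ∈ V) : MemLp u 2 P := by
  obtain ⟨v, hv⟩ := hV.law u hu
  have h1 : MemLp id 2 (P.map u) := by rw [hv]; exact memLp_id_gaussianReal' 2 (by simp)
  exact (memLp_map_measure_iff (by fun_prop) (hV.measurable u hu).aemeasurable).1 h1

lemma integrable_mul (hV : IsGaussianSpace V P) (hu : u ∈ V) (hw : w ∈ V) :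
    Integrable (fun ω => u ω * w ω) P :=
  (hV.memLp hu).integrable_mul (hV.memLp hw)

lemma integral_eq_zero (hV : IsGaussianSpace V P) (hu : u ∈ V) : ∫ ω, u ω ∂P = 0 := by
  obtain ⟨v, hv⟩ := hV.law u hu
  have := integral_map (μ := P) (φ := u) (hV.measurable u hu).aemeasurable (f := id) (by fun_prop)
  rw [hv] at this
  simpa using this.symm

lemma covariance_eq (hV : IsGaussianSpace V P) (hu : u ∈ V) (hw : w ∈ V) :
    cov[u, w; P] = ∫ ω, u ω * w ω ∂P := by
  rw [covariance_eq_sub (hV.memLp hu) (hV.memLp hw), hV.integral_eq_zero hu]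
  simp

lemma map_eq (hV : IsGaussianSpace V P) (hu : u ∈ V) :
    P.map u = gaussianReal 0 (∫ ω, u ω * u ω ∂P).toNNReal := by
  obtain ⟨v, hv⟩ := hV.law u hu
  have h2 : ∫ ω, u ω * u ω ∂P = v := by
    have := integral_map (μ := P) (φ := u) (hV.measurable u hu).aemeasurable
      (f := fun x => x * x) (by fun_prop)
    rw [← this, hv]
    have h3 := variance_fun_id_gaussianReal (μ := 0) (v := v)
    rw [variance_eq_integral (by fun_prop)] at h3
    simpa [pow_two] using h3
  rw [h2, hv, Real.toNNReal_coe]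

lemma integral_self_nonneg (u : Ω → ℝ) : 0 ≤ ∫ ω, u ω * u ω ∂P :=
  integral_nonneg fun ω => mul_self_nonneg (u ω)

lemma integral_cexp (hV : IsGaussianSpace V P) (hu : u ∈ V) :
    ∫ ω, Complex.exp (u ω * Complex.I) ∂P
      = (Real.exp (-(∫ ω, u ω * u ω ∂P) / 2) : ℂ) := by
  have h := charFun_gaussianReal (μ := 0) (v := (∫ ω, u ω * u ω ∂P).toNNReal) 1
  rw [← hV.map_eq hu, charFun_apply_real, integral_map (hV.measurable u hu).aemeasurable
    (by fun_prop)] at h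
  simp only [Complex.ofReal_one, one_mul] at h
  rw [h, Complex.ofReal_exp]
  congr 1
  simp [Real.coe_toNNReal _ (integral_self_nonneg u)]
  ring

lemma integrable_of_bound {E : Type*} [NormedAddCommGroup E] {f : Ω → E}
    (hf : AEStronglyMeasurable f P) (C : ℝ) (h : ∀ ω, ‖f ω‖ ≤ C) : Integrable f P :=
  Integrable.of_bound hf C (Eventually.of_forall h)

lemma integral_cos (hV : IsGaussianSpace V P) (hu : u ∈ V) :
    ∫ ω, Real.cos (u ω) ∂P = Real.exp (-(∫ ω, u ω * u ω ∂P) / 2) := by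
  have h := congrArg Complex.re (hV.integral_cexp hu)
  have hm := hV.measurable u hu
  have hi : Integrable (fun ω => Complex.exp (u ω * Complex.I)) P :=
    integrable_of_bound (by fun_prop) 1 fun ω => by
      rw [Complex.norm_exp_ofReal_mul_I]
  rw [Complex.ofReal_re] at h
  rw [← h, ← RCLike.re_eq_complex_re, ← integral_re hi]
  simp [Complex.exp_ofReal_mul_I_re]

lemma integral_add_mul_self (hV : IsGaussianSpace V P) (hu : u ∈ V) (hw : w ∈ V) :
    ∫ ω, (u + w) ω * (u + w) ω ∂P
      = ∫ ω, u ω * u ω ∂P + ∫ ω, w ω * w ω ∂P + 2 * ∫ ω, u ω * w ω ∂P := by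
  rw [← integral_const_mul, ← integral_add (hV.integrable_mul hu hu) (hV.integrable_mul hw hw),
    ← integral_add (f := fun ω => u ω * u ω + w ω * w ω)
      ((hV.integrable_mul hu hu).add (hV.integrable_mul hw hw))
      ((hV.integrable_mul hu hw).const_mul 2)]
  congr 1; ext ω; simp; ring

lemma integral_sub_mul_self (hV : IsGaussianSpace V P) (hu : u ∈ V) (hw : w ∈ V) :
    ∫ ω, (u - w) ω * (u - w) ω ∂P
      = ∫ ω, u ω * u ω ∂P + ∫ ω, w ω * w ω ∂P - 2 * ∫ ω, u ω * w ω ∂P := by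
  rw [← integral_const_mul, ← integral_add (hV.integrable_mul hu hu) (hV.integrable_mul hw hw),
    ← integral_sub (f := fun ω => u ω * u ω + w ω * w ω)
      ((hV.integrable_mul hu hu).add (hV.integrable_mul hw hw))
      ((hV.integrable_mul hu hw).const_mul 2)]
  congr 1; ext ω; simp; ring

lemma integrable_cos {a : Ω → ℝ} (ha : Measurable a) : Integrable (fun ω => Real.cos (a ω)) P :=
  integrable_of_bound (by fun_prop) 1 fun ω => by simpa using Real.abs_cos_le_one _

lemma integral_cos_mul_cos (hV : IsGaussianSpace V P) (hu : u ∈ V) (hw : w ∈ V) :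
    ∫ ω, Real.cos (u ω) * Real.cos (w ω) ∂P
      = Real.exp (-(∫ ω, u ω * u ω ∂P + ∫ ω, w ω * w ω ∂P) / 2)
        * Real.cosh (∫ ω, u ω * w ω ∂P) := by
  have h1 := hV.integral_cos (V.add_mem hu hw)
  have h2 := hV.integral_cos (V.sub_mem hu hw)
  have e : ∀ ω, Real.cos (u ω) * Real.cos (w ω)
      = (Real.cos ((u + w) ω) + Real.cos ((u - w) ω)) / 2 := fun ω => by
    simp [Real.cos_add, Real.cos_sub]
  simp_rw [e]
  rw [integral_div, integral_add (integrable_cos (hV.measurable _ (V.add_mem hu hw)))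
    (integrable_cos (hV.measurable _ (V.sub_mem hu hw))), h1, h2,
    hV.integral_add_mul_self hu hw, hV.integral_sub_mul_self hu hw, Real.cosh_eq,
    mul_div_assoc', mul_add, ← Real.exp_add, ← Real.exp_add]
  ring_nf

lemma integral_sin_mul_sin (hV : IsGaussianSpace V P) (hu : u ∈ V) (hw : w ∈ V) :
    ∫ ω, Real.sin (u ω) * Real.sin (w ω) ∂P
      = Real.exp (-(∫ ω, u ω * u ω ∂P + ∫ ω, w ω * w ω ∂P) / 2)
        * Real.sinh (∫ ω, u ω * w ω ∂P) := by
  have h1 := hV.integral_cos (V.add_mem hu hw)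
  have h2 := hV.integral_cos (V.sub_mem hu hw)
  have e : ∀ ω, Real.sin (u ω) * Real.sin (w ω)
      = (Real.cos ((u - w) ω) - Real.cos ((u + w) ω)) / 2 := fun ω => by
    simp [Real.cos_add, Real.cos_sub]
  simp_rw [e]
  rw [integral_div, integral_sub (integrable_cos (hV.measurable _ (V.sub_mem hu hw)))
    (integrable_cos (hV.measurable _ (V.add_mem hu hw))), h1, h2,
    hV.integral_add_mul_self hu hw, hV.integral_sub_mul_self hu hw, Real.sinh_eq,
    mul_div_assoc', mul_sub, ← Real.exp_add, ← Real.exp_add]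
  ring_nf

lemma abs_integral_mul_le (hV : IsGaussianSpace V P) (hu : u ∈ V) (hw : w ∈ V) :
    |∫ ω, u ω * w ω ∂P| ≤ (∫ ω, u ω * u ω ∂P + ∫ ω, w ω * w ω ∂P) / 2 := by
  have h1 := hV.integral_add_mul_self hu hw
  have h2 := hV.integral_sub_mul_self hu hw
  have h3 := integral_self_nonneg (P := P) (u + w)
  have h4 := integral_self_nonneg (P := P) (u - w)
  rw [abs_le]
  constructor <;> linarith

lemma _root_.Real.cosh_sub_one_le (x : ℝ) : Real.cosh x - 1 ≤ x ^ 2 / 2 * Real.cosh x := by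
  have h1 : Real.cosh x = 1 + 2 * Real.sinh (x / 2) ^ 2 := by
    have := Real.cosh_two_mul (x / 2)
    rw [Real.cosh_sq] at this
    rw [← this.trans (by ring : _ = 1 + 2 * Real.sinh (x / 2) ^ 2)]
    congr 1; ring
  have h2 : Real.sinh (x / 2) ^ 2 ≤ (x / 2) ^ 2 * Real.cosh (x / 2) ^ 2 := by
    wlog hx : 0 ≤ x generalizing x
    · have := this (-x) (by rw [Real.cosh_neg]; simpa [neg_div, Real.sinh_neg] using h1)
        (by linarith)
      simpa [neg_div, Real.sinh_neg] using this
    have h3 : Real.sinh (x / 2) ≤ x / 2 * Real.cosh (x / 2) := by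
      have hmono : MonotoneOn (fun y => y * Real.cosh y - Real.sinh y) (Set.Ici 0) := by
        apply monotoneOn_of_deriv_nonneg (convex_Ici 0) (by fun_prop) (by fun_prop)
        intro y hy
        simp only [Set.nonempty_Iio, interior_Ici', Set.mem_Ioi] at hy
        have : HasDerivAt (fun y => y * Real.cosh y - Real.sinh y)
            (1 * Real.cosh y + y * Real.sinh y - Real.cosh y) y :=
          ((hasDerivAt_id y).mul (Real.hasDerivAt_cosh y)).sub (Real.hasDerivAt_sinh y)
        rw [this.deriv]
        have := mul_nonneg hy.le (Real.sinh_nonneg_iff.2 hy.le)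
        linarith
      have := hmono (Set.mem_Ici.2 le_rfl) (Set.mem_Ici.2 (by positivity : 0 ≤ x / 2))
        (by positivity)
      simp at this
      linarith
    have h4 : 0 ≤ Real.sinh (x / 2) := Real.sinh_nonneg_iff.2 (by positivity)
    rw [← mul_pow]
    exact pow_le_pow_left₀ h4 h3 2
  have h5 : Real.cosh (x / 2) ^ 2 ≤ Real.cosh x := by
    rw [Real.cosh_sq, h1]; nlinarith [sq_nonneg (Real.sinh (x / 2))]
  have h6 := mul_le_mul_of_nonneg_left h5 (sq_nonneg x)
  nlinarith

lemma _root_.Real.cosh_le_exp_abs' (x : ℝ) : Real.cosh x ≤ Real.exp |x| := by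
  rw [← Real.cosh_abs, Real.cosh_eq]
  have : Real.exp (-|x|) ≤ Real.exp |x| := Real.exp_le_exp.2 (by linarith [abs_nonneg x])
  linarith

/-- Covariance of cosines is at most quadratic in the correlation. -/
lemma abs_cov_cos_le (hV : IsGaussianSpace V P) (hu : u ∈ V) (hw : w ∈ V) :
    |∫ ω, Real.cos (u ω) * Real.cos (w ω) ∂P
      - (∫ ω, Real.cos (u ω) ∂P) * ∫ ω, Real.cos (w ω) ∂P| ≤ (∫ ω, u ω * w ω ∂P) ^ 2 / 2 := by
  rw [hV.integral_cos_mul_cos hu hw, hV.integral_cos hu, hV.integral_cos hw, ← Real.exp_add]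
  have hb := hV.abs_integral_mul_le hu hw
  set c := ∫ ω, u ω * w ω ∂P
  set a := ∫ ω, u ω * u ω ∂P
  set b := ∫ ω, w ω * w ω ∂P
  have e1 : -a / 2 + -b / 2 = -(a + b) / 2 := by ring
  rw [e1, ← mul_sub_one, abs_of_nonneg (mul_nonneg (Real.exp_pos _).le
    (sub_nonneg.2 (Real.one_le_cosh c)))]
  have h1 : Real.exp (-(a + b) / 2) * Real.cosh c ≤ 1 := by
    calc _ ≤ Real.exp (-(a + b) / 2) * Real.exp |c| := by
          gcongr; exact Real.cosh_le_exp_abs' c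
      _ ≤ 1 := by rw [← Real.exp_add]; exact Real.exp_le_one_iff.2 (by linarith)
  calc _ ≤ Real.exp (-(a + b) / 2) * (c ^ 2 / 2 * Real.cosh c) := by
        gcongr; exact Real.cosh_sub_one_le c
    _ = c ^ 2 / 2 * (Real.exp (-(a + b) / 2) * Real.cosh c) := by ring
    _ ≤ c ^ 2 / 2 * 1 := by gcongr
    _ = _ := by ring

end IsGaussianSpace

/-- Gaussian integration by parts on the line. -/
lemma integral_mul_gaussianReal_eq {f f' : ℝ → ℂ} (v : ℝ≥0) (hd : ∀ x, HasDerivAt f (f' x) x)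
    (hf' : Measurable f') (C C' : ℝ) (hC : ∀ x, ‖f x‖ ≤ C) (hC' : ∀ x, ‖f' x‖ ≤ C') :
    ∫ x, (x : ℂ) * f x ∂(gaussianReal 0 v) = v * ∫ x, f' x ∂(gaussianReal 0 v) := by
  by_cases hv : v = 0
  · simp [hv, gaussianReal_zero_var]
  have hfm : Measurable f := (continuous_iff_continuousAt.2 fun x => (hd x).continuousAt).measurable
  have hv' : (v : ℝ) ≠ 0 := by exact_mod_cast hv
  set g : ℝ → ℂ := fun x => (gaussianPDFReal 0 v x : ℂ) with hg
  have hgd : ∀ x, HasDerivAt g (-(x / v) * g x : ℂ) x := by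
    intro x
    have h1 : HasDerivAt (gaussianPDFReal 0 v) (-(x / v) * gaussianPDFReal 0 v x) x := by
      have h2 : HasDerivAt (fun x : ℝ => -(x - 0) ^ 2 / (2 * v)) (-(2 * x) / (2 * v)) x := by
        have := (((hasDerivAt_id x).sub_const 0).pow 2).neg.div_const (2 * (v : ℝ))
        simpa using this
      have h3 := (h2.exp).const_mul (√(2 * Real.pi * v))⁻¹
      rw [gaussianPDFReal_def]
      refine h3.congr_deriv ?_
      have : -(2 * x) / (2 * (v : ℝ)) = -(x / v) := by field_simp
      rw [this]; ring
    have := h1.ofReal_comp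
    simpa [hg] using this
  have hgi : Integrable g := (integrable_gaussianPDFReal 0 v).ofReal
  have hgm : Measurable g := by fun_prop
  have hxg : Integrable (fun x : ℝ => (x : ℂ) * g x) := by
    have h1 : Integrable (fun x : ℝ => x) (gaussianReal 0 v) :=
      (memLp_id_gaussianReal 1).integrable (by simp)
    rw [gaussianReal_of_var_ne_zero _ hv, integrable_withDensity_iff_integrable_smul'
      (by fun_prop) (Eventually.of_forall fun x => gaussianPDF_lt_top)] at h1
    have := h1.ofReal (𝕜 := ℂ)
    refine this.congr (Eventually.of_forall fun x => ?_)
    simp [toReal_gaussianPDF, hg, mul_comm]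
  have key := integral_mul_deriv_eq_deriv_mul_of_integrable (u := f) (v := g) (u' := f')
    (v' := fun x => (-(x / v) * g x : ℂ)) (fun x _ => hd x) (fun x _ => hgd x) ?_ ?_ ?_
  · rw [integral_gaussianReal_eq_integral_smul hv, integral_gaussianReal_eq_integral_smul hv,
      ← integral_const_mul]
    have e1 : ∀ x : ℝ, f x * (-(x / v) * g x : ℂ)
        = (-(1 / v) : ℂ) * (gaussianPDFReal 0 v x • ((x : ℂ) * f x)) := fun x => by
      simp [hg]; ring
    have e2 : ∀ x : ℝ, f' x * g x = (1 / v : ℂ) * ((v : ℂ) * gaussianPDFReal 0 v x • f' x) :=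
      fun x => by
        have : (v : ℂ) ≠ 0 := by exact_mod_cast hv
        simp [hg]; field_simp
    simp_rw [e1, e2] at key
    rw [integral_const_mul, integral_const_mul, neg_mul, neg_inj] at key
    refine mul_left_cancel₀ ?_ key
    have : (v : ℂ) ≠ 0 := by exact_mod_cast hv
    simp [this]
  · have : Integrable (fun x : ℝ => f x * ((-(1 / v) : ℂ) * ((x : ℂ) * g x))) :=
      (hxg.const_mul _).bdd_mul hfm.aestronglyMeasurable (Eventually.of_forall hC)
    refine this.congr (Eventually.of_forall fun x => ?_)
    simp only [Pi.mul_apply]; ring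
  · exact hgi.bdd_mul hf'.aestronglyMeasurable (Eventually.of_forall hC')
  · exact hgi.bdd_mul hfm.aestronglyMeasurable (Eventually.of_forall hC)

namespace IsGaussianSpace

variable {Ω : Type*} [MeasurableSpace Ω] {P : Measure Ω} [IsProbabilityMeasure P]
  {V : Submodule ℝ (Ω → ℝ)} {u w : Ω → ℝ}

lemma indepFun (hV : IsGaussianSpace V P) {κ : Type*} [Finite κ] {u : Ω → ℝ} {w : κ → Ω → ℝ}
    (hu : u ∈ V) (hw : ∀ k, w k ∈ V) (h0 : ∀ k, ∫ ω, u ω * w k ω ∂P = 0) :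
    IndepFun (fun ω k => w k ω) u P := by
  classical
  have := Fintype.ofFinite κ
  have hmu := hV.measurable u hu
  have hmw := fun k => hV.measurable _ (hw k)
  have hm : Measurable (fun ω => ((fun k => w k ω), (fun _ : Unit => u ω))) := by fun_prop
  have hG : HasGaussianLaw (fun ω => ((fun k => w k ω), (fun _ : Unit => u ω))) P := by
    refine ⟨isGaussian_of_map_eq_gaussianReal fun L => ?_⟩
    set U : Ω → ℝ := ∑ k, (L (Pi.single k 1, 0)) • w k + (L (0, fun _ => 1)) • u
    have hU : U ∈ V := V.add_mem (V.sum_mem fun k _ => V.smul_mem _ (hw k)) (V.smul_mem _ hu)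
    obtain ⟨v, hv⟩ := hV.law U hU
    refine ⟨0, v, ?_⟩
    rw [← hv, Measure.map_map (by fun_prop) hm]
    congr 1
    ext ω
    have e : ((fun k => w k ω), (fun _ : Unit => u ω))
        = ∑ k, w k ω • ((Pi.single k 1, 0) : (κ → ℝ) × (Unit → ℝ))
          + u ω • ((0, fun _ => 1) : (κ → ℝ) × (Unit → ℝ)) := by
      ext i
      · simp [Prod.fst_sum, Finset.sum_apply, Pi.single_apply]
      · simp [Prod.snd_sum]
    simp only [Function.comp_apply]
    rw [e]
    simp only [map_add, map_sum, map_smul]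
    simp [U, mul_comm]
  have := hG.indepFun_of_covariance_eval (X := w) (Y := fun _ : Unit => u) fun k _ => by
    rw [hV.covariance_eq (hw k) hu, ← h0 k]
    simp_rw [mul_comm]
  exact this.comp measurable_id (measurable_pi_apply ())

/-- Integration by parts conditionally on variables uncorrelated with `u`. -/
lemma integral_mul_eq (hV : IsGaussianSpace V P) {κ : Type*} [Finite κ] {u : Ω → ℝ}
    {w : κ → Ω → ℝ} (hu : u ∈ V) (hw : ∀ k, w k ∈ V) (h0 : ∀ k, ∫ ω, u ω * w k ω ∂P = 0)
    {F F' : (κ → ℝ) → ℝ → ℂ} (hF : Measurable (Function.uncurry F))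
    (hF' : Measurable (Function.uncurry F'))
    (hd : ∀ y x, HasDerivAt (F y) (F' y x) x) (C C' : ℝ) (hC : ∀ y x, ‖F y x‖ ≤ C)
    (hC' : ∀ y x, ‖F' y x‖ ≤ C') :
    ∫ ω, (u ω : ℂ) * F (fun k => w k ω) (u ω) ∂P
      = (∫ ω, u ω * u ω ∂P : ℝ) * ∫ ω, F' (fun k => w k ω) (u ω) ∂P := by
  have hmu := hV.measurable u hu
  have hmw := fun k => hV.measurable _ (hw k)
  have hmW : Measurable (fun ω k => w k ω) := by fun_prop
  have hprod := (indepFun_iff_map_prod_eq_prod_map_map hmW.aemeasurable hmu.aemeasurable).1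
    (hV.indepFun hu hw h0)
  have hWp : IsProbabilityMeasure (P.map (fun ω k => w k ω)) :=
    Measure.isProbabilityMeasure_map hmW.aemeasurable
  have hmWu : Measurable (fun ω => ((fun k => w k ω), u ω)) := by fun_prop
  have e1 : ∫ ω, (u ω : ℂ) * F (fun k => w k ω) (u ω) ∂P
      = ∫ z, (z.2 : ℂ) * F z.1 z.2 ∂(P.map (fun ω => ((fun k => w k ω), u ω))) := by
    rw [integral_map hmWu.aemeasurable]
    exact ((Complex.measurable_ofReal.comp measurable_snd).mul hF).aestronglyMeasurable
  have e2 : ∫ ω, F' (fun k => w k ω) (u ω) ∂P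
      = ∫ z, F' z.1 z.2 ∂(P.map (fun ω => ((fun k => w k ω), u ω))) := by
    rw [integral_map hmWu.aemeasurable]
    exact hF'.aestronglyMeasurable
  have i1 : Integrable (fun z : (κ → ℝ) × ℝ => (z.2 : ℂ) * F z.1 z.2)
      (P.map (fun ω => ((fun k => w k ω), u ω))) := by
    have hm1 : Measurable (fun z : (κ → ℝ) × ℝ => (z.2 : ℂ) * F z.1 z.2) :=
      (Complex.measurable_ofReal.comp measurable_snd).mul hF
    rw [integrable_map_measure hm1.aestronglyMeasurable hmWu.aemeasurable]
    have h1 : Integrable (fun ω => (u ω : ℂ)) P := ((hV.memLp hu).integrable (by simp)).ofReal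
    refine h1.mul_bdd (c := C) (hF.comp hmWu).aestronglyMeasurable
      (Eventually.of_forall fun ω => hC _ _)
  have i2 : Integrable (fun z : (κ → ℝ) × ℝ => F' z.1 z.2)
      (P.map (fun ω => ((fun k => w k ω), u ω))) := by
    have hm2 : Measurable (fun z : (κ → ℝ) × ℝ => F' z.1 z.2) := hF'
    rw [integrable_map_measure hm2.aestronglyMeasurable hmWu.aemeasurable]
    exact integrable_of_bound (hF'.comp hmWu).aestronglyMeasurable C' fun ω => hC' _ _
  rw [e1, e2]
  rw [hprod, hV.map_eq hu] at i1 i2 ⊢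
  rw [integral_prod _ i1, integral_prod _ i2, ← integral_const_mul]
  congr 1; ext y
  rw [integral_mul_gaussianReal_eq (f := F y) (f' := F' y) _ (hd y)
    (hF'.comp (measurable_const.prodMk measurable_id)) C C' (hC y) (hC' y)]
  congr 1
  norm_cast
  exact Real.coe_toNNReal _ (integral_self_nonneg u)

end IsGaussianSpace

namespace IsGaussianSpace

variable {Ω : Type*} [MeasurableSpace Ω] {P : Measure Ω} [IsProbabilityMeasure P]
  {V : Submodule ℝ (Ω → ℝ)} {u w : Ω → ℝ}

lemma ae_eq_zero (hV : IsGaussianSpace V P) (hu : u ∈ V) (h : ∫ ω, u ω * u ω ∂P = 0) :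
    ∀ᵐ ω ∂P, u ω = 0 := by
  rw [integral_eq_zero_iff_of_nonneg (fun ω => mul_self_nonneg _) (hV.integrable_mul hu hu)] at h
  filter_upwards [h] with ω hω
  simpa using hω

lemma norm_cexp_ofReal_mul_I (x : ℝ) : ‖Complex.exp ((x : ℂ) * Complex.I)‖ = 1 :=
  Complex.norm_exp_ofReal_mul_I x

/-- Integration by parts against `exp (iθ(∑ aₖ cos wₖ - b))`. -/
lemma integral_mul_sin_mul_cexp (hV : IsGaussianSpace V P) {κ : Type*} [Fintype κ] {u : Ω → ℝ}
    {w : κ → Ω → ℝ} (hu : u ∈ V) (hw : ∀ k, w k ∈ V) (a : κ → ℝ) (b θ t : ℝ) :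
    ∫ ω, (u ω : ℂ) * (Real.sin (t * u ω)
        * Complex.exp ((θ * (∑ k, a k * Real.cos (w k ω) - b) : ℝ) * Complex.I)) ∂P
      = t * (∫ ω, u ω * u ω ∂P : ℝ) * ∫ ω, (Real.cos (t * u ω)
        * Complex.exp ((θ * (∑ k, a k * Real.cos (w k ω) - b) : ℝ) * Complex.I)) ∂P
        - θ * Complex.I * ∑ k, (a k * ∫ ω, u ω * w k ω ∂P : ℝ) *
          ∫ ω, ((Real.sin (t * u ω) * Real.sin (w k ω) : ℝ)
        * Complex.exp ((θ * (∑ k, a k * Real.cos (w k ω) - b) : ℝ) * Complex.I)) ∂P := by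
  have hmu := hV.measurable u hu
  have hmw := fun k => hV.measurable _ (hw k)
  by_cases h0 : ∫ ω, u ω * u ω ∂P = 0
  · have hz := hV.ae_eq_zero hu h0
    have e1 : ∀ k, ∫ ω, u ω * w k ω ∂P = 0 := fun k => by
      rw [integral_congr_ae (g := fun _ => 0) (by filter_upwards [hz] with ω hω; simp [hω])]
      simp
    rw [integral_congr_ae (g := fun _ => 0) (by filter_upwards [hz] with ω hω; simp [hω])]
    simp [h0, e1]
  set D := ∫ ω, u ω * u ω ∂P with hD
  set c : κ → ℝ := fun k => (∫ ω, u ω * w k ω ∂P) / D with hc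
  set W : κ → Ω → ℝ := fun k => w k - c k • u with hWdef
  have hW : ∀ k, W k ∈ V := fun k => V.sub_mem (hw k) (V.smul_mem _ hu)
  have hW0 : ∀ k, ∫ ω, u ω * W k ω ∂P = 0 := fun k => by
    have : ∀ ω, u ω * W k ω = u ω * w k ω - c k * (u ω * u ω) := fun ω => by
      simp [hWdef]; ring
    simp_rw [this]
    rw [integral_sub (hV.integrable_mul hu (hw k)) ((hV.integrable_mul hu hu).const_mul _),
      integral_const_mul, ← hD]
    simp only [hc]; field_simp; ring
  set S : (κ → ℝ) → ℝ → ℝ := fun y x => θ * (∑ k, a k * Real.cos (y k + c k * x) - b) with hS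
  set S' : (κ → ℝ) → ℝ → ℝ := fun y x => θ * ∑ k, a k * (-Real.sin (y k + c k * x) * c k) with hS'
  have hSd : ∀ y x, HasDerivAt (S y) (S' y x) x := fun y x => by
    refine HasDerivAt.const_mul θ (HasDerivAt.sub_const b ?_)
    refine HasDerivAt.fun_sum fun k _ => HasDerivAt.const_mul (a k) ?_
    have : HasDerivAt (fun x => y k + c k * x) (c k) x := by
      simpa using ((hasDerivAt_id x).const_mul (c k)).const_add (y k)
    exact this.cos
  set F : (κ → ℝ) → ℝ → ℂ := fun y x => (Real.sin (t * x) : ℂ) * Complex.exp (S y x * Complex.I)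
    with hF
  set F' : (κ → ℝ) → ℝ → ℂ := fun y x =>
    ((Real.cos (t * x) * t : ℝ) : ℂ) * Complex.exp (S y x * Complex.I)
      + (Real.sin (t * x) : ℂ) * (Complex.exp (S y x * Complex.I) * (S' y x * Complex.I)) with hF'
  have key := hV.integral_mul_eq hu hW hW0 (F := F) (F' := F') ?_ ?_ ?_ 1
    (|t| + |θ| * ∑ k, |a k| * |c k|) ?_ ?_
  · have hSW : ∀ ω, S (fun k => W k ω) (u ω) = θ * (∑ k, a k * Real.cos (w k ω) - b) := fun ω => by
      simp [hS, hWdef]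
    have hSW' : ∀ ω, S' (fun k => W k ω) (u ω)
        = -(θ * ∑ k, a k * c k * Real.sin (w k ω)) := fun ω => by
      simp only [hS', hWdef, Pi.sub_apply, Pi.smul_apply, smul_eq_mul, sub_add_cancel]
      rw [← mul_neg, ← Finset.sum_neg_distrib]
      congr 2; ext k; ring
    simp only [hF, hF', hSW, hSW'] at key
    rw [key, ← hD]
    set e : Ω → ℂ := fun ω =>
      Complex.exp ((θ * (∑ k, a k * Real.cos (w k ω) - b) : ℝ) * Complex.I) with he
    have hem : Measurable e := by fun_prop
    have he1 : ∀ ω, ‖e ω‖ = 1 := fun ω => norm_cexp_ofReal_mul_I _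
    have i1 : Integrable (fun ω => (Real.cos (t * u ω) : ℂ) * e ω) P :=
      integrable_of_bound (by fun_prop) 1 fun ω => by
        rw [norm_mul, he1, mul_one, Complex.norm_real]; exact Real.abs_cos_le_one _
    have i2 : ∀ k, Integrable
        (fun ω => ((Real.sin (t * u ω) * Real.sin (w k ω) : ℝ) : ℂ) * e ω) P :=
      fun k => integrable_of_bound (by fun_prop) 1 fun ω => by
        rw [norm_mul, he1, mul_one, Complex.norm_real, Real.norm_eq_abs, abs_mul]
        exact mul_le_one₀ (Real.abs_sin_le_one _) (abs_nonneg _) (Real.abs_sin_le_one _)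
    have e2 : ∀ ω, ((Real.cos (t * u ω) * t : ℝ) : ℂ) * e ω + (Real.sin (t * u ω) : ℂ)
          * (e ω * ((-(θ * ∑ k, a k * c k * Real.sin (w k ω)) : ℝ) * Complex.I))
        = t * ((Real.cos (t * u ω) : ℂ) * e ω) - θ * Complex.I * ∑ k, ((a k * c k : ℝ) : ℂ) *
          (((Real.sin (t * u ω) * Real.sin (w k ω) : ℝ) : ℂ) * e ω) := fun ω => by
      push_cast
      rw [sub_eq_add_neg]
      congr 1
      · ring
      · simp only [Finset.sum_mul, Finset.mul_sum, ← Finset.sum_neg_distrib]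
        refine Finset.sum_congr rfl fun k _ => ?_
        ring
    rw [integral_congr_ae (Eventually.of_forall e2)]
    rw [integral_sub (i1.const_mul _) ((integrable_finsetSum _ fun k _ =>
      (i2 k).const_mul _).const_mul _), integral_const_mul, integral_const_mul,
      integral_finsetSum _ fun k _ => (i2 k).const_mul _, mul_sub]
    simp_rw [integral_const_mul]
    congr 1
    · ring
    · rw [mul_left_comm, Finset.mul_sum]
      congr 2; ext k
      rw [← mul_assoc, ← Complex.ofReal_mul]
      congr 2
      simp only [hc]; field_simp
  · have : Measurable (Function.uncurry S) := by
      simp only [hS, Function.uncurry_def]; fun_prop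
    simp only [Function.uncurry_def] at this ⊢
    simp only [hF]; fun_prop
  · have h1 : Measurable (Function.uncurry S) := by
      simp only [hS, Function.uncurry_def]; fun_prop
    have h2 : Measurable (Function.uncurry S') := by
      simp only [hS', Function.uncurry_def]; fun_prop
    simp only [Function.uncurry_def] at h1 h2 ⊢
    simp only [hF']; fun_prop
  · intro y x
    have h1 : HasDerivAt (fun x : ℝ => ((Real.sin (t * x) : ℝ) : ℂ))
        ((Real.cos (t * x) * t : ℝ) : ℂ) x := by
      have : HasDerivAt (fun x => t * x) t x := by simpa using (hasDerivAt_id x).const_mul t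
      exact this.sin.ofReal_comp
    exact h1.mul (((hSd y x).ofReal_comp.mul_const Complex.I).cexp)
  · intro y x
    simp only [hF]
    rw [norm_mul, norm_cexp_ofReal_mul_I, mul_one, Complex.norm_real]
    exact Real.abs_sin_le_one _
  · intro y x
    simp only [hF']
    refine (norm_add_le _ _).trans (add_le_add ?_ ?_)
    · rw [norm_mul, norm_cexp_ofReal_mul_I, mul_one, Complex.norm_real, norm_mul]
      exact mul_le_of_le_one_left (norm_nonneg _) (Real.abs_cos_le_one _)
    · rw [norm_mul, norm_mul, norm_cexp_ofReal_mul_I, norm_mul, Complex.norm_I, one_mul, mul_one,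
        Complex.norm_real, Complex.norm_real]
      refine (mul_le_of_le_one_left (norm_nonneg _) (Real.abs_sin_le_one _)).trans ?_
      simp only [hS', norm_mul, Real.norm_eq_abs]
      gcongr
      refine (Finset.abs_sum_le_sum_abs _ _).trans (Finset.sum_le_sum fun k _ => ?_)
      rw [abs_mul, abs_mul, abs_neg]
      gcongr
      exact mul_le_of_le_one_left (abs_nonneg _) (Real.abs_sin_le_one _)

/-- Interpolation between `E[cos u ⋅ e]` and `E[cos u] E[e]`. -/
lemma hasDerivAt_interpolation (hV : IsGaussianSpace V P) {κ : Type*} [Fintype κ] {u : Ω → ℝ}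
    {w : κ → Ω → ℝ} (hu : u ∈ V) (hw : ∀ k, w k ∈ V) (a : κ → ℝ) (b θ t : ℝ) :
    HasDerivAt (fun t : ℝ => (Real.exp (-(1 - t ^ 2) * (∫ ω, u ω * u ω ∂P) / 2) : ℂ) *
      ∫ ω, (Real.cos (t * u ω)
        * Complex.exp ((θ * (∑ k, a k * Real.cos (w k ω) - b) : ℝ) * Complex.I)) ∂P)
      (θ * Complex.I * ∑ k, (a k * (∫ ω, u ω * w k ω ∂P)
        * Real.exp (-(1 - t ^ 2) * (∫ ω, u ω * u ω ∂P) / 2) : ℝ) *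
          ∫ ω, ((Real.sin (t * u ω) * Real.sin (w k ω) : ℝ)
        * Complex.exp ((θ * (∑ k, a k * Real.cos (w k ω) - b) : ℝ) * Complex.I)) ∂P) t := by
  have hmu := hV.measurable u hu
  have hmw := fun k => hV.measurable _ (hw k)
  obtain ⟨e, he⟩ : ∃ e : Ω → ℂ, e = fun ω =>
    Complex.exp ((θ * (∑ k, a k * Real.cos (w k ω) - b) : ℝ) * Complex.I) := ⟨_, rfl⟩
  have hee : ∀ ω, Complex.exp ((θ * (∑ k, a k * Real.cos (w k ω) - b) : ℝ) * Complex.I) = e ω :=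
    fun ω => by rw [he]
  have key := hV.integral_mul_sin_mul_cexp hu hw a b θ t
  simp only [hee] at key ⊢
  set D := ∫ ω, u ω * u ω ∂P with hD
  have hem : Measurable e := by rw [he]; fun_prop
  have he1 : ∀ ω, ‖e ω‖ = 1 := fun ω => by rw [← hee]; exact norm_cexp_ofReal_mul_I _
  have h1 : HasDerivAt (fun t : ℝ => ((Real.exp (-(1 - t ^ 2) * D / 2) : ℝ) : ℂ))
      ((Real.exp (-(1 - t ^ 2) * D / 2) * (t * D) : ℝ) : ℂ) t := by
    have : HasDerivAt (fun t : ℝ => -(1 - t ^ 2) * D / 2) (t * D) t := by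
      have := ((((hasDerivAt_id t).pow 2).const_sub 1).neg.mul_const D).div_const 2
      refine this.congr_deriv ?_
      simp; ring
    exact this.exp.ofReal_comp
  have h2 : HasDerivAt (fun t : ℝ => ∫ ω, ((Real.cos (t * u ω) : ℝ) : ℂ) * e ω ∂P)
      (∫ ω, ((-Real.sin (t * u ω) * u ω : ℝ) : ℂ) * e ω ∂P) t := by
    refine (hasDerivAt_integral_of_dominated_loc_of_deriv_le (bound := fun ω => |u ω|)
      (F' := fun t ω => ((-Real.sin (t * u ω) * u ω : ℝ) : ℂ) * e ω) (s := Set.univ)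
      Filter.univ_mem ?_ ?_ ?_ ?_ ?_ ?_).2
    · exact Eventually.of_forall fun t => by fun_prop
    · exact integrable_of_bound (by fun_prop) 1 fun ω => by
        rw [norm_mul, he1, mul_one, Complex.norm_real]; exact Real.abs_cos_le_one _
    · fun_prop
    · refine Eventually.of_forall fun ω t _ => ?_
      rw [norm_mul, he1, mul_one, Complex.norm_real, norm_mul, norm_neg]
      exact mul_le_of_le_one_left (norm_nonneg _) (Real.abs_sin_le_one _)
    · exact ((hV.memLp hu).integrable (by simp)).abs
    · refine Eventually.of_forall fun ω t _ => ?_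
      have : HasDerivAt (fun t => t * u ω) (u ω) t := by simpa using (hasDerivAt_id t).mul_const _
      exact this.cos.ofReal_comp.mul_const _
  refine (h1.mul h2).congr_deriv ?_
  have e3 : ∫ ω, ((-Real.sin (t * u ω) * u ω : ℝ) : ℂ) * e ω ∂P
      = -∫ ω, (u ω : ℂ) * (Real.sin (t * u ω) * e ω) ∂P := by
    rw [← integral_neg]; congr 1; ext ω; push_cast; ring
  rw [e3, key]
  have e4 : ∀ k, (((a k * (∫ ω, u ω * w k ω ∂P) * Real.exp (-(1 - t ^ 2) * D / 2)) : ℝ) : ℂ) =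
    (Real.exp (-(1 - t ^ 2) * D / 2) : ℂ) * ((a k * ∫ ω, u ω * w k ω ∂P : ℝ) : ℂ) := fun k => by
      push_cast; ring
  simp_rw [e4, mul_assoc, ← Finset.mul_sum]
  push_cast
  ring

end IsGaussianSpace

namespace IsGaussianSpace

variable {Ω : Type*} [MeasurableSpace Ω] {P : Measure Ω} [IsProbabilityMeasure P]
  {V : Submodule ℝ (Ω → ℝ)} {u w : Ω → ℝ}

lemma memLp_two_of_bound {f : Ω → ℝ} (hf : Measurable f) (C : ℝ) (h : ∀ ω, |f ω| ≤ C) :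
    MemLp f 2 P :=
  MemLp.of_bound hf.aestronglyMeasurable C (Eventually.of_forall h)

lemma memLp_cos (hf : Measurable u) : MemLp (fun ω => Real.cos (u ω)) 2 P :=
  memLp_two_of_bound (by fun_prop) 1 fun _ => Real.abs_cos_le_one _

lemma memLp_sin_mul_sin (hu : Measurable u) (hw : Measurable w) :
    MemLp (fun ω => Real.sin (u ω) * Real.sin (w ω)) 2 P :=
  memLp_two_of_bound (by fun_prop) 1 fun _ => by
    rw [abs_mul]
    exact mul_le_one₀ (Real.abs_sin_le_one _) (abs_nonneg _) (Real.abs_sin_le_one _)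

lemma abs_covariance_cos_le (hV : IsGaussianSpace V P) (hu : u ∈ V) (hw : w ∈ V) :
    |cov[fun ω => Real.cos (u ω), fun ω => Real.cos (w ω); P]| ≤ (∫ ω, u ω * w ω ∂P) ^ 2 / 2 := by
  rw [covariance_eq_sub (memLp_cos (hV.measurable u hu)) (memLp_cos (hV.measurable w hw))]
  exact hV.abs_cov_cos_le hu hw

lemma integral_add_mul (hV : IsGaussianSpace V P) {x y z : Ω → ℝ} (hx : x ∈ V) (hy : y ∈ V)
    (hz : z ∈ V) : ∫ ω, (x + y) ω * z ω ∂P = ∫ ω, x ω * z ω ∂P + ∫ ω, y ω * z ω ∂P := by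
  rw [← integral_add (hV.integrable_mul hx hz) (hV.integrable_mul hy hz)]
  congr 1; ext ω; simp; ring

lemma integral_sub_mul (hV : IsGaussianSpace V P) {x y z : Ω → ℝ} (hx : x ∈ V) (hy : y ∈ V)
    (hz : z ∈ V) : ∫ ω, (x - y) ω * z ω ∂P = ∫ ω, x ω * z ω ∂P - ∫ ω, y ω * z ω ∂P := by
  rw [← integral_sub (hV.integrable_mul hx hz) (hV.integrable_mul hy hz)]
  congr 1; ext ω; simp; ring

lemma integral_mul_add (hV : IsGaussianSpace V P) {x y z : Ω → ℝ} (hx : x ∈ V) (hy : y ∈ V)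
    (hz : z ∈ V) : ∫ ω, z ω * (x + y) ω ∂P = ∫ ω, z ω * x ω ∂P + ∫ ω, z ω * y ω ∂P := by
  rw [← integral_add (hV.integrable_mul hz hx) (hV.integrable_mul hz hy)]
  congr 1; ext ω; simp; ring

lemma integral_mul_sub (hV : IsGaussianSpace V P) {x y z : Ω → ℝ} (hx : x ∈ V) (hy : y ∈ V)
    (hz : z ∈ V) : ∫ ω, z ω * (x - y) ω ∂P = ∫ ω, z ω * x ω ∂P - ∫ ω, z ω * y ω ∂P := by
  rw [← integral_sub (hV.integrable_mul hz hx) (hV.integrable_mul hz hy)]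
  congr 1; ext ω; simp; ring

lemma abs_covariance_sin_mul_sin_le (hV : IsGaussianSpace V P) {x y z w : Ω → ℝ} (hx : x ∈ V)
    (hy : y ∈ V) (hz : z ∈ V) (hw : w ∈ V) :
    |cov[fun ω => Real.sin (x ω) * Real.sin (y ω), fun ω => Real.sin (z ω) * Real.sin (w ω); P]|
      ≤ ((∫ ω, x ω * z ω ∂P) ^ 2 + (∫ ω, x ω * w ω ∂P) ^ 2 + (∫ ω, y ω * z ω ∂P) ^ 2
        + (∫ ω, y ω * w ω ∂P) ^ 2) / 2 := by
  have e : ∀ x y : Ω → ℝ, (fun ω => Real.sin (x ω) * Real.sin (y ω))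
      = fun ω => 2⁻¹ * ((fun ω => Real.cos ((x - y) ω)) - (fun ω => Real.cos ((x + y) ω))) ω := by
    intro x y; ext ω
    simp [Real.cos_add, Real.cos_sub]; ring
  have hm : ∀ {x}, x ∈ V → MemLp (fun ω => Real.cos (x ω)) 2 P :=
    fun h => memLp_cos (hV.measurable _ h)
  have ha := V.sub_mem hx hy
  have hb := V.add_mem hx hy
  have hc := V.sub_mem hz hw
  have hd := V.add_mem hz hw
  rw [e, e, covariance_const_mul_left, covariance_const_mul_right,
    covariance_sub_left (hm ha) (hm hb) ((hm hc).sub (hm hd)),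
    covariance_sub_right (hm ha) (hm hc) (hm hd), covariance_sub_right (hm hb) (hm hc) (hm hd)]
  have h1 := hV.abs_covariance_cos_le ha hc
  have h2 := hV.abs_covariance_cos_le ha hd
  have h3 := hV.abs_covariance_cos_le hb hc
  have h4 := hV.abs_covariance_cos_le hb hd
  rw [hV.integral_mul_sub hz hw ha, hV.integral_sub_mul hx hy hz, hV.integral_sub_mul hx hy hw]
    at h1
  rw [hV.integral_mul_add hz hw ha, hV.integral_sub_mul hx hy hz, hV.integral_sub_mul hx hy hw]
    at h2
  rw [hV.integral_mul_sub hz hw hb, hV.integral_add_mul hx hy hz, hV.integral_add_mul hx hy hw]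
    at h3
  rw [hV.integral_mul_add hz hw hb, hV.integral_add_mul hx hy hz, hV.integral_add_mul hx hy hw]
    at h4
  rw [abs_le] at h1 h2 h3 h4 ⊢
  constructor <;> nlinarith

/-- Variance bound for weighted sums of products of sines. -/
lemma variance_sum_sin_mul_sin_le (hV : IsGaussianSpace V P) {κ : Type*} [Fintype κ]
    {X : κ → Ω → ℝ} (hX : ∀ k, X k ∈ V) (a : κ → ℝ) (e : κ → ℝ) (he : ∀ k, 0 ≤ e k ∧ e k ≤ 1)
    {t : ℝ} (ht : 0 ≤ t) (ht1 : t ≤ 1) {A B : ℝ}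
    (hA : ∀ i, ∑ k, |a k| * |∫ ω, X i ω * X k ω ∂P| ≤ A)
    (hB : ∑ i, ∑ k, |a i| * |a k| * (∫ ω, X i ω * X k ω ∂P) ^ 2 ≤ B) :
    Var[∑ p : κ × κ, fun ω => (a p.1 * a p.2 * (∫ ω, X p.1 ω * X p.2 ω ∂P) * e p.1)
      * (Real.sin (t * X p.1 ω) * Real.sin (X p.2 ω)); P] ≤ 2 * A ^ 2 * B := by
  set Γ : κ → κ → ℝ := fun i k => ∫ ω, X i ω * X k ω ∂P with hΓ
  have hsym : ∀ i k, Γ i k = Γ k i := fun i k => by simp only [hΓ]; simp_rw [mul_comm]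
  have hm := fun k => hV.measurable _ (hX k)
  have htX : ∀ i, t • X i ∈ V := fun i => V.smul_mem _ (hX i)
  have hL : ∀ p : κ × κ, MemLp (fun ω => Real.sin (t * X p.1 ω) * Real.sin (X p.2 ω)) 2 P :=
    fun p => memLp_sin_mul_sin ((hm _).const_mul t) (hm _)
  rw [variance_sum fun p => (hL p).const_mul _]
  have hcov : ∀ p q : κ × κ, |cov[fun ω => Real.sin (t * X p.1 ω) * Real.sin (X p.2 ω),
      fun ω => Real.sin (t * X q.1 ω) * Real.sin (X q.2 ω); P]|
      ≤ (Γ p.1 q.1 ^ 2 + Γ p.1 q.2 ^ 2 + Γ p.2 q.1 ^ 2 + Γ p.2 q.2 ^ 2) / 2 := by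
    intro p q
    have h := hV.abs_covariance_sin_mul_sin_le (htX p.1) (hX p.2) (htX q.1) (hX q.2)
    simp only [Pi.smul_apply, smul_eq_mul] at h
    refine h.trans ?_
    have h1 : ∫ ω, t * X p.1 ω * (t * X q.1 ω) ∂P = t ^ 2 * Γ p.1 q.1 := by
      simp only [hΓ]; rw [← integral_const_mul]; congr 1; ext ω; ring
    have h2 : ∫ ω, t * X p.1 ω * X q.2 ω ∂P = t * Γ p.1 q.2 := by
      simp only [hΓ]; rw [← integral_const_mul]; congr 1; ext ω; ring
    have h3 : ∫ ω, X p.2 ω * (t * X q.1 ω) ∂P = t * Γ p.2 q.1 := by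
      simp only [hΓ]; rw [← integral_const_mul]; congr 1; ext ω; ring
    rw [h1, h2, h3]
    have ht2 : t ^ 2 ≤ 1 := pow_le_one₀ ht ht1
    have ht4 : (t ^ 2) ^ 2 ≤ 1 := pow_le_one₀ (by positivity) ht2
    have : ∀ x s : ℝ, s ^ 2 ≤ 1 → (s * x) ^ 2 ≤ x ^ 2 := fun x s hs => by
      rw [mul_pow]; exact mul_le_of_le_one_left (sq_nonneg _) hs
    have i1 := this (Γ p.1 q.1) _ ht4
    have i2 := this (Γ p.1 q.2) _ ht2
    have i3 := this (Γ p.2 q.1) _ ht2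
    have i4 : (∫ ω, X p.2 ω * X q.2 ω ∂P) ^ 2 = Γ p.2 q.2 ^ 2 := rfl
    linarith
  set m : κ × κ → ℝ := fun p => |a p.1| * |a p.2| * |Γ p.1 p.2| with hmdef
  have hm0 : ∀ p, 0 ≤ m p := fun p => by positivity
  have hc : ∀ p : κ × κ, |a p.1 * a p.2 * Γ p.1 p.2 * e p.1| ≤ m p := fun p => by
    rw [abs_mul, abs_mul, abs_mul, abs_of_nonneg (he p.1).1]
    exact mul_le_of_le_one_right (hm0 p) (he p.1).2
  have hA0 : ∀ i, 0 ≤ ∑ k, |a k| * |Γ i k| := fun i => Finset.sum_nonneg fun _ _ => by positivity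
  have hf : ∀ i l, ∑ k, ∑ j, m (i, k) * m (l, j) ≤ |a i| * |a l| * A ^ 2 := fun i l => by
    have : ∑ k, ∑ j, m (i, k) * m (l, j)
        = |a i| * |a l| * ((∑ k, |a k| * |Γ i k|) * ∑ j, |a j| * |Γ l j|) := by
      rw [Finset.sum_mul_sum, Finset.mul_sum]
      refine Finset.sum_congr rfl fun k _ => ?_
      rw [Finset.mul_sum]
      refine Finset.sum_congr rfl fun j _ => ?_
      simp only [hmdef]; ring
    rw [this, pow_two]
    gcongr
    · exact (hA0 i).trans (hA i)
    · exact hA i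
    · exact hA l
  have hswap : ∀ p : κ × κ, m p.swap = m p := fun p => by
    simp only [hmdef, Prod.fst_swap, Prod.snd_swap, hsym p.2 p.1]; ring
  have hcore : ∑ p, ∑ q, m p * m q * Γ p.1 q.1 ^ 2 ≤ A ^ 2 * B := by
    calc ∑ p, ∑ q, m p * m q * Γ p.1 q.1 ^ 2
        = ∑ i, ∑ l, (∑ k, ∑ j, m (i, k) * m (l, j)) * Γ i l ^ 2 := by
          simp only [Fintype.sum_prod_type, Finset.sum_mul]
          refine Finset.sum_congr rfl fun i _ => ?_
          rw [Finset.sum_comm]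
      _ ≤ ∑ i, ∑ l, (|a i| * |a l| * A ^ 2) * Γ i l ^ 2 := by
          gcongr with i _ l _
          exact hf i l
      _ = A ^ 2 * ∑ i, ∑ l, |a i| * |a l| * Γ i l ^ 2 := by
          simp only [Finset.mul_sum]
          refine Finset.sum_congr rfl fun i _ => Finset.sum_congr rfl fun l _ => ?_
          ring
      _ ≤ A ^ 2 * B := by gcongr
  have hsw : ∀ F : κ × κ → ℝ, ∑ p, F p = ∑ p : κ × κ, F p.swap := fun F =>
    (Equiv.sum_comp (Equiv.prodComm κ κ) F).symm
  have hcore2 : ∑ p, ∑ q, m p * m q * Γ p.1 q.2 ^ 2 ≤ A ^ 2 * B := by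
    refine le_trans (le_of_eq ?_) hcore
    refine Finset.sum_congr rfl fun p _ => ?_
    rw [hsw]
    simp [hswap]
  have hcore3 : ∑ p, ∑ q, m p * m q * Γ p.2 q.1 ^ 2 ≤ A ^ 2 * B := by
    refine le_trans (le_of_eq ?_) hcore
    rw [hsw]
    simp [hswap]
  have hcore4 : ∑ p, ∑ q, m p * m q * Γ p.2 q.2 ^ 2 ≤ A ^ 2 * B := by
    refine le_trans (le_of_eq ?_) hcore2
    rw [hsw]
    simp [hswap]
  calc _ ≤ ∑ p, ∑ q, m p * m q * ((Γ p.1 q.1 ^ 2 + Γ p.1 q.2 ^ 2 + Γ p.2 q.1 ^ 2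
          + Γ p.2 q.2 ^ 2) / 2) := by
        refine Finset.sum_le_sum fun p _ => Finset.sum_le_sum fun q _ => ?_
        rw [covariance_const_mul_left, covariance_const_mul_right, ← mul_assoc]
        refine (le_abs_self _).trans ?_
        rw [abs_mul, abs_mul]
        gcongr
        · exact hc p
        · exact hc q
        · exact hcov p q
    _ = (∑ p, ∑ q, m p * m q * Γ p.1 q.1 ^ 2 + ∑ p, ∑ q, m p * m q * Γ p.1 q.2 ^ 2
        + ∑ p, ∑ q, m p * m q * Γ p.2 q.1 ^ 2 + ∑ p, ∑ q, m p * m q * Γ p.2 q.2 ^ 2) / 2 := by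
        simp only [← Finset.sum_add_distrib, Finset.sum_div]
        refine Finset.sum_congr rfl fun p _ => Finset.sum_congr rfl fun q _ => ?_
        ring
    _ ≤ _ := by linarith

end IsGaussianSpace

section General

variable {Ω : Type*} [MeasurableSpace Ω] {P : Measure Ω} [IsProbabilityMeasure P]

lemma integral_abs_sub_le_sqrt_variance {T : Ω → ℝ} (hT : MemLp T 2 P) :
    ∫ ω, |T ω - ∫ x, T x ∂P| ∂P ≤ √Var[T; P] := by
  have h1 : MemLp (fun ω => |T ω - ∫ x, T x ∂P|) 2 P := (hT.sub (memLp_const _)).abs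
  have h2 := variance_nonneg (fun ω => |T ω - ∫ x, T x ∂P|) P
  rw [variance_eq_sub h1] at h2
  apply Real.le_sqrt_of_sq_le
  rw [variance_eq_integral hT.aemeasurable]
  simp only [Pi.pow_apply, sq_abs] at h2
  linarith

lemma norm_integral_mul_sub_le {T : Ω → ℝ} (hT : MemLp T 2 P) {e : Ω → ℂ} (he : Measurable e)
    (he1 : ∀ ω, ‖e ω‖ ≤ 1) :
    ‖∫ ω, (T ω : ℂ) * e ω ∂P - (∫ ω, T ω ∂P : ℝ) * ∫ ω, e ω ∂P‖ ≤ √Var[T; P] := by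
  have hTi : Integrable T P := hT.integrable (by simp)
  have i1 : Integrable (fun ω => (T ω : ℂ) * e ω) P :=
    hTi.ofReal.mul_bdd (c := 1) he.aestronglyMeasurable (Eventually.of_forall he1)
  have i2 : Integrable e P := Integrable.of_bound he.aestronglyMeasurable 1
    (Eventually.of_forall he1)
  rw [← integral_const_mul, ← integral_sub i1 (i2.const_mul _)]
  refine (norm_integral_le_integral_norm _).trans ?_
  refine le_trans (integral_mono_of_nonneg (Eventually.of_forall fun _ => norm_nonneg _)
    ((hTi.sub (integrable_const _)).abs) (Eventually.of_forall fun ω => ?_))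
    (integral_abs_sub_le_sqrt_variance hT)
  simp only [← sub_mul, norm_mul]
  rw [← Complex.ofReal_sub, Complex.norm_real]
  exact mul_le_of_le_one_right (norm_nonneg _) (he1 ω)

end General

namespace IsGaussianSpace

variable {Ω : Type*} [MeasurableSpace Ω] {P : Measure Ω} [IsProbabilityMeasure P]
  {V : Submodule ℝ (Ω → ℝ)} {u w : Ω → ℝ}

lemma covariance_cos_eq (hV : IsGaussianSpace V P) (hu : u ∈ V) (hw : w ∈ V) :
    cov[fun ω => Real.cos (u ω), fun ω => Real.cos (w ω); P]
      = Real.exp (-(∫ ω, u ω * u ω ∂P + ∫ ω, w ω * w ω ∂P) / 2)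
        * (Real.cosh (∫ ω, u ω * w ω ∂P) - 1) := by
  rw [covariance_eq_sub (memLp_cos (hV.measurable u hu)) (memLp_cos (hV.measurable w hw)),
    hV.integral_cos hu, hV.integral_cos hw, ← Real.exp_add, mul_sub_one,
    ← hV.integral_cos_mul_cos hu hw]
  simp only [Pi.mul_apply]
  congr 2; ring

lemma variance_sum_cos (hV : IsGaussianSpace V P) {κ : Type*} [Fintype κ] {X : κ → Ω → ℝ}
    (hX : ∀ k, X k ∈ V) (a : κ → ℝ) :
    Var[∑ k, fun ω => a k * Real.cos (X k ω); P]
      = ∑ i, ∑ k, a i * a k * (Real.exp (-(∫ ω, X i ω * X i ω ∂P + ∫ ω, X k ω * X k ω ∂P) / 2)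
        * (Real.cosh (∫ ω, X i ω * X k ω ∂P) - 1)) := by
  rw [variance_sum fun k => (memLp_cos (hV.measurable _ (hX k))).const_mul _]
  refine Finset.sum_congr rfl fun i _ => Finset.sum_congr rfl fun k _ => ?_
  rw [covariance_const_mul_left, covariance_const_mul_right, hV.covariance_cos_eq (hX i) (hX k)]
  ring

/-- The first-order Stein identity for cosine sums, up to the error `√(2 A² B)`. -/
lemma norm_integral_sum_cos_mul_cexp_sub_le (hV : IsGaussianSpace V P) {κ : Type*} [Fintype κ]
    {X : κ → Ω → ℝ} (hX : ∀ k, X k ∈ V) (a : κ → ℝ) {A B : ℝ}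
    (hA : ∀ i, ∑ k, |a k| * |∫ ω, X i ω * X k ω ∂P| ≤ A)
    (hB : ∑ i, ∑ k, |a i| * |a k| * (∫ ω, X i ω * X k ω ∂P) ^ 2 ≤ B) (b v : ℝ)
    (hb : b = ∑ k, a k * Real.exp (-(∫ ω, X k ω * X k ω ∂P) / 2))
    (hv : v = Var[∑ k, fun ω => a k * Real.cos (X k ω); P]) (θ : ℝ) :
    ‖∫ ω, ((∑ k, a k * Real.cos (X k ω) - b : ℝ) : ℂ) *
        Complex.exp ((θ * (∑ k, a k * Real.cos (X k ω) - b) : ℝ) * Complex.I) ∂P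
      - θ * Complex.I * v *
        ∫ ω, Complex.exp ((θ * (∑ k, a k * Real.cos (X k ω) - b) : ℝ) * Complex.I) ∂P‖
      ≤ |θ| * √(2 * A ^ 2 * B) := by
  have hm := fun k => hV.measurable _ (hX k)
  have hder := fun i t => hV.hasDerivAt_interpolation (hX i) hX a b θ t
  obtain ⟨e, he⟩ : ∃ e : Ω → ℂ, e = fun ω =>
    Complex.exp ((θ * (∑ k, a k * Real.cos (X k ω) - b) : ℝ) * Complex.I) := ⟨_, rfl⟩
  have hee : ∀ ω, Complex.exp ((θ * (∑ k, a k * Real.cos (X k ω) - b) : ℝ) * Complex.I) = e ω :=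
    fun ω => by rw [he]
  simp only [hee] at hder ⊢
  have hem : Measurable e := by rw [he]; fun_prop
  have he1 : ∀ ω, ‖e ω‖ = 1 := fun ω => by rw [← hee]; exact norm_cexp_ofReal_mul_I _
  clear he hee
  have hei : Integrable e P := integrable_of_bound hem.aestronglyMeasurable 1 fun ω => (he1 ω).le
  rw [hV.variance_sum_cos hX] at hv
  set Γ : κ → κ → ℝ := fun i k => ∫ ω, X i ω * X k ω ∂P with hΓ
  set φ : ℂ := ∫ ω, e ω ∂P with hφ
  set E : κ → ℝ → ℝ := fun i t => Real.exp (-(1 - t ^ 2) * Γ i i / 2) with hE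
  set M : ℝ → ℝ := fun t => ∑ i, ∑ k, a i * a k * (Real.exp (-(Γ i i + Γ k k) / 2)
        * (Real.cosh (t * Γ i k) - 1)) with hM
  set M' : ℝ → ℝ := fun t => ∑ i, ∑ k, a i * a k * (Real.exp (-(Γ i i + Γ k k) / 2)
        * (Real.sinh (t * Γ i k) * Γ i k)) with hM'
  have hMd : ∀ t, HasDerivAt M (M' t) t := fun t => by
    refine HasDerivAt.fun_sum fun i _ => HasDerivAt.fun_sum fun k _ => ?_
    refine HasDerivAt.const_mul _ (HasDerivAt.const_mul _ (HasDerivAt.sub_const 1 ?_))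
    have : HasDerivAt (fun t => t * Γ i k) (Γ i k) t := by
      simpa using (hasDerivAt_id t).mul_const (Γ i k)
    exact this.cosh
  set T : ℝ → Ω → ℝ := fun t => ∑ p : κ × κ, fun ω => (a p.1 * a p.2 * Γ p.1 p.2 * E p.1 t)
      * (Real.sin (t * X p.1 ω) * Real.sin (X p.2 ω)) with hT
  have hL : ∀ t, ∀ p : κ × κ, MemLp (fun ω => Real.sin (t * X p.1 ω) * Real.sin (X p.2 ω)) 2 P :=
    fun t p => memLp_sin_mul_sin ((hm _).const_mul t) (hm _)
  have hTL : ∀ t, MemLp (T t) 2 P := fun t =>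
    memLp_finsetSum' _ fun p _ => (hL t p).const_mul _
  have hTa : ∀ t ω, T t ω = ∑ i, ∑ k, (a i * a k * Γ i k * E i t)
      * (Real.sin (t * X i ω) * Real.sin (X k ω)) := fun t ω => by
    simp only [hT, Finset.sum_apply, Fintype.sum_prod_type]
  have hTint : ∀ t, ∫ ω, T t ω ∂P = M' t := fun t => by
    simp only [hTa, hM']
    rw [integral_finsetSum _ fun i _ => integrable_finsetSum _ fun k _ =>
      ((hL t (i, k)).integrable (by simp)).const_mul _]
    refine Finset.sum_congr rfl fun i _ => ?_
    rw [integral_finsetSum _ fun k _ => ((hL t (i, k)).integrable (by simp)).const_mul _]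
    refine Finset.sum_congr rfl fun k _ => ?_
    rw [integral_const_mul]
    have h := hV.integral_sin_mul_sin (V.smul_mem t (hX i)) (hX k)
    simp only [Pi.smul_apply, smul_eq_mul] at h
    have h1 : ∫ ω, t * X i ω * (t * X i ω) ∂P = t ^ 2 * Γ i i := by
      simp only [hΓ]; rw [← integral_const_mul]; congr 1; ext ω; ring
    have h2 : ∫ ω, t * X i ω * X k ω ∂P = t * Γ i k := by
      simp only [hΓ]; rw [← integral_const_mul]; congr 1; ext ω; ring
    have h3 : ∫ ω, X k ω * X k ω ∂P = Γ k k := rfl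
    rw [h, h1, h2, h3]
    have h4 : Real.exp (-(Γ i i + Γ k k) / 2)
        = E i t * Real.exp (-(t ^ 2 * Γ i i + Γ k k) / 2) := by
      simp only [hE]; rw [← Real.exp_add]; congr 1; ring
    rw [h4]; ring
  have hTe : ∀ t, ∫ ω, (T t ω : ℂ) * e ω ∂P = ∑ i, (a i : ℂ) * ∑ k, ((a k * Γ i k * E i t : ℝ) : ℂ)
      * ∫ ω, ((Real.sin (t * X i ω) * Real.sin (X k ω) : ℝ) : ℂ) * e ω ∂P := fun t => by
    have hi : ∀ i k, Integrable
        (fun ω => ((Real.sin (t * X i ω) * Real.sin (X k ω) : ℝ) : ℂ) * e ω) P := fun i k =>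
      ((hL t (i, k)).integrable (by simp)).ofReal.mul_bdd (c := 1) hem.aestronglyMeasurable
        (Eventually.of_forall fun ω => (he1 ω).le)
    have : ∀ ω, (T t ω : ℂ) * e ω = ∑ i, (a i : ℂ) * ∑ k, ((a k * Γ i k * E i t : ℝ) : ℂ)
      * (((Real.sin (t * X i ω) * Real.sin (X k ω) : ℝ) : ℂ) * e ω) := fun ω => by
      rw [hTa]
      push_cast
      simp only [Finset.sum_mul, Finset.mul_sum]
      refine Finset.sum_congr rfl fun i _ => Finset.sum_congr rfl fun k _ => ?_
      ring
    rw [integral_congr_ae (Eventually.of_forall this), integral_finsetSum _ fun i _ =>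
      (integrable_finsetSum _ fun k _ => (hi i k).const_mul _).const_mul _]
    refine Finset.sum_congr rfl fun i _ => ?_
    rw [integral_const_mul, integral_finsetSum _ fun k _ => (hi i k).const_mul _]
    simp_rw [integral_const_mul]
  set g : ℝ → ℂ := fun t =>
    ∑ i, (a i : ℂ) * ((E i t : ℂ) * ∫ ω, (Real.cos (t * X i ω) : ℂ) * e ω ∂P)
    - θ * Complex.I * φ * M t with hg
  have hgd : ∀ t, HasDerivAt g
      (θ * Complex.I * (∫ ω, (T t ω : ℂ) * e ω ∂P - (∫ ω, T t ω ∂P : ℝ) * φ)) t := fun t => by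
    rw [hTint, hTe]
    refine ((HasDerivAt.fun_sum fun i _ => (hder i t).const_mul (a i : ℂ)).sub
      ((hMd t).ofReal_comp.const_mul (θ * Complex.I * φ))).congr_deriv ?_
    rw [mul_sub, Finset.mul_sum]
    congr 1
    · refine Finset.sum_congr rfl fun i _ => ?_
      exact mul_left_comm _ _ _
    · ring
  have hbd : ∀ t ∈ Set.Ico (0 : ℝ) 1, ‖(θ * Complex.I *
      (∫ ω, (T t ω : ℂ) * e ω ∂P - (∫ ω, T t ω ∂P : ℝ) * φ) : ℂ)‖ ≤ |θ| * √(2 * A ^ 2 * B) := by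
    intro t ht
    rw [norm_mul, norm_mul, Complex.norm_I, mul_one, Complex.norm_real, Real.norm_eq_abs]
    gcongr
    refine (norm_integral_mul_sub_le (hTL t) hem fun ω => (he1 ω).le).trans (Real.sqrt_le_sqrt ?_)
    refine hV.variance_sum_sin_mul_sin_le hX a (fun i => E i t) (fun k => ⟨(Real.exp_pos _).le, ?_⟩)
      ht.1 ht.2.le hA hB
    refine Real.exp_le_one_iff.2 ?_
    have h1 : 0 ≤ Γ k k := integral_self_nonneg _
    have h2 : t ^ 2 ≤ 1 := pow_le_one₀ ht.1 ht.2.le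
    nlinarith [mul_nonneg (sub_nonneg.2 h2) h1]
  have hmv := norm_image_sub_le_of_norm_deriv_le_segment_01' (f := g)
    (fun t _ => (hgd t).hasDerivWithinAt) hbd
  refine le_trans (le_of_eq ?_) hmv
  congr 1
  have hM0 : M 0 = 0 := by simp [hM]
  have hM1 : M 1 = v := by simp only [hM, hv, one_mul, hΓ]
  simp only [hg, hM0, hM1]
  simp only [hE, one_pow, sub_self, neg_zero, zero_mul, zero_div, Real.exp_zero,
    Complex.ofReal_one, one_mul, Complex.ofReal_zero, mul_zero, sub_zero, Real.cos_zero]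
  have hic : ∀ i, Integrable (fun ω => (Real.cos (X i ω) : ℂ) * e ω) P := fun i =>
    (integrable_cos (hm i)).ofReal.mul_bdd (c := 1) hem.aestronglyMeasurable
        (Eventually.of_forall fun ω => (he1 ω).le)
  have h1 : ∫ ω, ((∑ k, a k * Real.cos (X k ω) - b : ℝ) : ℂ) * e ω ∂P
      = ∑ i, (a i : ℂ) * ∫ ω, (Real.cos (X i ω) : ℂ) * e ω ∂P - b * φ := by
    have : ∀ ω, ((∑ k, a k * Real.cos (X k ω) - b : ℝ) : ℂ) * e ω
      = ∑ i, (a i : ℂ) * ((Real.cos (X i ω) : ℂ) * e ω) - b * e ω := fun ω => by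
      push_cast
      rw [sub_mul, Finset.sum_mul]
      simp only [mul_assoc]
    rw [integral_congr_ae (Eventually.of_forall this), integral_sub
      (integrable_finsetSum _ fun i _ => (hic i).const_mul _) (hei.const_mul _),
      integral_finsetSum _ fun i _ => (hic i).const_mul _]
    simp_rw [integral_const_mul, hφ]
  have h2 : ∑ i, (a i : ℂ) * ((Real.exp (-(1 - 0 ^ 2) * Γ i i / 2) : ℝ) * ∫ ω, e ω ∂P) = b * φ := by
    rw [hb, Complex.ofReal_sum, Finset.sum_mul]
    refine Finset.sum_congr rfl fun i _ => ?_
    rw [← mul_assoc, ← Complex.ofReal_mul]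
    congr 4
    norm_num
    rfl
  rw [h1, h2]
  ring

/-- Quantitative normal approximation for cosine sums of Gaussian variables. -/
lemma norm_charFun_sum_cos_sub_le (hV : IsGaussianSpace V P) {κ : Type*} [Fintype κ]
    {X : κ → Ω → ℝ} (hX : ∀ k, X k ∈ V) (a : κ → ℝ) {A B : ℝ}
    (hA : ∀ i, ∑ k, |a k| * |∫ ω, X i ω * X k ω ∂P| ≤ A)
    (hB : ∑ i, ∑ k, |a i| * |a k| * (∫ ω, X i ω * X k ω ∂P) ^ 2 ≤ B) (θ : ℝ) :
    ‖∫ ω, Complex.exp ((θ * (∑ k, a k * Real.cos (X k ω)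
        - ∑ k, a k * Real.exp (-(∫ ω, X k ω * X k ω ∂P) / 2)) : ℝ) * Complex.I) ∂P
      - Real.exp (-θ ^ 2 * Var[∑ k, fun ω => a k * Real.cos (X k ω); P] / 2)‖
      ≤ θ ^ 2 * √(2 * A ^ 2 * B) := by
  have hm := fun k => hV.measurable _ (hX k)
  have key := fun θ => hV.norm_integral_sum_cos_mul_cexp_sub_le hX a hA hB _ _ rfl rfl θ
  set ε := √(2 * A ^ 2 * B) with hε
  set b := ∑ k, a k * Real.exp (-(∫ ω, X k ω * X k ω ∂P) / 2) with hb
  set v := Var[∑ k, fun ω => a k * Real.cos (X k ω); P] with hv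
  have hv0 : 0 ≤ v := variance_nonneg _ _
  set S : Ω → ℝ := fun ω => ∑ k, a k * Real.cos (X k ω) - b with hS
  have hSm : Measurable S := by fun_prop
  have hSb : ∀ ω, |S ω| ≤ ∑ k, |a k| + |b| := fun ω => by
    refine (abs_sub _ _).trans (add_le_add_left ((Finset.abs_sum_le_sum_abs _ _).trans
      (Finset.sum_le_sum fun k _ => ?_)) _)
    rw [abs_mul]
    exact mul_le_of_le_one_right (abs_nonneg _) (Real.abs_cos_le_one _)
  change ∀ θ : ℝ, ‖∫ ω, (S ω : ℂ) * Complex.exp ((θ * S ω : ℝ) * Complex.I) ∂P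
    - θ * Complex.I * v * ∫ ω, Complex.exp ((θ * S ω : ℝ) * Complex.I) ∂P‖ ≤ |θ| * ε at key
  change ‖∫ ω, Complex.exp ((θ * S ω : ℝ) * Complex.I) ∂P - Real.exp (-θ ^ 2 * v / 2)‖ ≤ θ ^ 2 * ε
  set φ : ℝ → ℂ := fun θ => ∫ ω, Complex.exp ((θ * S ω : ℝ) * Complex.I) ∂P with hφ
  set φ' : ℝ → ℂ := fun θ => ∫ ω, (S ω : ℂ) * Complex.exp ((θ * S ω : ℝ) * Complex.I) ∂P with hφ'
  have hφd : ∀ t, HasDerivAt φ (Complex.I * φ' t) t := fun t => by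
    have := (hasDerivAt_integral_of_dominated_loc_of_deriv_le (μ := P) (x₀ := t)
      (bound := fun _ => ∑ k, |a k| + |b|)
      (F := fun t ω => Complex.exp ((t * S ω : ℝ) * Complex.I))
      (F' := fun t ω => Complex.exp ((t * S ω : ℝ) * Complex.I) * ((S ω : ℝ) * Complex.I))
      (s := Set.univ) Filter.univ_mem ?_ ?_ ?_ ?_ ?_ ?_).2
    · refine this.congr_deriv ?_
      simp only [hφ']
      rw [← integral_const_mul]
      congr 1; ext ω; ring
    · exact Eventually.of_forall fun t => by fun_prop
    · exact integrable_of_bound (by fun_prop) 1 fun ω => (norm_cexp_ofReal_mul_I _).le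
    · fun_prop
    · refine Eventually.of_forall fun ω t _ => ?_
      rw [norm_mul, norm_cexp_ofReal_mul_I, norm_mul, Complex.norm_I, one_mul, mul_one,
        Complex.norm_real]
      exact hSb ω
    · exact integrable_const _
    · refine Eventually.of_forall fun ω t _ => ?_
      have : HasDerivAt (fun t => t * S ω) (S ω) t := by simpa using (hasDerivAt_id t).mul_const _
      exact (this.ofReal_comp.mul_const Complex.I).cexp
  set η : ℝ → ℂ := fun s => φ (s * θ) * (Real.exp (s ^ 2 * (θ ^ 2 * v / 2)) : ℝ) with hη
  have hηd : ∀ s, HasDerivAt η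
      (θ * Complex.I * (φ' (s * θ) - (s * θ : ℝ) * Complex.I * v * φ (s * θ))
      * (Real.exp (s ^ 2 * (θ ^ 2 * v / 2)) : ℝ)) s := fun s => by
    have h1 : HasDerivAt (fun s => s * θ) θ s := by simpa using (hasDerivAt_id s).mul_const θ
    have h2 : HasDerivAt (fun s : ℝ => φ (s * θ)) (θ • (Complex.I * φ' (s * θ))) s :=
      HasDerivAt.scomp (h := fun s => s * θ) s (hφd (s * θ)) h1
    have h3 : HasDerivAt (fun s : ℝ => s ^ 2 * (θ ^ 2 * v / 2)) (2 * s * (θ ^ 2 * v / 2)) s := by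
      simpa using ((hasDerivAt_id s).pow 2).mul_const (θ ^ 2 * v / 2)
    refine (h2.mul h3.exp.ofReal_comp).congr_deriv ?_
    rw [Complex.real_smul]
    push_cast
    linear_combination ((θ : ℂ) ^ 2 * s * v * φ (s * θ)
      * Complex.exp (s ^ 2 * (θ ^ 2 * v / 2))) * Complex.I_sq
  have hmv := norm_image_sub_le_of_norm_deriv_le_segment_01' (f := η)
    (C := θ ^ 2 * ε * Real.exp (θ ^ 2 * v / 2))
    (fun t _ => (hηd t).hasDerivWithinAt) fun s hs => ?_
  · simp only [hη, one_mul, one_pow, zero_mul, ne_eq, OfNat.ofNat_ne_zero, not_false_eq_true,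
      zero_pow, Real.exp_zero, Complex.ofReal_one, mul_one] at hmv
    have h0 : φ 0 = 1 := by simp [hφ]
    rw [h0] at hmv
    have h4 : φ θ - Real.exp (-θ ^ 2 * v / 2)
        = (φ θ * (Real.exp (θ ^ 2 * v / 2) : ℝ) - 1) * (Real.exp (-θ ^ 2 * v / 2) : ℝ) := by
      rw [sub_mul, mul_assoc, ← Complex.ofReal_mul, ← Real.exp_add]
      simp [← add_div]
    have h5 : Real.exp (θ ^ 2 * v / 2) * Real.exp (-θ ^ 2 * v / 2) = 1 := by
      rw [← Real.exp_add]; simp [← add_div]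
    rw [h4, norm_mul, Complex.norm_real, Real.norm_eq_abs, abs_of_pos (Real.exp_pos _)]
    calc _ ≤ (θ ^ 2 * ε * Real.exp (θ ^ 2 * v / 2)) * Real.exp (-θ ^ 2 * v / 2) := by gcongr
      _ = _ := by rw [mul_assoc, h5, mul_one]
  · rw [norm_mul, norm_mul, norm_mul, Complex.norm_I, mul_one, Complex.norm_real,
      Complex.norm_real, Real.norm_eq_abs, Real.norm_eq_abs, abs_of_pos (Real.exp_pos _)]
    have h1 : s ^ 2 ≤ 1 := pow_le_one₀ hs.1 hs.2.le
    have h2 : |θ| * ‖φ' (s * θ) - (s * θ : ℝ) * Complex.I * v * φ (s * θ)‖ ≤ θ ^ 2 * ε := by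
      calc _ ≤ |θ| * (|s * θ| * ε) := by gcongr; exact key _
        _ = s * (θ ^ 2 * ε) := by rw [abs_mul, abs_of_nonneg hs.1, ← sq_abs θ]; ring
        _ ≤ 1 * (θ ^ 2 * ε) := by gcongr; exact hs.2.le
        _ = _ := one_mul _
    gcongr
    exact mul_le_of_le_one_left (by positivity) h1

end IsGaussianSpace

section Schur

variable {κ : Type*} [Fintype κ]

lemma Matrix.posSemidef_iff_sum {M : Matrix κ κ ℝ} :
    M.PosSemidef ↔ (∀ i j, M i j = M j i) ∧ ∀ x : κ → ℝ, 0 ≤ ∑ i, ∑ j, x i * x j * M i j := by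
  rw [Matrix.posSemidef_iff_dotProduct_mulVec]
  refine and_congr ⟨fun h i j => ?_, fun h => ?_⟩ (forall_congr' fun x => ?_)
  · simpa using h.apply j i
  · exact Matrix.IsHermitian.ext fun i j => by simpa using h j i
  · have : star x ⬝ᵥ M.mulVec x = ∑ i, ∑ j, x i * x j * M i j := by
      simp only [dotProduct, Matrix.mulVec, Pi.star_apply, star_trivial, Finset.mul_sum]
      refine Finset.sum_congr rfl fun i _ => Finset.sum_congr rfl fun j _ => ?_
      ring
    rw [this]

lemma Matrix.PosSemidef.map_pow {M : Matrix κ κ ℝ} (hM : M.PosSemidef) (n : ℕ) :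
    (M.map (· ^ n)).PosSemidef := by
  induction n with
  | zero =>
    rw [Matrix.posSemidef_iff_sum]
    refine ⟨fun i j => by simp, fun x => ?_⟩
    simp only [Matrix.map_apply, pow_zero, mul_one]
    rw [← Finset.sum_mul_sum]
    exact mul_self_nonneg _
  | succ n ih =>
    have e : M.map (· ^ (n + 1)) = (M.map (· ^ n)).hadamard M := by
      ext i j
      simp [pow_succ]
    rw [e]
    exact ih.hadamard hM

/-- Schur-type comparison of entrywise powers. -/
lemma abs_sum_pow_le (Q B : Matrix κ κ ℝ) (ρ : ℝ) (hQ : ∀ i j, Q i j = Q j i)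
    (h : ∀ x y : κ → ℝ, |∑ i, ∑ j, x i * y j * B i j|
      ≤ ρ * (∑ i, ∑ j, x i * x j * Q i j + ∑ i, ∑ j, y i * y j * Q i j) / 2)
    (d : κ → ℝ) (n : ℕ) :
    |∑ i, ∑ j, d i * d j * B i j ^ n| ≤ ρ ^ n * ∑ i, ∑ j, d i * d j * Q i j ^ n := by
  have hM : (Matrix.fromBlocks (ρ • Q) B B.transpose (ρ • Q)).PosSemidef := by
    rw [Matrix.posSemidef_iff_sum]
    constructor
    · rintro (i | i) (j | j) <;> simp [hQ i j]
    · intro x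
      simp only [Fintype.sum_sum_type, Matrix.fromBlocks_apply₁₁, Matrix.fromBlocks_apply₁₂,
        Matrix.fromBlocks_apply₂₁, Matrix.fromBlocks_apply₂₂, Matrix.smul_apply, smul_eq_mul,
        Matrix.transpose_apply, Finset.sum_add_distrib]
      have h1 := neg_le_of_abs_le (h (fun i => x (Sum.inl i)) (fun i => x (Sum.inr i)))
      have h2 : ∑ i, ∑ j, x (Sum.inr i) * x (Sum.inl j) * B j i
          = ∑ i, ∑ j, x (Sum.inl i) * x (Sum.inr j) * B i j := by
        rw [Finset.sum_comm]
        refine Finset.sum_congr rfl fun i _ => Finset.sum_congr rfl fun j _ => ?_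
        ring
      have h3 : ∀ z : κ → ℝ, ∑ i, ∑ j, z i * z j * (ρ * Q i j)
          = ρ * ∑ i, ∑ j, z i * z j * Q i j := fun z => by
        simp only [Finset.mul_sum]
        refine Finset.sum_congr rfl fun i _ => Finset.sum_congr rfl fun j _ => ?_
        ring
      rw [h2, h3 fun i => x (Sum.inl i), h3 fun i => x (Sum.inr i)]
      linarith
  have hP := (Matrix.posSemidef_iff_sum.1 (hM.map_pow n)).2
  have key : ∀ s : ℝ, s ^ 2 = 1 → 0 ≤ 2 * (ρ ^ n * ∑ i, ∑ j, d i * d j * Q i j ^ n)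
      + 2 * s * ∑ i, ∑ j, d i * d j * B i j ^ n := fun s hs => by
    refine (hP (Sum.elim d fun i => s * d i)).trans (le_of_eq ?_)
    simp only [Fintype.sum_sum_type, Matrix.map_apply, Matrix.fromBlocks_apply₁₁,
      Matrix.fromBlocks_apply₁₂, Matrix.fromBlocks_apply₂₁, Matrix.fromBlocks_apply₂₂,
      Matrix.smul_apply, smul_eq_mul, Matrix.transpose_apply, Finset.sum_add_distrib,
      Sum.elim_inl, Sum.elim_inr, mul_pow]
    have h2 : ∑ i, ∑ j, s * d i * d j * B j i ^ n
        = s * ∑ i, ∑ j, d i * d j * B i j ^ n := by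
      rw [Finset.sum_comm]
      simp only [Finset.mul_sum]
      refine Finset.sum_congr rfl fun i _ => Finset.sum_congr rfl fun j _ => ?_
      ring
    have h3 : ∑ i, ∑ j, d i * (s * d j) * B i j ^ n
        = s * ∑ i, ∑ j, d i * d j * B i j ^ n := by
      simp only [Finset.mul_sum]
      refine Finset.sum_congr rfl fun i _ => Finset.sum_congr rfl fun j _ => ?_
      ring
    have h4 : ∑ i, ∑ j, d i * d j * (ρ ^ n * Q i j ^ n)
        = ρ ^ n * ∑ i, ∑ j, d i * d j * Q i j ^ n := by
      simp only [Finset.mul_sum]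
      refine Finset.sum_congr rfl fun i _ => Finset.sum_congr rfl fun j _ => ?_
      ring
    have h5 : ∑ i, ∑ j, s * d i * (s * d j) * (ρ ^ n * Q i j ^ n)
        = ρ ^ n * ∑ i, ∑ j, d i * d j * Q i j ^ n := by
      simp only [Finset.mul_sum]
      refine Finset.sum_congr rfl fun i _ => Finset.sum_congr rfl fun j _ => ?_
      linear_combination (d i * d j * (ρ ^ n * Q i j ^ n)) * hs
    rw [h2, h3, h4, h5]
    ring
  have k1 := key 1 (by norm_num)
  have k2 := key (-1) (by norm_num)
  rw [abs_le]
  constructor <;> linarith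

/-- Comparison of the bilinear forms of `cosh - 1` and `cosh`. -/
lemma abs_sum_cosh_sub_one_le (Q B : Matrix κ κ ℝ) {ρ : ℝ} (hρ0 : 0 ≤ ρ) (hρ1 : ρ ≤ 1)
    (hQ : ∀ i j, Q i j = Q j i) (hQ0 : ∀ x : κ → ℝ, 0 ≤ ∑ i, ∑ j, x i * x j * Q i j)
    (h : ∀ x y : κ → ℝ, |∑ i, ∑ j, x i * y j * B i j|
      ≤ ρ * (∑ i, ∑ j, x i * x j * Q i j + ∑ i, ∑ j, y i * y j * Q i j) / 2)
    (d : κ → ℝ) :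
    |∑ i, ∑ j, d i * d j * (Real.cosh (B i j) - 1)|
      ≤ ρ ^ 2 * ∑ i, ∑ j, d i * d j * Real.cosh (Q i j) := by
  have hs : ∀ M : Matrix κ κ ℝ, HasSum (fun n : ℕ => (∑ i, ∑ j, d i * d j * M i j ^ (2 * n))
      / (2 * n).factorial) (∑ i, ∑ j, d i * d j * Real.cosh (M i j)) := fun M => by
    have : HasSum (fun n : ℕ => ∑ i, ∑ j, d i * d j * (M i j ^ (2 * n) / (2 * n).factorial))
        (∑ i, ∑ j, d i * d j * Real.cosh (M i j)) :=
      hasSum_sum fun i _ => hasSum_sum fun j _ => (Real.hasSum_cosh (M i j)).mul_left _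
    convert this using 2 with n
    simp only [Finset.sum_div]
    refine Finset.sum_congr rfl fun i _ => Finset.sum_congr rfl fun j _ => ?_
    ring
  have hB := (hasSum_nat_add_iff' 1).2 (hs B)
  have hQ' := (hasSum_nat_add_iff' 1).2 (hs Q)
  simp only [Finset.range_one, Finset.sum_singleton, mul_zero, pow_zero, Nat.factorial_zero,
    Nat.cast_one, div_one, mul_one] at hB hQ'
  have e1 : ∑ i, ∑ j, d i * d j * (Real.cosh (B i j) - 1)
      = ∑ i, ∑ j, d i * d j * Real.cosh (B i j) - ∑ i, ∑ j, d i * d j := by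
    simp only [mul_sub, mul_one, Finset.sum_sub_distrib]
  have h0 : 0 ≤ ∑ i, ∑ j, d i * d j := by rw [← Finset.sum_mul_sum]; exact mul_self_nonneg _
  have hb : ∀ n : ℕ, ‖(∑ i, ∑ j, d i * d j * B i j ^ (2 * (n + 1))) / (2 * (n + 1)).factorial‖
      ≤ ρ ^ 2 * ((∑ i, ∑ j, d i * d j * Q i j ^ (2 * (n + 1))) / (2 * (n + 1)).factorial) := by
    intro n
    have h1 := abs_sum_pow_le Q B ρ hQ h d (2 * (n + 1))
    have h2 : 0 ≤ ∑ i, ∑ j, d i * d j * Q i j ^ (2 * (n + 1)) := by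
      exact (Matrix.posSemidef_iff_sum.1
        ((Matrix.posSemidef_iff_sum.2 ⟨hQ, hQ0⟩).map_pow (2 * (n + 1)))).2 d
    have h3 : ρ ^ (2 * (n + 1)) ≤ ρ ^ 2 := pow_le_pow_of_le_one hρ0 hρ1 (by omega)
    rw [norm_div, Real.norm_eq_abs, Real.norm_natCast, ← mul_div_assoc]
    gcongr
    exact h1.trans (by gcongr)
  rw [e1, ← hB.tsum_eq]
  refine (tsum_of_norm_bounded (hQ'.mul_left (ρ ^ 2)) hb).trans ?_
  have := mul_nonneg (sq_nonneg ρ) h0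
  rw [mul_sub]
  linarith

end Schur

section Sums

lemma sum_range_intCast_sub_le {g : ℤ → ℝ} (hg0 : ∀ k, 0 ≤ g k) (hg : Summable g) (N : ℕ) (j : ℤ) :
    ∑ m ∈ Finset.range N, g ((m : ℤ) - j) ≤ ∑' k, g k := by
  have hinj : Function.Injective fun m : ℕ => (m : ℤ) - j := fun a b h => by simpa using h
  rw [← Finset.sum_image (f := g) (fun a _ b _ h => hinj h)]
  exact hg.sum_le_tsum _ fun k _ => hg0 k

lemma sum_range_range_le {g : ℤ → ℝ} (hg0 : ∀ k, 0 ≤ g k) (hg : Summable g) (N : ℕ) :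
    ∑ j ∈ Finset.range N, ∑ m ∈ Finset.range N, g ((m : ℤ) - j) ≤ N * ∑' k, g k := by
  refine (Finset.sum_le_sum fun (j : ℕ) _ =>
    sum_range_intCast_sub_le hg0 hg N (j : ℤ)).trans ?_
  simp

lemma tendsto_sum_range_range_div {g : ℤ → ℝ} (hg : Summable g) :
    Tendsto (fun N : ℕ => (N : ℝ)⁻¹ * ∑ j ∈ Finset.range N, ∑ m ∈ Finset.range N, g ((m : ℤ) - j))
      atTop (𝓝 (∑' k, g k)) := by
  have hS : ∀ N : ℕ, ∑ j ∈ Finset.range N, ∑ m ∈ Finset.range N, g ((m : ℤ) - j)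
      = ∑ n ∈ Finset.range N, (∑ l ∈ Finset.range (n + 1), g l
        + ∑ l ∈ Finset.range n, g (-((l : ℤ) + 1))) := by
    intro N
    induction N with
    | zero => simp
    | succ n ih =>
      rw [Finset.sum_range_succ (fun n => ∑ l ∈ Finset.range (n + 1), g l
        + ∑ l ∈ Finset.range n, g (-((l : ℤ) + 1))) n, ← ih]
      simp only [Finset.sum_range_succ _ n, Finset.sum_add_distrib]
      rw [add_assoc]
      congr 1
      have e1 : ∑ j ∈ Finset.range n, g ((n : ℤ) - j) = ∑ l ∈ Finset.range n, g ((l : ℤ) + 1) := by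
        rw [← Finset.sum_range_reflect]
        refine Finset.sum_congr rfl fun j hj => ?_
        have := Finset.mem_range.1 hj
        congr 1; omega
      have e2 : ∑ m ∈ Finset.range n, g ((m : ℤ) - n)
          = ∑ l ∈ Finset.range n, g (-((l : ℤ) + 1)) := by
        rw [← Finset.sum_range_reflect]
        refine Finset.sum_congr rfl fun j hj => ?_
        have := Finset.mem_range.1 hj
        congr 1; omega
      have e3 : ∑ l ∈ Finset.range n, g l + g n
          = ∑ l ∈ Finset.range n, g ((l : ℤ) + 1) + g 0 := by
        rw [← Finset.sum_range_succ (fun l : ℕ => g l), Finset.sum_range_succ']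
        simp
      rw [e1, e2, sub_self]
      linarith
  have h1 : Summable fun l : ℕ => g l := hg.comp_injective Nat.cast_injective
  have h2 : Summable fun l : ℕ => g (-((l : ℤ) + 1)) :=
    hg.comp_injective fun a b h => by simpa using h
  have ht : ∑' k, g k = ∑' l : ℕ, g l + ∑' l : ℕ, g (-((l : ℤ) + 1)) :=
    tsum_of_nat_of_neg_add_one h1 h2
  simp only [hS, ht]
  refine Filter.Tendsto.cesaro ?_
  exact ((tendsto_add_atTop_iff_nat 1).2 h1.hasSum.tendsto_sum_nat).add
    h2.hasSum.tendsto_sum_nat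

lemma tendsto_sqrt_inv_mul_sum_Icc {ρ : ℤ → ℝ} (h0 : ∀ k, 0 ≤ ρ k)
    (hs : Summable fun k => ρ k ^ 2) :
    Tendsto (fun N : ℕ => (√(N : ℝ))⁻¹ * ∑ l ∈ Finset.Icc (-(N : ℤ)) N, ρ l) atTop (𝓝 0) := by
  rw [Metric.tendsto_atTop]
  intro ε hε
  obtain ⟨s, hsv⟩ := summable_iff_vanishing_norm.1 hs (ε ^ 2 / 12) (by positivity)
  have hlim : Tendsto (fun N : ℕ => (√(N : ℝ))⁻¹ * ∑ l ∈ s, ρ l) atTop (𝓝 0) := by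
    have : Tendsto (fun N : ℕ => (√(N : ℝ))⁻¹) atTop (𝓝 0) :=
      tendsto_inv_atTop_zero.comp (Real.tendsto_sqrt_atTop.comp tendsto_natCast_atTop_atTop)
    simpa using this.mul_const (∑ l ∈ s, ρ l)
  obtain ⟨N0, hN0⟩ := Metric.tendsto_atTop.1 hlim (ε / 2) (by positivity)
  refine ⟨max N0 1, fun N hN => ?_⟩
  have hN1 : 1 ≤ N := (le_max_right _ _).trans hN
  have hNr : (1 : ℝ) ≤ N := by exact_mod_cast hN1
  have hsN := hN0 N ((le_max_left _ _).trans hN)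
  have hsq : 0 < √(N : ℝ) := by positivity
  rw [Real.dist_eq, sub_zero] at hsN ⊢
  rw [abs_of_nonneg (mul_nonneg (by positivity) (Finset.sum_nonneg fun l _ => h0 l))] at hsN ⊢
  set T := Finset.Icc (-(N : ℤ)) N with hT
  have h1 : ∑ l ∈ T, ρ l ≤ ∑ l ∈ s, ρ l + ∑ l ∈ T \ s, ρ l := by
    rw [← Finset.sum_inter_add_sum_sdiff T s]
    gcongr
    · exact fun i _ _ => h0 i
    · exact Finset.inter_subset_right
  have h2 : (∑ l ∈ T \ s, ρ l) ^ 2 ≤ (3 * N) * (ε ^ 2 / 12) := by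
    refine (sq_sum_le_card_mul_sum_sq (s := T \ s) (f := ρ)).trans ?_
    have hc : ((T \ s).card : ℝ) ≤ 3 * N := by
      have : (T \ s).card ≤ T.card := Finset.card_le_card Finset.sdiff_subset
      have h3 : T.card = 2 * N + 1 := by rw [hT, Int.card_Icc]; omega
      have : (T \ s).card ≤ 3 * N := by omega
      exact_mod_cast this
    have hv := hsv (T \ s) Finset.sdiff_disjoint
    rw [Real.norm_eq_abs] at hv
    have := (le_abs_self _).trans hv.le
    exact mul_le_mul hc this (Finset.sum_nonneg fun l _ => sq_nonneg _) (by positivity)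
  have h3 : ∑ l ∈ T \ s, ρ l ≤ √N * (ε / 2) := by
    refine abs_le_of_sq_le_sq' ?_ (by positivity) |>.2
    rw [mul_pow, Real.sq_sqrt (by positivity)]
    linarith
  calc (√(N : ℝ))⁻¹ * ∑ l ∈ T, ρ l ≤ (√(N : ℝ))⁻¹ * (∑ l ∈ s, ρ l + √N * (ε / 2)) := by
        gcongr; linarith
    _ = (√(N : ℝ))⁻¹ * ∑ l ∈ s, ρ l + ε / 2 := by field_simp
    _ < ε := by linarith

end Sums

section Covariance

variable {Ω : Type*} [MeasurableSpace Ω] {P : Measure Ω} [IsProbabilityMeasure P]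
  {X Y X' Y' : Ω → ℝ}

lemma abs_covariance_le_sqrt (hX : MemLp X 2 P) (hY : MemLp Y 2 P) :
    |cov[X, Y; P]| ≤ √Var[X; P] * √Var[Y; P] := by
  have h : ∀ x : ℝ, 0 ≤ Var[Y; P] * (x * x) + (2 * cov[X, Y; P]) * x + Var[X; P] := fun x => by
    have := variance_nonneg (X + x • Y) P
    rw [variance_add hX (hY.const_smul x), variance_smul, covariance_smul_right] at this
    nlinarith
  have hd := discrim_le_zero h
  rw [discrim] at hd
  rw [← Real.sqrt_mul (variance_nonneg _ _)]
  apply Real.le_sqrt_of_sq_le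
  rw [sq_abs]
  nlinarith

lemma abs_covariance_sub_covariance_le {ε M : ℝ} (hX : MemLp X 2 P) (hY : MemLp Y 2 P)
    (hX' : MemLp X' 2 P) (hY' : MemLp Y' 2 P) (h1 : √Var[X; P] ≤ M) (h2 : √Var[Y; P] ≤ M)
    (h3 : √Var[X - X'; P] ≤ ε) (h4 : √Var[Y - Y'; P] ≤ ε) :
    |cov[X, Y; P] - cov[X', Y'; P]| ≤ 2 * M * ε + ε ^ 2 := by
  have e : cov[X, Y; P] - cov[X', Y'; P]
      = cov[X - X', Y; P] + cov[X, Y - Y'; P] - cov[X - X', Y - Y'; P] := by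
    rw [covariance_sub_left hX hX' (hY.sub hY'), covariance_sub_left hX hX' hY,
      covariance_sub_right hX hY hY', covariance_sub_right hX' hY hY']
    ring
  rw [e]
  have a1 := (abs_covariance_le_sqrt (hX.sub hX') hY).trans
    (mul_le_mul h3 h2 (Real.sqrt_nonneg _) ((Real.sqrt_nonneg _).trans h3))
  have a2 := (abs_covariance_le_sqrt hX (hY.sub hY')).trans
    (mul_le_mul h1 h4 (Real.sqrt_nonneg _) ((Real.sqrt_nonneg _).trans h1))
  have a3 := (abs_covariance_le_sqrt (hX.sub hX') (hY.sub hY')).trans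
    (mul_le_mul h3 h4 (Real.sqrt_nonneg _) ((Real.sqrt_nonneg _).trans h3))
  rw [abs_le] at *
  constructor <;> nlinarith

end Covariance

namespace IsGaussianSpace

variable {Ω : Type*} [MeasurableSpace Ω] {P : Measure Ω} [IsProbabilityMeasure P]
  {V : Submodule ℝ (Ω → ℝ)}

lemma covariance_sum_cos (hV : IsGaussianSpace V P) {κ : Type*} [Fintype κ] {X Y : κ → Ω → ℝ}
    (hX : ∀ i, X i ∈ V) (hY : ∀ i, Y i ∈ V) (c : κ → ℝ) :
    cov[fun ω => ∑ i, c i * Real.cos (X i ω), fun ω => ∑ i, c i * Real.cos (Y i ω); P]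
      = ∑ i, ∑ j, c i * c j * (Real.exp (-(∫ ω, X i ω * X i ω ∂P + ∫ ω, Y j ω * Y j ω ∂P) / 2)
        * (Real.cosh (∫ ω, X i ω * Y j ω ∂P) - 1)) := by
  rw [covariance_fun_sum_fun_sum (fun k => (memLp_cos (hV.measurable _ (hX k))).const_mul _)
    fun k => (memLp_cos (hV.measurable _ (hY k))).const_mul _]
  refine Finset.sum_congr rfl fun i _ => Finset.sum_congr rfl fun k _ => ?_
  rw [covariance_const_mul_left, covariance_const_mul_right, hV.covariance_cos_eq (hX i) (hY k)]
  ring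

lemma integral_sum_cos_sq (hV : IsGaussianSpace V P) {κ : Type*} [Fintype κ] {X : κ → Ω → ℝ}
    (hX : ∀ i, X i ∈ V) (c : κ → ℝ) :
    ∫ ω, (∑ i, c i * Real.cos (X i ω)) ^ 2 ∂P
      = ∑ i, ∑ j, c i * c j * (Real.exp (-(∫ ω, X i ω * X i ω ∂P + ∫ ω, X j ω * X j ω ∂P) / 2)
        * Real.cosh (∫ ω, X i ω * X j ω ∂P)) := by
  have hm := fun k => hV.measurable _ (hX k)
  simp only [sq, Finset.sum_mul_sum]
  have hi : ∀ i j, Integrable (fun ω => c i * Real.cos (X i ω) * (c j * Real.cos (X j ω))) P :=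
    fun i j => ((memLp_cos (hm i)).const_mul _).integrable_mul ((memLp_cos (hm j)).const_mul _)
  rw [integral_finsetSum _ fun i _ => integrable_finsetSum _ fun j _ => hi i j]
  refine Finset.sum_congr rfl fun i _ => ?_
  rw [integral_finsetSum _ fun j _ => hi i j]
  refine Finset.sum_congr rfl fun j _ => ?_
  rw [← hV.integral_cos_mul_cos (hX i) (hX j), ← integral_const_mul]
  congr 1; ext ω; ring

/-- A Gebelein-type inequality for linear combinations of cosines. -/
lemma abs_covariance_sum_cos_le (hV : IsGaussianSpace V P) {κ : Type*} [Fintype κ]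
    {X Y : κ → Ω → ℝ} (hX : ∀ i, X i ∈ V) (hY : ∀ i, Y i ∈ V)
    (hXY : ∀ i j, ∫ ω, Y i ω * Y j ω ∂P = ∫ ω, X i ω * X j ω ∂P) {ρ : ℝ} (hρ0 : 0 ≤ ρ)
    (hρ1 : ρ ≤ 1)
    (h : ∀ x y : κ → ℝ, |∑ i, ∑ j, x i * y j * ∫ ω, X i ω * Y j ω ∂P|
      ≤ ρ * (∑ i, ∑ j, x i * x j * ∫ ω, X i ω * X j ω ∂P
        + ∑ i, ∑ j, y i * y j * ∫ ω, X i ω * X j ω ∂P) / 2) (c : κ → ℝ) :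
    |cov[fun ω => ∑ i, c i * Real.cos (X i ω), fun ω => ∑ i, c i * Real.cos (Y i ω); P]|
      ≤ ρ ^ 2 * ∫ ω, (∑ i, c i * Real.cos (X i ω)) ^ 2 ∂P := by
  rw [hV.covariance_sum_cos hX hY, hV.integral_sum_cos_sq hX]
  have hQ0 : ∀ x : κ → ℝ, 0 ≤ ∑ i, ∑ j, x i * x j * ∫ ω, X i ω * X j ω ∂P := fun x => by
    have : ∑ i, ∑ j, x i * x j * ∫ ω, X i ω * X j ω ∂P = ∫ ω, (∑ i, x i * X i ω) ^ 2 ∂P := by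
      simp only [sq, Finset.sum_mul_sum]
      have hi : ∀ i j, Integrable (fun ω => x i * X i ω * (x j * X j ω)) P :=
        fun i j => ((hV.memLp (hX i)).const_mul _).integrable_mul ((hV.memLp (hX j)).const_mul _)
      rw [integral_finsetSum _ fun i _ => integrable_finsetSum _ fun j _ => hi i j]
      refine Finset.sum_congr rfl fun i _ => ?_
      rw [integral_finsetSum _ fun j _ => hi i j]
      refine Finset.sum_congr rfl fun j _ => ?_
      rw [← integral_const_mul]
      congr 1; ext ω; ring
    rw [this]
    exact integral_nonneg fun ω => sq_nonneg _
  have key := abs_sum_cosh_sub_one_le (fun i j => ∫ ω, X i ω * X j ω ∂P)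
    (fun i j => ∫ ω, X i ω * Y j ω ∂P) hρ0 hρ1 (fun i j => by simp_rw [mul_comm]) hQ0 h
    (fun i => c i * Real.exp (-(∫ ω, X i ω * X i ω ∂P) / 2))
  have he : ∀ a b : ℝ, Real.exp (-(a + b) / 2) = Real.exp (-a / 2) * Real.exp (-b / 2) :=
    fun a b => by rw [← Real.exp_add]; congr 1; ring
  simp only [hXY, he]
  convert key using 3 <;> exact Finset.sum_congr rfl fun j _ => by ring

end IsGaussianSpace

open scoped RealInnerProductSpace in
/-- A stationary centered Gaussian sequence `Z` of random vectors, whose correlations between times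
`j` and `j + k` are dominated by `ρ k ≤ 1`, with `ρ` square summable. -/
structure IsShortRangeGaussian {Ω E : Type*} [MeasurableSpace Ω] [NormedAddCommGroup E]
    [InnerProductSpace ℝ E] [MeasurableSpace E] (V : Submodule ℝ (Ω → ℝ)) (P : Measure Ω)
    (Z : ℤ → Ω → E) (ρ : ℤ → ℝ) : Prop where
  space : IsGaussianSpace V P
  meas : ∀ j, Measurable (Z j)
  mem : ∀ j t, (fun ω => ⟪Z j ω, t⟫) ∈ V
  stat : ∀ j k s t, ∫ ω, ⟪Z j ω, s⟫ * ⟪Z (j + k) ω, t⟫ ∂P = ∫ ω, ⟪Z 0 ω, s⟫ * ⟪Z k ω, t⟫ ∂P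
  nonneg : ∀ k, 0 ≤ ρ k
  le_one : ∀ k, ρ k ≤ 1
  summable : Summable fun k => ρ k ^ 2
  bound : ∀ k s t, |∫ ω, ⟪Z 0 ω, s⟫ * ⟪Z k ω, t⟫ ∂P|
    ≤ ρ k * (∫ ω, ⟪Z 0 ω, s⟫ * ⟪Z 0 ω, s⟫ ∂P + ∫ ω, ⟪Z 0 ω, t⟫ * ⟪Z 0 ω, t⟫ ∂P) / 2

open scoped RealInnerProductSpace in
/-- Finite linear combination of the functions `z ↦ cos ⟪z, t i⟫`. -/
noncomputable def cosPoly {E κ : Type*} [NormedAddCommGroup E] [InnerProductSpace ℝ E] [Fintype κ]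
    (c : κ → ℝ) (t : κ → E) (z : E) : ℝ :=
  ∑ i, c i * Real.cos ⟪z, t i⟫

section cosPoly

variable {E κ : Type*} [NormedAddCommGroup E] [InnerProductSpace ℝ E] [MeasurableSpace E]
  [BorelSpace E] [SecondCountableTopology E] [Fintype κ] (c : κ → ℝ) (t : κ → E)

@[fun_prop]
lemma measurable_cosPoly : Measurable (cosPoly c t) := by
  unfold cosPoly
  fun_prop

lemma abs_cosPoly_le (z : E) : |cosPoly c t z| ≤ ∑ i, |c i| := by
  refine (Finset.abs_sum_le_sum_abs _ _).trans (Finset.sum_le_sum fun i _ => ?_)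
  rw [abs_mul]
  exact mul_le_of_le_one_right (abs_nonneg _) (Real.abs_cos_le_one _)

end cosPoly

namespace IsShortRangeGaussian

open scoped RealInnerProductSpace

variable {Ω E : Type*} [MeasurableSpace Ω] {P : Measure Ω} [IsProbabilityMeasure P]
  {V : Submodule ℝ (Ω → ℝ)} [NormedAddCommGroup E] [InnerProductSpace ℝ E] [CompleteSpace E]
  [SecondCountableTopology E] [MeasurableSpace E] [BorelSpace E] {Z : ℤ → Ω → E} {ρ : ℤ → ℝ}
  {κ : Type*} [Fintype κ]

lemma integral_eq (hZ : IsShortRangeGaussian V P Z ρ) (i j : ℤ) (s t : E) :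
    ∫ ω, ⟪Z i ω, s⟫ * ⟪Z j ω, t⟫ ∂P = ∫ ω, ⟪Z 0 ω, s⟫ * ⟪Z (j - i) ω, t⟫ ∂P := by
  rw [← hZ.stat i (j - i) s t]
  simp

lemma integral_self_eq (hZ : IsShortRangeGaussian V P Z ρ) (j : ℤ) (s t : E) :
    ∫ ω, ⟪Z j ω, s⟫ * ⟪Z j ω, t⟫ ∂P = ∫ ω, ⟪Z 0 ω, s⟫ * ⟪Z 0 ω, t⟫ ∂P := by
  rw [hZ.integral_eq j j]
  simp

lemma map_eq (hZ : IsShortRangeGaussian V P Z ρ) (j : ℤ) : P.map (Z j) = P.map (Z 0) := by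
  have := Measure.isProbabilityMeasure_map (μ := P) (hZ.meas j).aemeasurable
  have := Measure.isProbabilityMeasure_map (μ := P) (hZ.meas 0).aemeasurable
  refine Measure.ext_of_charFun (funext fun t => ?_)
  have h : ∀ j, charFun (P.map (Z j)) t
      = (Real.exp (-(∫ ω, ⟪Z j ω, t⟫ * ⟪Z j ω, t⟫ ∂P) / 2) : ℂ) := fun j => by
    rw [← hZ.space.integral_cexp (hZ.mem j t), charFun_apply,
      integral_map (hZ.meas j).aemeasurable (by fun_prop)]
  rw [h, h, hZ.integral_self_eq]

lemma integral_comp (hZ : IsShortRangeGaussian V P Z ρ) {F : E → ℝ} (hF : Measurable F) (j : ℤ) :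
    ∫ ω, F (Z j ω) ∂P = ∫ ω, F (Z 0 ω) ∂P := by
  rw [← integral_map (hZ.meas j).aemeasurable hF.aestronglyMeasurable, hZ.map_eq,
    integral_map (hZ.meas 0).aemeasurable hF.aestronglyMeasurable]

lemma memLp_comp (hZ : IsShortRangeGaussian V P Z ρ) {F : E → ℝ} (hF : Measurable F) {C : ℝ}
    (h : ∀ z, |F z| ≤ C) (j : ℤ) : MemLp (fun ω => F (Z j ω)) 2 P :=
  IsGaussianSpace.memLp_two_of_bound (hF.comp (hZ.meas j)) C fun _ => h _

lemma covariance_cosPoly (hZ : IsShortRangeGaussian V P Z ρ) (c : κ → ℝ) (t : κ → E) (i j : ℤ) :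
    cov[fun ω => cosPoly c t (Z i ω), fun ω => cosPoly c t (Z j ω); P]
      = cov[fun ω => cosPoly c t (Z 0 ω), fun ω => cosPoly c t (Z (j - i) ω); P] := by
  unfold cosPoly
  rw [hZ.space.covariance_sum_cos (fun k => hZ.mem _ (t k)) (fun k => hZ.mem _ (t k)),
    hZ.space.covariance_sum_cos (fun k => hZ.mem _ (t k)) (fun k => hZ.mem _ (t k))]
  simp only [hZ.integral_self_eq]
  simp only [hZ.integral_eq i j]

lemma abs_covariance_cosPoly_le (hZ : IsShortRangeGaussian V P Z ρ) (c : κ → ℝ) (t : κ → E)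
    (k : ℤ) :
    |cov[fun ω => cosPoly c t (Z 0 ω), fun ω => cosPoly c t (Z k ω); P]|
      ≤ ρ k ^ 2 * ∫ ω, cosPoly c t (Z 0 ω) ^ 2 ∂P := by
  have hs : ∀ (x y : κ → ℝ) (k : ℤ), ∑ i, ∑ j, x i * y j * ∫ ω, ⟪Z 0 ω, t i⟫ * ⟪Z k ω, t j⟫ ∂P
      = ∫ ω, ⟪Z 0 ω, ∑ i, x i • t i⟫ * ⟪Z k ω, ∑ i, y i • t i⟫ ∂P := fun x y k => by
    simp only [inner_sum, inner_smul_right, Finset.sum_mul_sum]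
    have hi : ∀ i j, Integrable (fun ω => x i * ⟪Z 0 ω, t i⟫ * (y j * ⟪Z k ω, t j⟫)) P :=
      fun i j => ((hZ.space.memLp (hZ.mem 0 (t i))).const_mul _).integrable_mul
        ((hZ.space.memLp (hZ.mem k (t j))).const_mul _)
    rw [integral_finsetSum _ fun i _ => integrable_finsetSum _ fun j _ => hi i j]
    refine Finset.sum_congr rfl fun i _ => ?_
    rw [integral_finsetSum _ fun j _ => hi i j]
    refine Finset.sum_congr rfl fun j _ => ?_
    rw [← integral_const_mul]
    congr 1; ext ω; ring
  refine hZ.space.abs_covariance_sum_cos_le (fun i => hZ.mem 0 (t i)) (fun i => hZ.mem k (t i))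
    (fun i j => hZ.integral_self_eq k _ _) (hZ.nonneg k) (hZ.le_one k) (fun x y => ?_) c
  rw [hs, hs, hs]
  exact hZ.bound k _ _

end IsShortRangeGaussian

namespace IsShortRangeGaussian

open scoped RealInnerProductSpace

variable {Ω E : Type*} [MeasurableSpace Ω] {P : Measure Ω} [IsProbabilityMeasure P]
  {V : Submodule ℝ (Ω → ℝ)} [NormedAddCommGroup E] [InnerProductSpace ℝ E] [CompleteSpace E]
  [SecondCountableTopology E] [MeasurableSpace E] [BorelSpace E] {Z : ℤ → Ω → E} {ρ : ℤ → ℝ}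
  {κ : Type*} [Fintype κ]

lemma variance_sum_comp (hZ : IsShortRangeGaussian V P Z ρ) {F : E → ℝ} (hF : Measurable F) {C : ℝ}
    (h : ∀ z, |F z| ≤ C) (hs : ∀ i j, cov[fun ω => F (Z i ω), fun ω => F (Z j ω); P]
      = cov[fun ω => F (Z 0 ω), fun ω => F (Z (j - i) ω); P]) (N : ℕ) :
    Var[fun ω => ∑ j ∈ Finset.range N, F (Z j ω); P]
      = ∑ j ∈ Finset.range N, ∑ m ∈ Finset.range N,
        cov[fun ω => F (Z 0 ω), fun ω => F (Z ((m : ℤ) - j) ω); P] := by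
  rw [variance_fun_sum' fun (j : ℕ) _ => hZ.memLp_comp hF h (j : ℤ)]
  exact Finset.sum_congr rfl fun i _ => Finset.sum_congr rfl fun j _ => hs i j

lemma abs_integral_mul_le_of_le (hZ : IsShortRangeGaussian V P Z ρ) {t : κ → E} {S : ℝ}
    (hS : ∀ i, ∫ ω, ⟪Z 0 ω, t i⟫ * ⟪Z 0 ω, t i⟫ ∂P ≤ S) (i i' : κ) (j j' : ℤ) :
    |∫ ω, ⟪Z j ω, t i⟫ * ⟪Z j' ω, t i'⟫ ∂P| ≤ ρ (j' - j) * S := by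
  rw [hZ.integral_eq]
  refine (hZ.bound _ _ _).trans ?_
  rw [mul_div_assoc]
  refine mul_le_mul_of_nonneg_left ?_ (hZ.nonneg _)
  linarith [hS i, hS i']

lemma summable_covariance_cosPoly (hZ : IsShortRangeGaussian V P Z ρ) (c : κ → ℝ) (t : κ → E) :
    Summable fun k : ℤ => cov[fun ω => cosPoly c t (Z 0 ω), fun ω => cosPoly c t (Z k ω); P] :=
  Summable.of_norm_bounded (hZ.summable.mul_right _) (hZ.abs_covariance_cosPoly_le c t)

/-- The central limit theorem for cosine polynomials, in terms of characteristic functions. -/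
lemma tendsto_charFun_cosPoly (hZ : IsShortRangeGaussian V P Z ρ) (c : κ → ℝ) (t : κ → E) (θ : ℝ) :
    Tendsto (fun N : ℕ => ∫ ω, Complex.exp ((θ * ((√(N : ℝ))⁻¹ * ∑ j ∈ Finset.range N,
        (cosPoly c t (Z j ω) - ∫ x, cosPoly c t (Z 0 x) ∂P)) : ℝ) * Complex.I) ∂P) atTop
      (𝓝 ((Real.exp (-θ ^ 2 * (∑' k : ℤ,
        cov[fun ω => cosPoly c t (Z 0 ω), fun ω => cosPoly c t (Z k ω); P]) / 2) : ℝ) : ℂ)) := by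
  set γ : ℤ → ℝ := fun k => cov[fun ω => cosPoly c t (Z 0 ω), fun ω => cosPoly c t (Z k ω); P]
    with hγ
  set S := ∑ i, ∫ ω, ⟪Z 0 ω, t i⟫ * ⟪Z 0 ω, t i⟫ ∂P with hS
  have hS' : ∀ i, ∫ ω, ⟪Z 0 ω, t i⟫ * ⟪Z 0 ω, t i⟫ ∂P ≤ S := fun i =>
    Finset.single_le_sum (f := fun i => ∫ ω, ⟪Z 0 ω, t i⟫ * ⟪Z 0 ω, t i⟫ ∂P)
      (fun i _ => integral_nonneg fun ω => mul_self_nonneg _) (Finset.mem_univ i)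
  have hS0 : 0 ≤ S := Finset.sum_nonneg fun i _ => integral_nonneg fun ω => mul_self_nonneg _
  set K := ∑ i, |c i| with hK
  have hK0 : 0 ≤ K := Finset.sum_nonneg fun i _ => abs_nonneg _
  set R := ∑' k, ρ k ^ 2 with hR
  set A : ℕ → ℝ := fun N => K * S * ((√(N : ℝ))⁻¹ * ∑ l ∈ Finset.Icc (-(N : ℤ)) N, ρ l) with hA
  have hA0 : Tendsto A atTop (𝓝 0) := by
    simpa using (tendsto_sqrt_inv_mul_sum_Icc hZ.nonneg hZ.summable).const_mul (K * S)
  set a : ∀ N : ℕ, κ × Fin N → ℝ := fun N p => (√(N : ℝ))⁻¹ * c p.1 with ha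
  set X : ∀ N : ℕ, κ × Fin N → Ω → ℝ := fun N p ω => ⟪Z (p.2 : ℕ) ω, t p.1⟫ with hX
  have hsum : ∀ (N : ℕ) (ω : Ω), ∑ p, a N p * Real.cos (X N p ω)
      = (√(N : ℝ))⁻¹ * ∑ j ∈ Finset.range N, cosPoly c t (Z j ω) := fun N ω => by
    simp only [ha, hX, cosPoly, mul_assoc]
    rw [← Finset.mul_sum, Fintype.sum_prod_type_right, Finset.sum_range]
  have habs : ∀ N p, |a N p| = (√(N : ℝ))⁻¹ * |c p.1| := fun N p => by
    simp only [ha, abs_mul, abs_inv, abs_of_nonneg (Real.sqrt_nonneg _)]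
  have hAN : ∀ (N : ℕ) (i : κ × Fin N),
      ∑ k, |a N k| * |∫ ω, X N i ω * X N k ω ∂P| ≤ A N := fun N i => by
    calc ∑ k, |a N k| * |∫ ω, X N i ω * X N k ω ∂P|
        ≤ ∑ k : κ × Fin N, (√(N : ℝ))⁻¹ * |c k.1| * (ρ ((k.2 : ℕ) - (i.2 : ℕ)) * S) := by
          refine Finset.sum_le_sum fun k _ => ?_
          rw [habs]
          exact mul_le_mul_of_nonneg_left (hZ.abs_integral_mul_le_of_le hS' _ _ _ _)
            (by positivity)
      _ = K * S * ((√(N : ℝ))⁻¹ * ∑ m ∈ Finset.range N, ρ ((m : ℤ) - (i.2 : ℕ))) := by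
          rw [Fintype.sum_prod_type, Finset.sum_range, hK, mul_assoc, Finset.sum_mul]
          refine Finset.sum_congr rfl fun i _ => ?_
          simp only [Finset.mul_sum]
          exact Finset.sum_congr rfl fun j _ => by ring
      _ ≤ A N := by
          simp only [hA]
          gcongr
          have hinj : Function.Injective fun m : ℕ => (m : ℤ) - (i.2 : ℕ) := fun a b h => by
            simpa using h
          rw [← Finset.sum_image (f := ρ) (fun a _ b _ h => hinj h)]
          refine Finset.sum_le_sum_of_subset_of_nonneg ?_ fun k _ _ => hZ.nonneg k
          intro l hl
          obtain ⟨m, hm, rfl⟩ := Finset.mem_image.1 hl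
          have h1 := Finset.mem_range.1 hm
          have h2 := i.2.2
          rw [Finset.mem_Icc]
          constructor <;> omega
  have hBN : ∀ N : ℕ, ∑ i, ∑ k, |a N i| * |a N k| * (∫ ω, X N i ω * X N k ω ∂P) ^ 2
      ≤ K ^ 2 * S ^ 2 * R := fun N => by
    calc ∑ i, ∑ k, |a N i| * |a N k| * (∫ ω, X N i ω * X N k ω ∂P) ^ 2
        ≤ ∑ i : κ × Fin N, ∑ k : κ × Fin N, (√(N : ℝ))⁻¹ * |c i.1| * ((√(N : ℝ))⁻¹ * |c k.1|)
            * (ρ ((k.2 : ℕ) - (i.2 : ℕ)) * S) ^ 2 := by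
          refine Finset.sum_le_sum fun i _ => Finset.sum_le_sum fun k _ => ?_
          rw [habs, habs, ← sq_abs (∫ ω, X N i ω * X N k ω ∂P)]
          gcongr
          exact hZ.abs_integral_mul_le_of_le hS' _ _ _ _
      _ = K ^ 2 * S ^ 2 * (((√(N : ℝ))⁻¹) ^ 2 * ∑ j ∈ Finset.range N, ∑ m ∈ Finset.range N,
            ρ ((m : ℤ) - j) ^ 2) := by
          have e : ∀ i k : κ × Fin N, (√(N : ℝ))⁻¹ * |c i.1| * ((√(N : ℝ))⁻¹ * |c k.1|)
            * (ρ ((k.2 : ℕ) - (i.2 : ℕ)) * S) ^ 2 = (S ^ 2 * ((√(N : ℝ))⁻¹) ^ 2) *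
              (|c i.1| * (|c k.1| * ρ ((k.2 : ℕ) - (i.2 : ℕ)) ^ 2)) := fun i k => by ring
          simp only [e, ← Finset.mul_sum]
          simp only [Fintype.sum_prod_type, ← Finset.mul_sum]
          simp only [Finset.sum_range]
          simp only [← Finset.sum_mul, ← Finset.mul_sum]
          ring
      _ ≤ K ^ 2 * S ^ 2 * R := by
          gcongr
          refine (mul_le_mul_of_nonneg_left (sum_range_range_le (fun k => sq_nonneg (ρ k))
            hZ.summable N) (by positivity)).trans ?_
          rw [inv_pow, Real.sq_sqrt (Nat.cast_nonneg _), ← mul_assoc, ← hR]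
          refine mul_le_of_le_one_left (tsum_nonneg fun k => sq_nonneg _) ?_
          exact inv_mul_le_one
  have hvar : ∀ N : ℕ, Var[∑ p, fun ω => a N p * Real.cos (X N p ω); P]
      = (N : ℝ)⁻¹ * ∑ j ∈ Finset.range N, ∑ m ∈ Finset.range N, γ ((m : ℤ) - j) := fun N => by
    have e : (∑ p, fun ω => a N p * Real.cos (X N p ω))
        = fun ω => (√(N : ℝ))⁻¹ * ∑ j ∈ Finset.range N, cosPoly c t (Z j ω) := by
      ext ω
      rw [← hsum, Finset.sum_apply]
    rw [e, variance_const_mul, inv_pow, Real.sq_sqrt (Nat.cast_nonneg _),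
      hZ.variance_sum_comp (measurable_cosPoly c t) (abs_cosPoly_le c t)
        (hZ.covariance_cosPoly c t)]
  have hmean : ∀ N : ℕ, ∑ p, a N p * Real.exp (-(∫ ω, X N p ω * X N p ω ∂P) / 2)
      = (√(N : ℝ))⁻¹ * ∑ j ∈ Finset.range N, ∫ x, cosPoly c t (Z 0 x) ∂P := fun N => by
    have e : ∫ x, cosPoly c t (Z 0 x) ∂P
        = ∑ i, c i * Real.exp (-(∫ ω, ⟪Z 0 ω, t i⟫ * ⟪Z 0 ω, t i⟫ ∂P) / 2) := by
      unfold cosPoly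
      rw [integral_finsetSum _ fun i _ => (((IsGaussianSpace.memLp_cos
        (hZ.space.measurable _ (hZ.mem 0 (t i)))).integrable (by simp)).const_mul _)]
      refine Finset.sum_congr rfl fun i _ => ?_
      rw [integral_const_mul, ← hZ.space.integral_cos (hZ.mem 0 (t i))]
    simp only [ha, hX, hZ.integral_self_eq, mul_assoc]
    rw [← Finset.mul_sum, Fintype.sum_prod_type_right, Finset.sum_range, e]
  have hmain : ∀ N : ℕ, ‖(∫ ω, Complex.exp ((θ * ((√(N : ℝ))⁻¹ * ∑ j ∈ Finset.range N,
        (cosPoly c t (Z j ω) - ∫ x, cosPoly c t (Z 0 x) ∂P)) : ℝ) * Complex.I) ∂P)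
      - ((Real.exp (-θ ^ 2 * ((N : ℝ)⁻¹ * ∑ j ∈ Finset.range N, ∑ m ∈ Finset.range N,
        γ ((m : ℤ) - j)) / 2) : ℝ) : ℂ)‖ ≤ θ ^ 2 * √(2 * A N ^ 2 * (K ^ 2 * S ^ 2 * R)) :=
      fun N => by
    have := hZ.space.norm_charFun_sum_cos_sub_le (fun p : κ × Fin N => hZ.mem _ (t p.1)) (a N)
      (hAN N) (hBN N) θ
    rw [← hvar]
    convert this using 6 with ω
    rw [Finset.sum_sub_distrib, mul_sub, ← hsum, ← hmean]
  have hlim0 : Tendsto (fun N => θ ^ 2 * √(2 * A N ^ 2 * (K ^ 2 * S ^ 2 * R))) atTop (𝓝 0) := by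
    have : Tendsto (fun N => θ ^ 2 * √(2 * A N ^ 2 * (K ^ 2 * S ^ 2 * R))) atTop
        (𝓝 (θ ^ 2 * √(2 * 0 ^ 2 * (K ^ 2 * S ^ 2 * R)))) :=
      (((hA0.pow 2).const_mul 2).mul_const _).sqrt.const_mul _
    simpa using this
  have hdiff := squeeze_zero_norm hmain hlim0
  have hv := tendsto_sum_range_range_div (hZ.summable_covariance_cosPoly c t)
  have hv2 : Tendsto (fun N : ℕ => ((Real.exp (-θ ^ 2 * ((N : ℝ)⁻¹ * ∑ j ∈ Finset.range N,
      ∑ m ∈ Finset.range N, γ ((m : ℤ) - j)) / 2) : ℝ) : ℂ)) atTop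
      (𝓝 ((Real.exp (-θ ^ 2 * (∑' k, γ k) / 2) : ℝ) : ℂ)) :=
    (Complex.continuous_ofReal.tendsto _).comp
      ((Real.continuous_exp.tendsto _).comp ((hv.const_mul _).div_const 2))
  simpa using hdiff.add hv2

end IsShortRangeGaussian

/-- `G` is a finite linear combination of functions `z ↦ cos ⟪z, t⟫`. -/
def IsCosPoly {E : Type*} [NormedAddCommGroup E] [InnerProductSpace ℝ E] (G : E → ℝ) : Prop :=
  ∃ (κ : Type) (_ : Fintype κ) (c : κ → ℝ) (t : κ → E), G = cosPoly c t

/-- Bounded measurable functions that are limits of cosine polynomials in `L²(μ)`. -/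
structure IsCosApproximable {E : Type*} [NormedAddCommGroup E] [InnerProductSpace ℝ E]
    [MeasurableSpace E] (μ : Measure E) (F : E → ℝ) : Prop where
  measurable : Measurable F
  bounded : ∃ C, ∀ z, |F z| ≤ C
  approx : ∀ δ > 0, ∃ G, IsCosPoly G ∧ ∫ z, (F z - G z) ^ 2 ∂μ ≤ δ

section IsCosPoly

variable {E : Type*} [NormedAddCommGroup E] [InnerProductSpace ℝ E] {F G : E → ℝ}

lemma IsCosPoly.sub (hF : IsCosPoly F) (hG : IsCosPoly G) : IsCosPoly (F - G) := by
  obtain ⟨κ, _, c, t, rfl⟩ := hF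
  obtain ⟨κ', _, c', t', rfl⟩ := hG
  refine ⟨κ ⊕ κ', inferInstance, Sum.elim c (-c'), Sum.elim t t', ?_⟩
  ext z
  simp [cosPoly, sub_eq_add_neg]

variable [MeasurableSpace E] [BorelSpace E] [SecondCountableTopology E]

lemma IsCosPoly.measurable (hG : IsCosPoly G) : Measurable G := by
  obtain ⟨κ, _, c, t, rfl⟩ := hG
  exact measurable_cosPoly c t

lemma IsCosPoly.bounded (hG : IsCosPoly G) : ∃ C, ∀ z, |G z| ≤ C := by
  obtain ⟨κ, _, c, t, rfl⟩ := hG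
  exact ⟨_, abs_cosPoly_le c t⟩

lemma IsCosPoly.isCosApproximable (hG : IsCosPoly G) (μ : Measure E) : IsCosApproximable μ G :=
  ⟨hG.measurable, hG.bounded, fun δ hδ => ⟨G, hG, by simpa using hδ.le⟩⟩

lemma IsCosApproximable.sub {μ : Measure E} (hF : IsCosApproximable μ F) (hG : IsCosPoly G) :
    IsCosApproximable μ (F - G) := by
  refine ⟨hF.measurable.sub hG.measurable, ?_, fun δ hδ => ?_⟩
  · obtain ⟨C, hC⟩ := hF.bounded
    obtain ⟨C', hC'⟩ := hG.bounded
    exact ⟨C + C', fun z => (abs_sub _ _).trans (add_le_add (hC z) (hC' z))⟩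
  · obtain ⟨G', hG', h⟩ := hF.approx δ hδ
    refine ⟨G' - G, hG'.sub hG, ?_⟩
    simpa using h

end IsCosPoly

namespace IsShortRangeGaussian

variable {Ω E : Type*} [MeasurableSpace Ω] {P : Measure Ω} [IsProbabilityMeasure P]
  {V : Submodule ℝ (Ω → ℝ)} [NormedAddCommGroup E] [InnerProductSpace ℝ E] [CompleteSpace E]
  [SecondCountableTopology E] [MeasurableSpace E] [BorelSpace E] {Z : ℤ → Ω → E} {ρ : ℤ → ℝ}
  {F G : E → ℝ}

lemma memLp_comp' (hZ : IsShortRangeGaussian V P Z ρ) (hF : IsCosApproximable (P.map (Z 0)) F)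
    (j : ℤ) : MemLp (fun ω => F (Z j ω)) 2 P := by
  obtain ⟨C, hC⟩ := hF.bounded
  exact hZ.memLp_comp hF.measurable hC j

lemma sqrt_variance_comp_le (hZ : IsShortRangeGaussian V P Z ρ)
    (hF : IsCosApproximable (P.map (Z 0)) F) (j : ℤ) :
    √Var[fun ω => F (Z j ω); P] ≤ √(∫ ω, F (Z 0 ω) ^ 2 ∂P) := by
  refine Real.sqrt_le_sqrt ((variance_le_expectation_sq
    (hZ.memLp_comp' hF j).aestronglyMeasurable).trans (le_of_eq ?_))
  exact hZ.integral_comp (F := fun z => F z ^ 2) (hF.measurable.pow_const 2) j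

lemma exists_seq_isCosPoly (hZ : IsShortRangeGaussian V P Z ρ)
    (hF : IsCosApproximable (P.map (Z 0)) F) : ∃ G : ℕ → E → ℝ, (∀ n, IsCosPoly (G n)) ∧
      ∀ n : ℕ, ∫ ω, (F (Z 0 ω) - G n (Z 0 ω)) ^ 2 ∂P ≤ (1 / ((n : ℝ) + 1)) ^ 2 := by
  choose G hG h using fun n : ℕ => hF.approx ((1 / ((n : ℝ) + 1)) ^ 2) (by positivity)
  refine ⟨G, hG, fun n => ?_⟩
  have := h n
  rwa [integral_map (hZ.meas 0).aemeasurable] at this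
  exact ((hF.measurable.sub (hG n).measurable).pow_const 2).aestronglyMeasurable

lemma tendsto_covariance_comp (hZ : IsShortRangeGaussian V P Z ρ)
    (hF : IsCosApproximable (P.map (Z 0)) F) {G : ℕ → E → ℝ} (hG : ∀ n, IsCosPoly (G n))
    (h : ∀ n : ℕ, ∫ ω, (F (Z 0 ω) - G n (Z 0 ω)) ^ 2 ∂P ≤ (1 / ((n : ℝ) + 1)) ^ 2) (i j : ℤ) :
    Tendsto (fun n => cov[fun ω => G n (Z i ω), fun ω => G n (Z j ω); P]) atTop
      (𝓝 cov[fun ω => F (Z i ω), fun ω => F (Z j ω); P]) := by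
  have ht := tendsto_one_div_add_atTop_nhds_zero_nat (𝕜 := ℝ)
  rw [tendsto_iff_norm_sub_tendsto_zero]
  have hs : ∀ n j, √Var[(fun ω => F (Z j ω)) - (fun ω => G n (Z j ω)); P] ≤ 1 / ((n : ℝ) + 1) :=
    fun n j => (hZ.sqrt_variance_comp_le (hF.sub (hG n)) j).trans
      ((Real.sqrt_le_left (by positivity)).2 (h n))
  refine squeeze_zero (fun n => norm_nonneg _) (fun n => ?_)
    (g := fun n : ℕ => 2 * √(∫ ω, F (Z 0 ω) ^ 2 ∂P) * (1 / ((n : ℝ) + 1)) + (1 / ((n : ℝ) + 1)) ^ 2)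
    ?_
  · rw [norm_sub_rev]
    exact abs_covariance_sub_covariance_le (hZ.memLp_comp' hF i) (hZ.memLp_comp' hF j)
      (hZ.memLp_comp' ((hG n).isCosApproximable _) i)
      (hZ.memLp_comp' ((hG n).isCosApproximable _) j)
      (hZ.sqrt_variance_comp_le hF i) (hZ.sqrt_variance_comp_le hF j) (hs n i) (hs n j)
  · simpa using (ht.const_mul (2 * √(∫ ω, F (Z 0 ω) ^ 2 ∂P))).add (ht.pow 2)

lemma integral_sq_le (hZ : IsShortRangeGaussian V P Z ρ)
    (hF : IsCosApproximable (P.map (Z 0)) F) (hG : IsCosPoly G) {ε : ℝ} (hε : 0 < ε)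
    (h : ∫ ω, (F (Z 0 ω) - G (Z 0 ω)) ^ 2 ∂P ≤ ε ^ 2) :
    ∫ ω, G (Z 0 ω) ^ 2 ∂P ≤ (1 + ε) * ∫ ω, F (Z 0 ω) ^ 2 ∂P + (1 + ε) * ε := by
  have i1 := (hZ.memLp_comp' hF 0).integrable_sq
  have i2 := (hZ.memLp_comp' (hF.sub hG) 0).integrable_sq
  have i3 := (hZ.memLp_comp' (hG.isCosApproximable _) 0).integrable_sq
  calc ∫ ω, G (Z 0 ω) ^ 2 ∂P
      ≤ ∫ ω, ((1 + ε) * F (Z 0 ω) ^ 2 + (1 + ε⁻¹) * (F - G) (Z 0 ω) ^ 2) ∂P := by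
        refine integral_mono i3 ((i1.const_mul _).add (i2.const_mul _)) fun ω => ?_
        simp only [Pi.sub_apply]
        set x := F (Z 0 ω)
        set y := G (Z 0 ω)
        have : (1 + ε) * x ^ 2 + (1 + ε⁻¹) * (x - y) ^ 2 - y ^ 2
            = ε⁻¹ * (ε * x + (x - y)) ^ 2 := by
          field_simp
          ring
        have h2 : 0 ≤ ε⁻¹ * (ε * x + (x - y)) ^ 2 := by positivity
        linarith
    _ = (1 + ε) * ∫ ω, F (Z 0 ω) ^ 2 ∂P + (1 + ε⁻¹) * ∫ ω, (F (Z 0 ω) - G (Z 0 ω)) ^ 2 ∂P := by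
        rw [integral_add (i1.const_mul _) (i2.const_mul _), integral_const_mul, integral_const_mul]
        rfl
    _ ≤ (1 + ε) * ∫ ω, F (Z 0 ω) ^ 2 ∂P + (1 + ε⁻¹) * ε ^ 2 := by gcongr
    _ = _ := by field_simp; ring

lemma covariance_comp (hZ : IsShortRangeGaussian V P Z ρ)
    (hF : IsCosApproximable (P.map (Z 0)) F) (i j : ℤ) :
    cov[fun ω => F (Z i ω), fun ω => F (Z j ω); P]
      = cov[fun ω => F (Z 0 ω), fun ω => F (Z (j - i) ω); P] := by
  obtain ⟨G, hG, h⟩ := hZ.exists_seq_isCosPoly hF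
  refine tendsto_nhds_unique (hZ.tendsto_covariance_comp hF hG h i j)
    ((hZ.tendsto_covariance_comp hF hG h 0 (j - i)).congr fun n => ?_)
  obtain ⟨κ, _, c, t, e⟩ := hG n
  rw [e, hZ.covariance_cosPoly c t i j]

lemma abs_covariance_isCosPoly_le (hZ : IsShortRangeGaussian V P Z ρ) (hG : IsCosPoly G) (k : ℤ) :
    |cov[fun ω => G (Z 0 ω), fun ω => G (Z k ω); P]| ≤ ρ k ^ 2 * ∫ ω, G (Z 0 ω) ^ 2 ∂P := by
  obtain ⟨κ, _, c, t, rfl⟩ := hG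
  exact hZ.abs_covariance_cosPoly_le c t k

/-- Gebelein-type inequality for the stationary sequence. -/
lemma abs_covariance_comp_le (hZ : IsShortRangeGaussian V P Z ρ)
    (hF : IsCosApproximable (P.map (Z 0)) F) (k : ℤ) :
    |cov[fun ω => F (Z 0 ω), fun ω => F (Z k ω); P]| ≤ ρ k ^ 2 * ∫ ω, F (Z 0 ω) ^ 2 ∂P := by
  obtain ⟨G, hG, h⟩ := hZ.exists_seq_isCosPoly hF
  have ht := tendsto_one_div_add_atTop_nhds_zero_nat (𝕜 := ℝ)
  have hr : Tendsto (fun n : ℕ => ρ k ^ 2 * ((1 + 1 / ((n : ℝ) + 1)) * ∫ ω, F (Z 0 ω) ^ 2 ∂P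
      + (1 + 1 / ((n : ℝ) + 1)) * (1 / ((n : ℝ) + 1)))) atTop
      (𝓝 (ρ k ^ 2 * ∫ ω, F (Z 0 ω) ^ 2 ∂P)) := by
    have h1 := ht.const_add 1
    simpa using ((h1.mul_const (∫ ω, F (Z 0 ω) ^ 2 ∂P)).add (h1.mul ht)).const_mul (ρ k ^ 2)
  refine le_of_tendsto_of_tendsto' (hZ.tendsto_covariance_comp hF hG h 0 k).abs hr fun n => ?_
  refine (hZ.abs_covariance_isCosPoly_le (hG n) k).trans ?_
  gcongr
  exact hZ.integral_sq_le hF (hG n) (by positivity) (h n)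

lemma summable_covariance_comp (hZ : IsShortRangeGaussian V P Z ρ)
    (hF : IsCosApproximable (P.map (Z 0)) F) :
    Summable fun k : ℤ => cov[fun ω => F (Z 0 ω), fun ω => F (Z k ω); P] :=
  Summable.of_norm_bounded (hZ.summable.mul_right _) (hZ.abs_covariance_comp_le hF)

lemma variance_sum_comp_eq (hZ : IsShortRangeGaussian V P Z ρ)
    (hF : IsCosApproximable (P.map (Z 0)) F) (N : ℕ) :
    Var[fun ω => ∑ j ∈ Finset.range N, F (Z j ω); P]
      = ∑ j ∈ Finset.range N, ∑ m ∈ Finset.range N,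
        cov[fun ω => F (Z 0 ω), fun ω => F (Z ((m : ℤ) - j) ω); P] := by
  obtain ⟨C, hC⟩ := hF.bounded
  exact hZ.variance_sum_comp hF.measurable hC (hZ.covariance_comp hF) N

lemma tsum_covariance_nonneg (hZ : IsShortRangeGaussian V P Z ρ)
    (hF : IsCosApproximable (P.map (Z 0)) F) :
    0 ≤ ∑' k : ℤ, cov[fun ω => F (Z 0 ω), fun ω => F (Z k ω); P] := by
  refine ge_of_tendsto' (tendsto_sum_range_range_div (hZ.summable_covariance_comp hF)) fun N => ?_
  rw [← hZ.variance_sum_comp_eq hF]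
  exact mul_nonneg (by positivity) (variance_nonneg _ _)

lemma variance_sum_comp_le (hZ : IsShortRangeGaussian V P Z ρ)
    (hF : IsCosApproximable (P.map (Z 0)) F) (N : ℕ) :
    Var[fun ω => (√(N : ℝ))⁻¹ * ∑ j ∈ Finset.range N, F (Z j ω); P]
      ≤ (∑' k, ρ k ^ 2) * ∫ ω, F (Z 0 ω) ^ 2 ∂P := by
  rw [variance_const_mul, inv_pow, Real.sq_sqrt (Nat.cast_nonneg _), hZ.variance_sum_comp_eq hF]
  have hI : 0 ≤ ∫ ω, F (Z 0 ω) ^ 2 ∂P := integral_nonneg fun ω => sq_nonneg _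
  have hR : 0 ≤ ∑' k, ρ k ^ 2 := tsum_nonneg fun k => sq_nonneg _
  have h1 : ∑ j ∈ Finset.range N, ∑ m ∈ Finset.range N,
        cov[fun ω => F (Z 0 ω), fun ω => F (Z ((m : ℤ) - j) ω); P]
      ≤ N * ((∑' k, ρ k ^ 2) * ∫ ω, F (Z 0 ω) ^ 2 ∂P) := by
    rw [← tsum_mul_right]
    refine le_trans ?_ (sum_range_range_le (g := fun k => ρ k ^ 2 * ∫ ω, F (Z 0 ω) ^ 2 ∂P)
      (fun k => mul_nonneg (sq_nonneg _) hI) (hZ.summable.mul_right _) N)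
    exact Finset.sum_le_sum fun j _ => Finset.sum_le_sum fun m _ =>
      (le_abs_self _).trans (hZ.abs_covariance_comp_le hF _)
  have h2 : (0 : ℝ) ≤ (N : ℝ)⁻¹ := inv_nonneg.2 (Nat.cast_nonneg _)
  refine (mul_le_mul_of_nonneg_left h1 h2).trans ?_
  rw [← mul_assoc]
  exact mul_le_of_le_one_left (mul_nonneg hR hI) inv_mul_le_one

end IsShortRangeGaussian

lemma norm_cexp_sub_cexp_le (x y : ℝ) :
    ‖Complex.exp ((x : ℝ) * Complex.I) - Complex.exp ((y : ℝ) * Complex.I)‖ ≤ |x - y| := by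
  have e : Complex.exp ((x : ℝ) * Complex.I) - Complex.exp ((y : ℝ) * Complex.I)
      = Complex.exp ((y : ℝ) * Complex.I) * (Complex.exp (Complex.I * (x - y : ℝ)) - 1) := by
    rw [mul_sub, ← Complex.exp_add, mul_one]
    congr 2
    push_cast
    ring
  rw [e, norm_mul, Complex.norm_exp_ofReal_mul_I, one_mul]
  exact Real.norm_exp_I_mul_ofReal_sub_one_le

lemma norm_integral_cexp_sub_le {Ω : Type*} [MeasurableSpace Ω] {P : Measure Ω}
    [IsProbabilityMeasure P] {X Y : Ω → ℝ} (hX : Integrable X P) (hY : Integrable Y P) (θ : ℝ) :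
    ‖∫ ω, Complex.exp ((θ * X ω : ℝ) * Complex.I) ∂P
      - ∫ ω, Complex.exp ((θ * Y ω : ℝ) * Complex.I) ∂P‖ ≤ |θ| * ∫ ω, |X ω - Y ω| ∂P := by
  have hi : ∀ {X : Ω → ℝ}, Integrable X P →
      Integrable (fun ω => Complex.exp ((θ * X ω : ℝ) * Complex.I)) P := fun hX => by
    have := hX.aestronglyMeasurable.aemeasurable
    refine Integrable.of_bound (AEMeasurable.aestronglyMeasurable (by fun_prop)) 1
      (Eventually.of_forall fun ω => ?_)
    rw [Complex.norm_exp_ofReal_mul_I]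
  rw [← integral_sub (hi hX) (hi hY), ← integral_const_mul]
  refine (norm_integral_le_integral_norm _).trans
    (integral_mono ((hi hX).sub (hi hY)).norm ((hX.sub hY).abs.const_mul _) fun ω => ?_)
  refine (norm_cexp_sub_cexp_le _ _).trans (le_of_eq ?_)
  rw [← mul_sub, abs_mul]

lemma tendsto_of_uniform_approx {a : ℕ → ℂ} {A : ℕ → ℕ → ℂ} {b : ℕ → ℂ} {l : ℂ} {e : ℕ → ℝ}
    (hA : ∀ n, Tendsto (A n) atTop (𝓝 (b n))) (hb : Tendsto b atTop (𝓝 l))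
    (he : Tendsto e atTop (𝓝 0)) (h : ∀ n N, ‖a N - A n N‖ ≤ e n) : Tendsto a atTop (𝓝 l) := by
  rw [Metric.tendsto_atTop] at hb he ⊢
  intro ε hε
  obtain ⟨n1, h1⟩ := hb (ε / 3) (by positivity)
  obtain ⟨n2, h2⟩ := he (ε / 3) (by positivity)
  set n := max n1 n2
  have g1 := h1 n (le_max_left _ _)
  have g2 := h2 n (le_max_right _ _)
  obtain ⟨N0, h3⟩ := Metric.tendsto_atTop.1 (hA n) (ε / 3) (by positivity)
  refine ⟨N0, fun N hN => ?_⟩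
  have g3 := h3 N hN
  have g4 := h n N
  rw [Real.dist_eq, sub_zero] at g2
  have g5 := (le_abs_self _).trans g2.le
  rw [← dist_eq_norm] at g4
  have t1 := dist_triangle (a N) (A n N) l
  have t2 := dist_triangle (A n N) (b n) l
  linarith

namespace IsShortRangeGaussian

variable {Ω E : Type*} [MeasurableSpace Ω] {P : Measure Ω} [IsProbabilityMeasure P]
  {V : Submodule ℝ (Ω → ℝ)} [NormedAddCommGroup E] [InnerProductSpace ℝ E] [CompleteSpace E]
  [SecondCountableTopology E] [MeasurableSpace E] [BorelSpace E] {Z : ℤ → Ω → E} {ρ : ℤ → ℝ}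
  {F : E → ℝ}

lemma tendsto_tsum_covariance_comp (hZ : IsShortRangeGaussian V P Z ρ)
    (hF : IsCosApproximable (P.map (Z 0)) F) {G : ℕ → E → ℝ} (hG : ∀ n, IsCosPoly (G n))
    (h : ∀ n : ℕ, ∫ ω, (F (Z 0 ω) - G n (Z 0 ω)) ^ 2 ∂P ≤ (1 / ((n : ℝ) + 1)) ^ 2) :
    Tendsto (fun n => ∑' k : ℤ, cov[fun ω => G n (Z 0 ω), fun ω => G n (Z k ω); P])
      atTop (𝓝 (∑' k : ℤ, cov[fun ω => F (Z 0 ω), fun ω => F (Z k ω); P])) := by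
  obtain ⟨I, hI⟩ : ∃ I, I = ∫ ω, F (Z 0 ω) ^ 2 ∂P := ⟨_, rfl⟩
  have hI0 : 0 ≤ I := hI ▸ integral_nonneg fun ω => sq_nonneg _
  have hs : Summable fun k => ρ k ^ 2 * (2 * I + 2) := hZ.summable.mul_right _
  refine tendsto_tsum_of_dominated_convergence hs
    (fun k => hZ.tendsto_covariance_comp hF hG h 0 k) (Eventually.of_forall fun n k => ?_)
  refine (hZ.abs_covariance_isCosPoly_le (hG n) k).trans
    (mul_le_mul_of_nonneg_left ?_ (sq_nonneg _))
  refine (hZ.integral_sq_le hF (hG n) (by positivity) (h n)).trans ?_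
  rw [← hI]
  have h1 : 1 / ((n : ℝ) + 1) ≤ 1 := by
    rw [div_le_one (by positivity)]
    linarith [(Nat.cast_nonneg n : (0 : ℝ) ≤ n)]
  have h0 : 0 ≤ 1 / ((n : ℝ) + 1) := by positivity
  nlinarith

/-- The central limit theorem for cosine-approximable functionals of a short-range dependent
stationary Gaussian sequence, in terms of characteristic functions. -/
theorem tendsto_charFun_comp (hZ : IsShortRangeGaussian V P Z ρ)
    (hF : IsCosApproximable (P.map (Z 0)) F) (θ : ℝ) :
    Tendsto (fun N : ℕ => ∫ ω, Complex.exp ((θ * ((√(N : ℝ))⁻¹ * ∑ j ∈ Finset.range N,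
        (F (Z j ω) - ∫ x, F (Z 0 x) ∂P)) : ℝ) * Complex.I) ∂P) atTop
      (𝓝 ((Real.exp (-θ ^ 2 * (∑' k : ℤ,
        cov[fun ω => F (Z 0 ω), fun ω => F (Z k ω); P]) / 2) : ℝ) : ℂ)) := by
  obtain ⟨G, hG, h⟩ := hZ.exists_seq_isCosPoly hF
  have ht := tendsto_one_div_add_atTop_nhds_zero_nat (𝕜 := ℝ)
  set R := ∑' k, ρ k ^ 2 with hR
  have hR0 : 0 ≤ R := tsum_nonneg fun k => sq_nonneg _
  refine tendsto_of_uniform_approx (A := fun n N => ∫ ω, Complex.exp ((θ * ((√(N : ℝ))⁻¹ *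
      ∑ j ∈ Finset.range N, (G n (Z j ω) - ∫ x, G n (Z 0 x) ∂P)) : ℝ) * Complex.I) ∂P)
    (b := fun n => ((Real.exp (-θ ^ 2 * (∑' k : ℤ,
        cov[fun ω => G n (Z 0 ω), fun ω => G n (Z k ω); P]) / 2) : ℝ) : ℂ))
    (e := fun n => |θ| * (√R * (1 / ((n : ℝ) + 1)))) (fun n => ?_) ?_ ?_ fun n N => ?_
  · obtain ⟨κ, _, c, t, e⟩ := hG n
    rw [e]
    exact hZ.tendsto_charFun_cosPoly c t θ
  · have hσ := hZ.tendsto_tsum_covariance_comp hF hG h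
    exact (Complex.continuous_ofReal.tendsto _).comp
      ((Real.continuous_exp.tendsto _).comp ((hσ.const_mul _).div_const 2))
  · simpa using (ht.const_mul (√R)).const_mul |θ|
  · have hi : ∀ {F : E → ℝ}, IsCosApproximable (P.map (Z 0)) F → Integrable (fun ω =>
        (√(N : ℝ))⁻¹ * ∑ j ∈ Finset.range N, (F (Z j ω) - ∫ x, F (Z 0 x) ∂P)) P := fun hF =>
      (integrable_finsetSum _ fun j _ => ((hZ.memLp_comp' hF _).integrable (by simp)).sub
        (integrable_const _)).const_mul _
    refine (norm_integral_cexp_sub_le (hi hF) (hi ((hG n).isCosApproximable _)) θ).trans ?_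
    refine mul_le_mul_of_nonneg_left ?_ (abs_nonneg _)
    have hD := hF.sub (hG n)
    have hiD : ∀ j, Integrable (fun ω => (F - G n) (Z j ω)) P := fun j =>
      (hZ.memLp_comp' hD j).integrable (by simp)
    have hT : MemLp (fun ω => (√(N : ℝ))⁻¹ * ∑ j ∈ Finset.range N, (F - G n) (Z j ω)) 2 P :=
      (memLp_finsetSum _ fun j _ => hZ.memLp_comp' hD _).const_mul _
    have hm : ∫ ω, (√(N : ℝ))⁻¹ * ∑ j ∈ Finset.range N, (F - G n) (Z j ω) ∂P
        = (√(N : ℝ))⁻¹ * ∑ j ∈ Finset.range N, (∫ x, F (Z 0 x) ∂P - ∫ x, G n (Z 0 x) ∂P) := by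
      rw [integral_const_mul, integral_finsetSum _ fun (j : ℕ) _ => hiD (j : ℤ)]
      congr 1
      refine Finset.sum_congr rfl fun j _ => ?_
      rw [hZ.integral_comp hD.measurable, ← integral_sub
        ((hZ.memLp_comp' hF 0).integrable (by simp))
        ((hZ.memLp_comp' ((hG n).isCosApproximable _) 0).integrable (by simp))]
      rfl
    have hv := hZ.variance_sum_comp_le hD N
    refine le_trans (le_of_eq ?_) ((integral_abs_sub_le_sqrt_variance hT).trans ?_)
    · rw [hm]
      congr 1; ext ω
      rw [← mul_sub, ← mul_sub, ← Finset.sum_sub_distrib, ← Finset.sum_sub_distrib]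
      simp only [Pi.sub_apply]
      congr 3; ext j
      ring
    · refine (Real.sqrt_le_sqrt (hv.trans (mul_le_mul_of_nonneg_left (h n) hR0))).trans ?_
      rw [Real.sqrt_mul hR0, Real.sqrt_sq (by positivity)]

end IsShortRangeGaussian

section Density

open scoped RealInnerProductSpace

variable {E : Type*} [NormedAddCommGroup E] [InnerProductSpace ℝ E] [CompleteSpace E]
  [SecondCountableTopology E] [MeasurableSpace E] [BorelSpace E] {μ : Measure E}
  [IsFiniteMeasure μ]

lemma charFun_add_map_neg {ν : Measure E} [IsFiniteMeasure ν] (t : E) :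
    charFun (ν + ν.map Neg.neg) t = ((2 * ∫ z, Real.cos ⟪z, t⟫ ∂ν : ℝ) : ℂ) := by
  have hi : ∀ s : ℝ, Integrable (fun z => Complex.exp ((s * ⟪z, t⟫ : ℝ) * Complex.I)) ν :=
    fun s => Integrable.of_bound (Measurable.aestronglyMeasurable (by fun_prop)) 1
      (Eventually.of_forall fun ω => by rw [Complex.norm_exp_ofReal_mul_I])
  have h1 := hi 1
  have h2 := hi (-1)
  simp only [one_mul, neg_mul] at h1 h2
  have e : ∀ z : E, Complex.exp ((⟪z, t⟫ : ℝ) * Complex.I)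
      + Complex.exp ((-⟪z, t⟫ : ℝ) * Complex.I) = ((2 * Real.cos ⟪z, t⟫ : ℝ) : ℂ) := fun z => by
    push_cast
    rw [Complex.two_cos]
  have hn : charFun (ν.map Neg.neg) t = ∫ z, Complex.exp ((-⟪z, t⟫ : ℝ) * Complex.I) ∂ν := by
    rw [charFun_apply, integral_map (by fun_prop) (by fun_prop)]
    simp
  have hadd : charFun (ν + ν.map Neg.neg) t = charFun ν t + charFun (ν.map Neg.neg) t := by
    rw [charFun_apply, charFun_apply, charFun_apply, integral_add_measure h1]
    refine (integrable_map_measure (by fun_prop) (by fun_prop)).2 ?_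
    convert h2 using 1
    ext z; simp
  rw [hadd, hn, charFun_apply, ← integral_add h1 h2]
  simp only [e]
  rw [integral_complex_ofReal, integral_const_mul]

lemma integral_mul_eq_zero_of_integral_mul_cos {H F : E → ℝ} (hH : Measurable H)
    (hHi : Integrable H μ) (hcos : ∀ t, ∫ z, H z * Real.cos ⟪z, t⟫ ∂μ = 0) (hF : Measurable F)
    {C : ℝ} (hC : ∀ z, |F z| ≤ C) (heven : ∀ᵐ z ∂μ, F (-z) = F z) :
    ∫ z, H z * F z ∂μ = 0 := by
  set ν : (E → ℝ) → Measure E := fun h => μ.withDensity fun z => ENNReal.ofReal (h z) with hν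
  have hfin : ∀ {h : E → ℝ}, Integrable h μ → IsFiniteMeasure (ν h) := fun hh =>
    isFiniteMeasure_withDensity_ofReal hh.2
  have hcov : ∀ {h : E → ℝ}, Measurable h → ∀ g : E → ℝ,
      ∫ z, g z ∂(ν h) = ∫ z, max (h z) 0 * g z ∂μ := fun {h} hh g => by
    rw [hν]
    refine (integral_withDensity_eq_integral_smul (f := fun z => (h z).toNNReal)
      hh.real_toNNReal g).trans ?_
    simp [NNReal.smul_def]
  have hsplit : ∀ {g : E → ℝ}, Measurable g → ∀ {K : ℝ}, (∀ z, |g z| ≤ K) →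
      ∫ z, H z * g z ∂μ = ∫ z, max (H z) 0 * g z ∂μ - ∫ z, max (-H z) 0 * g z ∂μ := by
    intro g hg K hK
    rw [← integral_sub (hHi.pos_part.mul_bdd (c := K) hg.aestronglyMeasurable
      (Eventually.of_forall hK)) (hHi.neg_part.mul_bdd (c := K) hg.aestronglyMeasurable
      (Eventually.of_forall hK))]
    congr 1; ext z
    rw [← sub_mul, max_comm (H z), max_comm (-H z)]
    congr 1
    rcases le_total 0 (H z) with h | h
    · rw [max_eq_right h, max_eq_left (by linarith)]; ring
    · rw [max_eq_left h, max_eq_right (by linarith)]; ring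
  have := hfin hHi
  have := hfin hHi.neg
  have hmeas : ν H + (ν H).map Neg.neg = ν (-H) + (ν (-H)).map Neg.neg := by
    refine Measure.ext_of_charFun (funext fun t => ?_)
    rw [charFun_add_map_neg, charFun_add_map_neg, hcov hH, hcov hH.neg]
    have := hsplit (g := fun z => Real.cos ⟪z, t⟫) (by fun_prop) fun z => Real.abs_cos_le_one _
    rw [hcos] at this
    simp only [Pi.neg_apply]
    congr 2
    linarith
  have hsym : ∀ {h : E → ℝ}, Measurable h → Integrable h μ →
      ∫ z, F z ∂(ν h + (ν h).map Neg.neg) = 2 * ∫ z, max (h z) 0 * F z ∂μ := by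
    intro h hh hi
    have := hfin hi
    have hFi : ∀ (ν : Measure E) [IsFiniteMeasure ν], Integrable F ν := fun ν _ =>
      Integrable.of_bound hF.aestronglyMeasurable C (Eventually.of_forall hC)
    rw [integral_add_measure (hFi _) (hFi _), integral_map (by fun_prop) hF.aestronglyMeasurable,
      hcov hh, hcov hh (fun z => F (-z)), two_mul]
    congr 1
    refine integral_congr_ae ?_
    filter_upwards [heven] with z hz
    rw [hz]
  have h1 := hsym hH hHi
  rw [hmeas, hsym hH.neg hHi.neg] at h1
  rw [hsplit hF hC]
  simp only [Pi.neg_apply] at h1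
  linarith

lemma isCosPoly_zero : IsCosPoly (0 : E → ℝ) :=
  ⟨Fin 0, inferInstance, 0, 0, by ext; simp [cosPoly]⟩

lemma isCosPoly_cos (t : E) : IsCosPoly fun z => Real.cos ⟪z, t⟫ :=
  ⟨Fin 1, inferInstance, 1, fun _ => t, by ext; simp [cosPoly]⟩

lemma IsCosPoly.smul {G : E → ℝ} (hG : IsCosPoly G) (a : ℝ) : IsCosPoly (a • G) := by
  obtain ⟨κ, _, c, t, rfl⟩ := hG
  exact ⟨κ, inferInstance, a • c, t, by ext; simp [cosPoly, Finset.mul_sum, mul_assoc]⟩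

lemma IsCosPoly.add {F G : E → ℝ} (hF : IsCosPoly F) (hG : IsCosPoly G) : IsCosPoly (F + G) := by
  obtain ⟨κ, _, c, t, rfl⟩ := hF
  obtain ⟨κ', _, c', t', rfl⟩ := hG
  exact ⟨κ ⊕ κ', inferInstance, Sum.elim c c', Sum.elim t t', by ext; simp [cosPoly]⟩

/-- Almost everywhere even bounded functions are `L²`-limits of cosine polynomials. -/
theorem isCosApproximable_of_even {F : E → ℝ} (hF : Measurable F) {C : ℝ} (hC : ∀ z, |F z| ≤ C)
    (heven : ∀ᵐ z ∂μ, F (-z) = F z) : IsCosApproximable μ F := by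
  have hmem : ∀ {F : E → ℝ}, Measurable F → ∀ {C : ℝ}, (∀ z, |F z| ≤ C) → MemLp F 2 μ :=
    fun hF C hC => MemLp.of_bound hF.aestronglyMeasurable C (Eventually.of_forall hC)
  have hc : ∀ t : E, MemLp (fun z => Real.cos ⟪z, t⟫) 2 μ := fun t =>
    hmem (by fun_prop) fun z => Real.abs_cos_le_one _
  set W : Submodule ℝ (Lp ℝ 2 μ) := Submodule.span ℝ (Set.range fun t => (hc t).toLp) with hW
  have hWG : ∀ g ∈ W, ∃ G : E → ℝ, IsCosPoly G ∧ g =ᵐ[μ] G := by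
    intro g hg
    induction hg using Submodule.span_induction with
    | mem x hx =>
      obtain ⟨t, rfl⟩ := hx
      exact ⟨_, isCosPoly_cos t, (hc t).coeFn_toLp⟩
    | zero => exact ⟨0, isCosPoly_zero, Lp.coeFn_zero _ _ _⟩
    | add x y _ _ hx hy =>
      obtain ⟨G, hG, h⟩ := hx
      obtain ⟨G', hG', h'⟩ := hy
      exact ⟨G + G', hG.add hG', (Lp.coeFn_add x y).trans (h.add h')⟩
    | smul a x _ hx =>
      obtain ⟨G, hG, h⟩ := hx
      exact ⟨a • G, hG.smul a, (Lp.coeFn_smul a x).trans (h.const_smul a)⟩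
  set f : Lp ℝ 2 μ := (hmem hF hC).toLp with hf
  have hcl : f ∈ W.topologicalClosure := by
    rw [← Submodule.orthogonal_orthogonal_eq_closure, Submodule.mem_orthogonal]
    intro H hH
    have hHm := (Lp.stronglyMeasurable H).measurable
    have hHi : Integrable H μ := (Lp.memLp H).integrable (by simp)
    have hcos : ∀ t : E, ∫ z, H z * Real.cos ⟪z, t⟫ ∂μ = 0 := fun t => by
      have := (Submodule.mem_orthogonal' _ _).1 hH _ (Submodule.subset_span ⟨t, rfl⟩)
      rw [L2.inner_def] at this
      rw [← this]
      refine integral_congr_ae ?_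
      filter_upwards [(hc t).coeFn_toLp] with z hz
      simp [hz, mul_comm]
    rw [L2.inner_def, ← integral_mul_eq_zero_of_integral_mul_cos hHm hHi hcos hF hC heven]
    refine integral_congr_ae ?_
    filter_upwards [(hmem hF hC).coeFn_toLp] with z hz
    rw [hf, hz]
    simp [mul_comm]
  refine ⟨hF, ⟨C, hC⟩, fun δ hδ => ?_⟩
  obtain ⟨g, hg, hd⟩ := Metric.mem_closure_iff.1 hcl (√δ) (Real.sqrt_pos.2 hδ)
  obtain ⟨G, hG, hgG⟩ := hWG g hg
  refine ⟨G, hG, ?_⟩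
  have : ∫ z, (F z - G z) ^ 2 ∂μ = ‖f - g‖ ^ 2 := by
    rw [← real_inner_self_eq_norm_sq, L2.inner_def]
    refine integral_congr_ae ?_
    filter_upwards [(hmem hF hC).coeFn_toLp, hgG, Lp.coeFn_sub f g] with z h1 h2 h3
    rw [h3, Pi.sub_apply, hf, h1, h2]
    simp [sq]
  rw [this]
  rw [dist_eq_norm] at hd
  exact (Real.le_sqrt (norm_nonneg _) hδ.le).1 hd.le

end Density

section Construction

variable {Ω : Type*} [MeasurableSpace Ω] {P : Measure Ω} [IsProbabilityMeasure P]

/-- The linear span of a centered Gaussian process is a Gaussian space. -/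
lemma isGaussianSpace_span {ι : Type*} {X : ι → Ω → ℝ} (hm : ∀ i, Measurable (X i))
    (hg : ∀ (n : ℕ) (s : Fin n → ι) (a : Fin n → ℝ),
      ∃ v : ℝ≥0, P.map (fun ω => ∑ i, a i * X (s i) ω) = gaussianReal 0 v) :
    IsGaussianSpace (Submodule.span ℝ (Set.range X)) P where
  measurable u hu := by
    obtain ⟨c, rfl⟩ := (Finsupp.mem_span_range_iff_exists_finsupp).1 hu
    have := Finset.measurable_sum c.support (f := fun i => c i • X i)
      fun i _ => (hm i).const_smul (c i)
    simp only [← Finset.sum_apply] at this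
    exact this
  law u hu := by
    obtain ⟨c, rfl⟩ := (Finsupp.mem_span_range_iff_exists_finsupp).1 hu
    obtain ⟨v, hv⟩ := hg c.support.card (fun i => (c.support.equivFin.symm i : ι))
      fun i => c (c.support.equivFin.symm i : ι)
    refine ⟨v, hv ▸ congrArg (fun T => P.map T) (funext fun ω => ?_)⟩
    rw [Equiv.sum_comp c.support.equivFin.symm fun i : c.support => c i * X i ω,
      Finset.sum_coe_sort c.support fun i => c i * X i ω]
    simp [Finsupp.sum, Finset.sum_apply]

open scoped RealInnerProductSpace

variable {E : Type*} [NormedAddCommGroup E] [InnerProductSpace ℝ E] [FiniteDimensional ℝ E]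
  [MeasurableSpace E] [BorelSpace E] {V : Submodule ℝ (Ω → ℝ)} {Z : ℤ → Ω → E} {R : ℤ → ℝ}

/-- The linear map sending `t` to the class of `⟪Z j, t⟫` in `L²`. -/
noncomputable def innerToLp (hV : IsGaussianSpace V P) (Z : Ω → E)
    (hmem : ∀ t, (fun ω => ⟪Z ω, t⟫) ∈ V) : E →ₗ[ℝ] Lp ℝ 2 P where
  toFun t := (hV.memLp (hmem t)).toLp
  map_add' s t := by
    rw [← MemLp.toLp_add]
    congr 1
    ext ω
    exact inner_add_right _ _ _
  map_smul' c t := by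
    rw [RingHom.id_apply, ← MemLp.toLp_const_smul]
    congr 1
    ext ω
    exact real_inner_smul_right _ _ _

lemma inner_innerToLp (hV : IsGaussianSpace V P) {Z Z' : Ω → E}
    (hmem : ∀ t, (fun ω => ⟪Z ω, t⟫) ∈ V) (hmem' : ∀ t, (fun ω => ⟪Z' ω, t⟫) ∈ V) (s t : E) :
    ⟪innerToLp hV Z hmem s, innerToLp hV Z' hmem' t⟫ = ∫ ω, ⟪Z ω, s⟫ * ⟪Z' ω, t⟫ ∂P := by
  rw [L2.inner_def]
  refine integral_congr_ae ?_
  filter_upwards [(hV.memLp (hmem s)).coeFn_toLp, (hV.memLp (hmem' t)).coeFn_toLp] with ω h1 h2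
  simp only [innerToLp, LinearMap.coe_mk, AddHom.coe_mk, h1, h2]
  simp [mul_comm]

lemma exists_isShortRangeGaussian (hV : IsGaussianSpace V P) (meas : ∀ j, Measurable (Z j))
    (mem : ∀ j t, (fun ω => ⟪Z j ω, t⟫) ∈ V)
    (stat : ∀ j k s t, ∫ ω, ⟪Z j ω, s⟫ * ⟪Z (j + k) ω, t⟫ ∂P = ∫ ω, ⟪Z 0 ω, s⟫ * ⟪Z k ω, t⟫ ∂P)
    (nonneg : ∀ k, 0 ≤ R k) (summable : Summable fun k => R k ^ 2)
    (bound : ∀ k s t, |∫ ω, ⟪Z 0 ω, s⟫ * ⟪Z k ω, t⟫ ∂P| ≤ R k * (‖s‖ * ‖t‖)) :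
    ∃ ρ, IsShortRangeGaussian V P Z ρ := by
  set T : ℤ → E →ₗ[ℝ] Lp ℝ 2 P := fun j => innerToLp hV (Z j) (mem j) with hT
  have hB : ∀ i j s t, ∫ ω, ⟪Z i ω, s⟫ * ⟪Z j ω, t⟫ ∂P = ⟪T i s, T j t⟫ := fun i j s t =>
    (inner_innerToLp hV (mem i) (mem j) s t).symm
  simp only [hB] at stat bound
  set K := LinearMap.ker (T 0) with hK
  have hker : ∀ j, ∀ s ∈ K, T j s = 0 := fun j s hs => by
    have := stat j 0 s s
    rw [add_zero, LinearMap.mem_ker.1 hs, inner_zero_left] at this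
    exact inner_self_eq_zero.1 this
  have hproj : ∀ j s, T j s = T j (Kᗮ.starProjection s) := fun j s => by
    conv_lhs => rw [← Submodule.starProjection_add_starProjection_orthogonal (K := K) s]
    rw [map_add, hker j _ (Submodule.starProjection_apply_mem K s), zero_add]
  obtain ⟨C, -, hC⟩ := ((T 0).domRestrict Kᗮ).exists_antilipschitzWith (by
    rw [Submodule.eq_bot_iff]
    rintro ⟨x, hx⟩ h0
    have hx0 : x ∈ K := LinearMap.mem_ker.2 h0
    simpa using (Submodule.mem_bot ℝ).1
      (K.inf_orthogonal_eq_bot ▸ Submodule.mem_inf.2 ⟨hx0, hx⟩))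
  have hnorm : ∀ s, ‖Kᗮ.starProjection s‖ ≤ C * ‖T 0 s‖ := fun s => by
    have := hC.le_mul_dist ⟨Kᗮ.starProjection s, Submodule.starProjection_apply_mem _ _⟩ 0
    rw [dist_zero_right, map_zero, dist_zero_right] at this
    rw [hproj 0 s]
    exact this
  refine ⟨fun k => min 1 (R k * C ^ 2), hV, meas, mem, fun j k s t => ?_, fun k =>
    le_min zero_le_one (mul_nonneg (nonneg k) (sq_nonneg _)), fun k => min_le_left _ _, ?_,
    fun k s t => ?_⟩
  · simp only [hB, stat]
  · refine Summable.of_nonneg_of_le (fun k => sq_nonneg _) (fun k => ?_)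
      (summable.mul_right ((C : ℝ) ^ 2 * C ^ 2))
    calc min 1 (R k * (C : ℝ) ^ 2) ^ 2 ≤ (R k * C ^ 2) ^ 2 :=
          pow_le_pow_left₀ (le_min zero_le_one (mul_nonneg (nonneg k) (sq_nonneg _)))
            (min_le_right _ _) 2
      _ = _ := by ring
  · have hq : ∀ s, 0 ≤ ⟪T 0 s, T 0 s⟫ := fun s => real_inner_self_nonneg
    simp only [hB]
    rcases le_total 1 (R k * (C : ℝ) ^ 2) with h | h
    · rw [min_eq_left h, one_mul, ← hB, ← hB 0 0, ← hB 0 0]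
      have := hV.abs_integral_mul_le (mem 0 s) (mem k t)
      have e : ∫ ω, ⟪Z k ω, t⟫ * ⟪Z k ω, t⟫ ∂P = ∫ ω, ⟪Z 0 ω, t⟫ * ⟪Z 0 ω, t⟫ ∂P := by
        rw [hB, hB]; simpa using stat k 0 t t
      rw [e] at this
      linarith
    · rw [min_eq_right h, hproj 0 s, hproj k t, ← hproj 0 s]
      have h1 := bound k (Kᗮ.starProjection s) (Kᗮ.starProjection t)
      rw [← hproj 0 s] at h1
      refine h1.trans ?_
      have h2 : ‖Kᗮ.starProjection s‖ * ‖Kᗮ.starProjection t‖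
          ≤ (C : ℝ) ^ 2 * ((⟪T 0 s, T 0 s⟫ + ⟪T 0 t, T 0 t⟫) / 2) := by
        rw [real_inner_self_eq_norm_sq, real_inner_self_eq_norm_sq]
        calc _ ≤ (C * ‖T 0 s‖) * (C * ‖T 0 t‖) :=
              mul_le_mul (hnorm s) (hnorm t) (norm_nonneg _) (by positivity)
          _ ≤ _ := by nlinarith [mul_nonneg (sq_nonneg (C : ℝ)) (sq_nonneg (‖T 0 s‖ - ‖T 0 t‖))]
      calc _ ≤ R k * _ := mul_le_mul_of_nonneg_left h2 (nonneg k)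
        _ = _ := by ring

end Construction

section OrdinalPattern

variable {m : ℕ} {x : Fin (m + 1) → ℝ} {π π' : Equiv.Perm (Fin (m + 1))}

lemma isOrdPat_iff_strictMono :
    IsOrdPat x π ↔ StrictMono fun i => toLex (OrderDual.toDual (x (π i)), π i) := by
  rw [Fin.strictMono_iff_lt_succ]
  simp only [IsOrdPat, ← forall_and, Prod.Lex.toLex_lt_toLex, OrderDual.toDual_lt_toDual,
    EmbeddingLike.apply_eq_iff_eq]
  refine forall_congr' fun i => ⟨fun h => ?_, fun h => ?_⟩
  · exact h.1.lt_or_eq.imp_right fun e => ⟨e.symm, h.2 e.symm⟩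
  · exact h.elim (fun h => ⟨h.le, fun e => absurd e h.ne'⟩) fun h => ⟨h.1.ge, fun _ => h.2⟩

lemma IsOrdPat.unique (h : IsOrdPat x π) (h' : IsOrdPat x π') : π = π' := by
  rw [isOrdPat_iff_strictMono] at h h'
  have hr : ∀ σ : Equiv.Perm (Fin (m + 1)),
      Set.range (fun i => toLex (OrderDual.toDual (x (σ i)), σ i))
        = Set.range fun i => toLex (OrderDual.toDual (x i), i) := fun σ =>
    σ.surjective.range_comp fun i => toLex (OrderDual.toDual (x i), i)
  have := (h.range_inj h').1 ((hr π).trans (hr π').symm)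
  ext i
  have := congrArg (fun z => (ofLex z).2) (congrFun this i)
  exact congrArg Fin.val this

lemma isOrdPat_iff_strictAnti (hx : Function.Injective x) :
    IsOrdPat x π ↔ StrictAnti fun i => x (π i) := by
  rw [Fin.strictAnti_iff_succ_lt]
  refine ⟨fun h i => (h.1 i).lt_of_ne fun e => ?_, fun h =>
    ⟨fun i => (h i).le, fun i e => absurd e (h i).ne'⟩⟩
  exact (Fin.castSucc_lt_succ (i := i)).ne' (π.injective (hx e))

lemma IsOrdPat.neg (hx : Function.Injective x) (h : IsOrdPat x π) :
    IsOrdPat (fun i => -x i) (Fin.revPerm.trans π) := by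
  rw [isOrdPat_iff_strictAnti hx] at h
  rw [isOrdPat_iff_strictAnti (x := fun i => -x i) (neg_injective.comp hx)]
  intro i j hij
  exact neg_lt_neg (h (Fin.rev_lt_rev.2 hij))

lemma measurableSet_isOrdPat (π : Equiv.Perm (Fin (m + 1))) :
    MeasurableSet {x : Fin (m + 1) → ℝ | IsOrdPat x π} := by
  refine MeasurableSet.inter (s₁ := {x | ∀ i : Fin m, _}) (s₂ := {x | ∀ i : Fin m, _}) ?_ ?_
  · rw [Set.ofPred_forall]
    exact MeasurableSet.iInter fun i =>
      measurableSet_le (measurable_pi_apply _) (measurable_pi_apply _)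
  · rw [Set.ofPred_forall]
    refine MeasurableSet.iInter fun i => ?_
    by_cases hp : π i.castSucc < π i.succ
    · simp [hp]
    · simp only [hp, imp_false]
      exact (measurableSet_eq_fun (measurable_pi_apply (π i.castSucc))
        (measurable_pi_apply (π i.succ))).compl

variable {Pat : ∀ m : ℕ, (Fin (m + 1) → ℝ) → Equiv.Perm (Fin (m + 1))}

lemma eq_pat_iff (hPat : ∀ (m : ℕ) (x : Fin (m + 1) → ℝ), IsOrdPat x (Pat m x)) :
    Pat m x = π ↔ IsOrdPat x π :=
  ⟨fun h => h ▸ hPat m x, fun h => (hPat m x).unique h⟩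

lemma measurableSet_pat_eq (hPat : ∀ (m : ℕ) (x : Fin (m + 1) → ℝ), IsOrdPat x (Pat m x))
    {α : Type*} [MeasurableSpace α] {u w : α → Fin (m + 1) → ℝ} (hu : Measurable u)
    (hw : Measurable w) : MeasurableSet {a | Pat m (u a) = Pat m (w a)} := by
  have : {a | Pat m (u a) = Pat m (w a)}
      = ⋃ π, u ⁻¹' {x | IsOrdPat x π} ∩ w ⁻¹' {x | IsOrdPat x π} := by
    ext a
    simp only [Set.mem_ofPred_eq, Set.mem_iUnion, Set.mem_inter_iff, Set.mem_preimage]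
    refine ⟨fun h => ⟨Pat m (u a), hPat _ _, h ▸ hPat _ _⟩, ?_⟩
    rintro ⟨π, h1, h2⟩
    rw [(eq_pat_iff hPat).2 h1, (eq_pat_iff hPat).2 h2]
  rw [this]
  exact MeasurableSet.iUnion fun π =>
    (hu (measurableSet_isOrdPat π)).inter (hw (measurableSet_isOrdPat π))

lemma pat_neg_eq_iff (hPat : ∀ (m : ℕ) (x : Fin (m + 1) → ℝ), IsOrdPat x (Pat m x))
    {x y : Fin (m + 1) → ℝ} (hx : Function.Injective x) (hy : Function.Injective y) :
    Pat m (fun i => -x i) = Pat m (fun i => -y i) ↔ Pat m x = Pat m y := by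
  rw [(eq_pat_iff hPat).2 ((hPat m x).neg hx), (eq_pat_iff hPat).2 ((hPat m y).neg hy)]
  refine ⟨fun h => ?_, fun h => by rw [h]⟩
  ext i
  simpa using congrArg Fin.val (Equiv.congr_fun h i.rev)

lemma cumsum_neg (y : Fin m → ℝ) : cumsum m (fun i => -y i) = fun i => -cumsum m y i := by
  ext i
  simp only [cumsum, ← Finset.sum_neg_distrib]
  exact Finset.sum_congr rfl fun j _ => by split_ifs <;> simp

lemma cumsum_eq_sum_range (u : ℕ → ℝ) (k : Fin (m + 1)) :
    cumsum m (fun i : Fin m => u i) k = ∑ l ∈ Finset.range k, u l := by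
  rw [cumsum, Fin.sum_univ_eq_sum_range (fun l => if l < (k : ℕ) then u l else 0) m,
    ← Finset.sum_filter]
  congr 1
  ext l
  simp only [Finset.mem_filter, Finset.mem_range]
  omega

lemma measurable_cumsum : Measurable (cumsum m) := by
  refine measurable_pi_lambda _ fun i => Finset.measurable_sum _ fun j _ => ?_
  split_ifs
  exacts [measurable_pi_apply j, measurable_const]

lemma injective_cumsum {u : ℕ → ℝ}
    (hu : ∀ i n, 0 < n → ∑ l ∈ Finset.range n, u (i + l) ≠ 0) :
    Function.Injective (cumsum m fun i : Fin m => u i) := by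
  have key : ∀ i j : Fin (m + 1), i < j →
      cumsum m (fun i : Fin m => u i) i ≠ cumsum m (fun i : Fin m => u i) j := by
    intro i j hij e
    obtain ⟨n, hn⟩ := Nat.exists_eq_add_of_lt (Fin.lt_def.1 hij)
    rw [cumsum_eq_sum_range, cumsum_eq_sum_range, hn, add_assoc, Finset.sum_range_add] at e
    exact hu i (n + 1) n.succ_pos (by linarith)
  intro i j e
  by_contra hne
  rcases lt_or_gt_of_ne hne with h | h
  exacts [key i j h e, key j i h e.symm]

end OrdinalPattern

namespace IsShortRangeGaussian

variable {Ω E : Type*} [MeasurableSpace Ω] {P : Measure Ω} [IsProbabilityMeasure P]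
  [NormedAddCommGroup E] [InnerProductSpace ℝ E] [CompleteSpace E] [SecondCountableTopology E]
  [MeasurableSpace E] [BorelSpace E] {V : Submodule ℝ (Ω → ℝ)} {Z : ℤ → Ω → E} {ρ : ℤ → ℝ}
  {F : E → ℝ}

/-- The central limit theorem for cosine-approximable functionals of a short-range dependent
stationary Gaussian sequence. -/
theorem tendstoInDistribution_comp (hZ : IsShortRangeGaussian V P Z ρ)
    (hF : IsCosApproximable (P.map (Z 0)) F) :
    TendstoInDistribution (fun (N : ℕ) ω => (√(N : ℝ))⁻¹ * ∑ j ∈ Finset.range N,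
        (F (Z j ω) - ∫ x, F (Z 0 x) ∂P)) atTop (id : ℝ → ℝ) (fun _ => P)
      (gaussianReal 0 (Real.toNNReal (∑' k : ℤ,
        cov[fun ω => F (Z 0 ω), fun ω => F (Z k ω); P]))) := by
  have hm : ∀ N : ℕ, Measurable fun ω => (√(N : ℝ))⁻¹ * ∑ j ∈ Finset.range N,
      (F (Z j ω) - ∫ x, F (Z 0 x) ∂P) := fun N =>
    (Finset.measurable_sum (Finset.range N) fun (j : ℕ) _ =>
      (hF.measurable.comp (hZ.meas j)).sub_const (∫ x, F (Z 0 x) ∂P)).const_mul _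
  refine ⟨fun N => (hm N).aemeasurable, aemeasurable_id, ?_⟩
  refine ProbabilityMeasure.tendsto_of_tendsto_charFun fun θ => ?_
  simp only [ProbabilityMeasure.coe_mk, Measure.map_id, charFun_gaussianReal]
  have h := hZ.tendsto_charFun_comp hF θ
  convert h using 2 with N
  · rw [charFun_apply_real, integral_map (hm N).aemeasurable (by fun_prop)]
    simp only [Complex.ofReal_mul]
  · rw [Real.coe_toNNReal _ (hZ.tsum_covariance_nonneg hF), Complex.ofReal_exp]
    congr 1
    push_cast
    ring

theorem tendsto_integral_comp (hZ : IsShortRangeGaussian V P Z ρ)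
    (hF : IsCosApproximable (P.map (Z 0)) F) (h : ℕ) (φ : BoundedContinuousFunction ℝ ℝ) :
    Tendsto (fun n : ℕ => ∫ ω, φ (√(n : ℝ) * (((n - h : ℕ) : ℝ)⁻¹ *
        ∑ j ∈ Finset.range (n - h), F (Z j ω) - ∫ x, F (Z 0 x) ∂P)) ∂P) atTop
      (𝓝 (∫ x, φ x ∂(gaussianReal 0 (Real.toNNReal (∑' k : ℤ,
        cov[fun ω => F (Z 0 ω), fun ω => F (Z k ω); P]))))) := by
  have h1 := hZ.tendstoInDistribution_comp hF
  have hratio : Tendsto (fun N : ℕ => √(((N + h : ℕ) : ℝ) / N)) atTop (𝓝 1) := by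
    have : Tendsto (fun N : ℕ => 1 + (h : ℝ) / N) atTop (𝓝 (1 + 0)) :=
      tendsto_const_nhds.add (tendsto_const_div_atTop_nhds_zero_nat _)
    rw [add_zero] at this
    have h2 := (Real.continuous_sqrt.tendsto 1).comp this
    rw [Real.sqrt_one] at h2
    refine h2.congr' ?_
    filter_upwards [eventually_gt_atTop 0] with N hN
    have : (N : ℝ) ≠ 0 := by positivity
    simp only [Function.comp]
    congr 1
    push_cast
    field_simp
  have h2 := h1.continuous_comp_prodMk_of_tendstoInMeasure_const (g := fun x : ℝ × ℝ => x.2 * x.1)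
    (by fun_prop) (Y := fun N _ => √(((N + h : ℕ) : ℝ) / N)) (c := 1)
    (tendstoInMeasure_of_tendsto_ae (fun N => aestronglyMeasurable_const)
      (Eventually.of_forall fun _ => hratio)) fun N => aemeasurable_const
  have h3 := ProbabilityMeasure.tendsto_iff_forall_integral_tendsto.1 h2.tendsto φ
  rw [← tendsto_add_atTop_iff_nat h]
  simp only [ProbabilityMeasure.coe_mk] at h3
  rw [integral_map h2.aemeasurable_limit (by fun_prop)] at h3
  simp only [id, one_mul] at h3
  refine h3.congr' ?_
  filter_upwards [eventually_gt_atTop 0] with N hN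
  rw [integral_map (h2.forall_aemeasurable N) (by fun_prop)]
  refine integral_congr_ae (Eventually.of_forall fun ω => ?_)
  have hN' : (0 : ℝ) < N := by positivity
  have hs := Real.mul_self_sqrt hN'.le
  have hs0 := (Real.sqrt_pos.2 hN').ne'
  simp only [Nat.add_sub_cancel, Finset.sum_sub_distrib, Finset.sum_const, Finset.card_range,
    nsmul_eq_mul]
  congr 1
  rw [Real.sqrt_div (Nat.cast_nonneg _)]
  have : (N : ℝ)⁻¹ = (√(N : ℝ))⁻¹ * (√(N : ℝ))⁻¹ := by rw [← mul_inv, hs]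
  rw [this]
  field_simp
  rw [sq, hs]

end IsShortRangeGaussian

section Decay

lemma summable_sq_of_rpow_decay {a L : ℕ → ℝ} {e c : ℝ} (he : 2 * e < -1)
    (ha : ∀ k : ℕ, 1 ≤ k → a k = L k * (k : ℝ) ^ e) (hL : Tendsto L atTop (𝓝 c)) :
    Summable fun k => a k ^ 2 := by
  obtain ⟨M, hM⟩ := (Metric.isBounded_range_of_tendsto L hL).exists_norm_le
  refine Summable.of_norm_bounded_eventually_nat
    ((Real.summable_nat_rpow.2 he).mul_left (M ^ 2)) ?_
  filter_upwards [eventually_ge_atTop 1] with k hk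
  have h1 : |L k| ≤ M := hM _ ⟨k, rfl⟩
  rw [ha k hk, mul_pow, Real.norm_of_nonneg (by positivity), ← Real.rpow_natCast ((k : ℝ) ^ e),
    ← Real.rpow_mul (Nat.cast_nonneg _), mul_comm e]
  push_cast
  refine mul_le_mul_of_nonneg_right ?_ (by positivity)
  exact sq_le_sq' (by linarith [abs_le.1 h1]) (abs_le.1 h1).2

lemma summable_sq_sum_abs_shift {ι : Type*} [Fintype ι] {a : ι → ℤ → ℝ}
    (ha : ∀ i, Summable fun k => a i k ^ 2) (m : ι → ℤ) :
    Summable fun k => (∑ i, |a i (k + m i)|) ^ 2 := by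
  have h1 : Summable fun k => (Fintype.card ι : ℝ) * ∑ i, a i (k + m i) ^ 2 :=
    (summable_sum fun i _ => (Equiv.addRight (m i)).summable_iff.2 (ha i)).mul_left _
  refine Summable.of_nonneg_of_le (fun k => sq_nonneg _) (fun k => ?_) h1
  have := sq_sum_le_card_mul_sum_sq (s := Finset.univ) (f := fun i => |a i (k + m i)|)
  simp only [sq_abs, Finset.card_univ] at this
  exact this

end Decay

section Window

variable {Ω : Type*} [MeasurableSpace Ω] {P : Measure Ω} [IsProbabilityMeasure P]
  {Y : ℤ → Ω → Fin 2 → ℝ} {r : Fin 2 → Fin 2 → ℤ → ℝ} {h : ℕ}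

/-- The vector of the `h` observations of a bivariate process following time `j`. -/
noncomputable def window (Y : ℤ → Ω → Fin 2 → ℝ) (h : ℕ) (j : ℤ) (ω : Ω) :
    EuclideanSpace ℝ (Fin h × Fin 2) :=
  WithLp.toLp 2 fun a => Y (j + 1 + (a.1 : ℕ)) ω a.2

/-- The span of all coordinates of a bivariate process. -/
def processSpan (Y : ℤ → Ω → Fin 2 → ℝ) : Submodule ℝ (Ω → ℝ) :=
  Submodule.span ℝ (Set.range fun (a : ℤ × Fin 2) ω => Y a.1 ω a.2)

lemma mem_processSpan (j : ℤ) (p : Fin 2) : (fun ω => Y j ω p) ∈ processSpan Y :=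
  Submodule.subset_span ⟨(j, p), rfl⟩

lemma measurable_coord (hmeas : ∀ j, Measurable (Y j)) (j : ℤ) (p : Fin 2) :
    Measurable fun ω => Y j ω p :=
  (measurable_pi_apply p).comp (hmeas j)

lemma isGaussianSpace_processSpan (hmeas : ∀ j, Measurable (Y j))
    (hgauss : ∀ (n : ℕ) (js : Fin n → ℤ) (ps : Fin n → Fin 2) (a : Fin n → ℝ),
      ∃ v : ℝ≥0, Measure.map (fun ω => ∑ i, a i * Y (js i) ω (ps i)) P = gaussianReal 0 v) :
    IsGaussianSpace (processSpan Y) P :=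
  isGaussianSpace_span (fun a => measurable_coord hmeas a.1 a.2)
    fun n s a => hgauss n (fun i => (s i).1) (fun i => (s i).2) a

open scoped RealInnerProductSpace

lemma inner_window (j : ℤ) (ω : Ω) (t : EuclideanSpace ℝ (Fin h × Fin 2)) :
    ⟪window Y h j ω, t⟫ = ∑ a, t a * Y (j + 1 + (a.1 : ℕ)) ω a.2 := by
  simp [window, PiLp.inner_apply]

lemma inner_window_mem (j : ℤ) (t : EuclideanSpace ℝ (Fin h × Fin 2)) :
    (fun ω => ⟪window Y h j ω, t⟫) ∈ processSpan Y := by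
  have : (fun ω => ⟪window Y h j ω, t⟫)
      = ∑ a, t a • fun ω => Y (j + 1 + (a.1 : ℕ)) ω a.2 := by
    ext ω
    simp [inner_window]
  rw [this]
  exact Submodule.sum_mem _ fun a _ => Submodule.smul_mem _ _ (mem_processSpan _ _)

lemma measurable_window (hmeas : ∀ j, Measurable (Y j)) (j : ℤ) : Measurable (window Y h j) :=
  (WithLp.measurable_toLp 2 _).comp (measurable_pi_lambda _ fun _ => measurable_coord hmeas _ _)

lemma integral_inner_window_mul (hV : IsGaussianSpace (processSpan Y) P)
    (hr : ∀ (p q : Fin 2) (j k : ℤ), ∫ ω, Y j ω p * Y (j + k) ω q ∂P = r p q k)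
    (j k : ℤ) (s t : EuclideanSpace ℝ (Fin h × Fin 2)) :
    ∫ ω, ⟪window Y h j ω, s⟫ * ⟪window Y h (j + k) ω, t⟫ ∂P
      = ∑ a, ∑ b, s a * t b * r a.2 b.2 (k + ((b.1 : ℕ) - (a.1 : ℕ))) := by
  have hi : ∀ a b : Fin h × Fin 2, Integrable (fun ω => s a * Y (j + 1 + (a.1 : ℕ)) ω a.2 *
      (t b * Y (j + k + 1 + (b.1 : ℕ)) ω b.2)) P := fun a b => by
    convert! (hV.integrable_mul (mem_processSpan (j + 1 + (a.1 : ℕ)) a.2)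
      (mem_processSpan (j + k + 1 + (b.1 : ℕ)) b.2)).const_mul (s a * t b) using 1
    ext ω
    ring
  simp only [inner_window, Finset.sum_mul_sum]
  rw [integral_finsetSum _ fun a _ => integrable_finsetSum _ fun b _ => hi a b]
  refine Finset.sum_congr rfl fun a _ => ?_
  rw [integral_finsetSum _ fun b _ => hi a b]
  refine Finset.sum_congr rfl fun b _ => ?_
  rw [← hr a.2 b.2 (j + 1 + (a.1 : ℕ)), ← integral_const_mul]
  refine integral_congr_ae (Eventually.of_forall fun ω => ?_)
  have e : j + k + 1 + ((b.1 : ℕ) : ℤ)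
      = j + 1 + ((a.1 : ℕ) : ℤ) + (k + (((b.1 : ℕ) : ℤ) - ((a.1 : ℕ) : ℤ))) := by ring
  simp only [e]
  ring

theorem exists_isShortRangeGaussian_window (hmeas : ∀ j, Measurable (Y j))
    (hV : IsGaussianSpace (processSpan Y) P)
    (hr : ∀ (p q : Fin 2) (j k : ℤ), ∫ ω, Y j ω p * Y (j + k) ω q ∂P = r p q k)
    (hsum : ∀ p q, Summable fun k => r p q k ^ 2) (h : ℕ) :
    ∃ ρ, IsShortRangeGaussian (processSpan Y) P (window Y h) ρ := by
  refine exists_isShortRangeGaussian (R := fun k => ∑ c : (Fin h × Fin 2) × (Fin h × Fin 2),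
    |r c.1.2 c.2.2 (k + ((c.2.1 : ℕ) - (c.1.1 : ℕ)))|) hV (measurable_window hmeas)
    inner_window_mem (fun j k s t => ?_) (fun k => Finset.sum_nonneg fun _ _ => abs_nonneg _)
    (summable_sq_sum_abs_shift (a := fun c : (Fin h × Fin 2) × (Fin h × Fin 2) =>
      r c.1.2 c.2.2) (fun c => hsum _ _) fun c => ((c.2.1 : ℕ) - (c.1.1 : ℕ) : ℤ))
    fun k s t => ?_
  · rw [integral_inner_window_mul hV hr]
    have := integral_inner_window_mul hV hr 0 k s t
    rw [zero_add] at this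
    rw [this]
  · have := integral_inner_window_mul hV hr 0 k s t
    rw [zero_add] at this
    rw [this, ← Fintype.sum_prod_type' (fun a b : Fin h × Fin 2 =>
      s a * t b * r a.2 b.2 (k + ((b.1 : ℕ) - (a.1 : ℕ)))), Finset.sum_mul]
    refine (Finset.abs_sum_le_sum_abs _ _).trans (Finset.sum_le_sum fun c _ => ?_)
    rw [abs_mul, abs_mul, mul_comm]
    exact mul_le_mul_of_nonneg_left
      (mul_le_mul (PiLp.norm_apply_le s c.1) (PiLp.norm_apply_le t c.2)
      (abs_nonneg _) (norm_nonneg _)) (abs_nonneg _)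

end Window

section Ties

variable {Ω : Type*} [MeasurableSpace Ω] {P : Measure Ω} [IsProbabilityMeasure P]
  {V : Submodule ℝ (Ω → ℝ)} {u : Ω → ℝ}
  {Y : ℤ → Ω → Fin 2 → ℝ} {r : Fin 2 → Fin 2 → ℤ → ℝ} {h : ℕ}

lemma IsGaussianSpace.ae_ne_zero (hV : IsGaussianSpace V P) (hu : u ∈ V)
    (h : ∫ ω, u ω * u ω ∂P ≠ 0) : ∀ᵐ ω ∂P, u ω ≠ 0 := by
  have hm := hV.measurable u hu
  have : NullSingletonClass (P.map u) := by
    rw [hV.map_eq hu]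
    exact nullSingletonClass_gaussianReal fun h0 => h
      (le_antisymm (Real.toNNReal_eq_zero.1 h0) (IsGaussianSpace.integral_self_nonneg u))
  have h0 : P.map u {0} = 0 := measure_singleton 0
  rw [Measure.map_apply hm (measurableSet_singleton 0)] at h0
  exact measure_eq_zero_iff_ae_notMem.1 h0

lemma ae_sum_range_ne_zero (hV : IsGaussianSpace (processSpan Y) P)
    (hvar : ∀ (j : ℤ) (p : Fin 2), ∫ ω, (Y j ω p) ^ 2 ∂P = 1)
    (hr : ∀ (p q : Fin 2) (j k : ℤ), ∫ ω, Y j ω p * Y (j + k) ω q ∂P = r p q k)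
    (hr1 : ∀ (p q : Fin 2) (k : ℤ), 1 ≤ k → |r p q k| < 1) (p : Fin 2) (j : ℤ) {n : ℕ}
    (hn : 0 < n) : ∀ᵐ ω ∂P, ∑ l ∈ Finset.range n, Y (j + (l : ℕ)) ω p ≠ 0 := by
  set W : ℤ → Ω → ℝ := fun j ω => ∑ l ∈ Finset.range n, Y (j + (l : ℕ)) ω p with hW
  have hmem : ∀ j, W j ∈ processSpan Y := fun j => by
    have : W j = ∑ l ∈ Finset.range n, fun ω => Y (j + (l : ℕ)) ω p := by
      ext ω
      simp [hW]
    rw [this]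
    exact Submodule.sum_mem _ fun l _ => mem_processSpan _ _
  have hcov : ∀ j, ∫ ω, W j ω * W j ω ∂P
      = ∑ l ∈ Finset.range n, ∑ m ∈ Finset.range n, r p p ((m : ℤ) - l) := fun j => by
    have hi : ∀ l m : ℕ, Integrable (fun ω => Y (j + l) ω p * Y (j + m) ω p) P := fun l m =>
      hV.integrable_mul (mem_processSpan _ _) (mem_processSpan _ _)
    simp only [hW, Finset.sum_mul_sum]
    rw [integral_finsetSum _ fun l _ => integrable_finsetSum _ fun m _ => hi l m]
    refine Finset.sum_congr rfl fun l _ => ?_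
    rw [integral_finsetSum _ fun m _ => hi l m]
    refine Finset.sum_congr rfl fun m _ => ?_
    rw [← hr p p (j + l)]
    rw [add_assoc j, add_sub_cancel]
  refine hV.ae_ne_zero (hmem j) fun h0 => ?_
  have hz : ∀ i, ∀ᵐ ω ∂P, W i ω = 0 := fun i =>
    hV.ae_eq_zero (hmem i) (by rw [hcov, ← hcov j, h0])
  have h1 : r p p n = 1 := by
    rw [← hr p p 0, ← hvar 0 p]
    refine integral_congr_ae ?_
    filter_upwards [hz 0, hz 1] with ω h0 h1
    have e1 := Finset.sum_range_succ (fun l : ℕ => Y (0 + (l : ℕ)) ω p) n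
    rw [Finset.sum_range_succ'] at e1
    have e2 : ∑ l ∈ Finset.range n, Y (0 + ((l + 1 : ℕ) : ℤ)) ω p = W 1 ω := by
      refine Finset.sum_congr rfl fun l _ => ?_
      rw [show (0 : ℤ) + ((l + 1 : ℕ) : ℤ) = 1 + (l : ℕ) by push_cast; ring]
    rw [e2, h1, show ∑ l ∈ Finset.range n, Y (0 + (l : ℕ)) ω p = W 0 ω from rfl, h0, zero_add,
      Nat.cast_zero, add_zero, zero_add] at e1
    rw [← e1, sq]
  have := hr1 p p n (by exact_mod_cast hn)
  rw [h1, abs_one] at this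
  exact lt_irrefl _ this

lemma ae_injective_cumsum (hV : IsGaussianSpace (processSpan Y) P)
    (hvar : ∀ (j : ℤ) (p : Fin 2), ∫ ω, (Y j ω p) ^ 2 ∂P = 1)
    (hr : ∀ (p q : Fin 2) (j k : ℤ), ∫ ω, Y j ω p * Y (j + k) ω q ∂P = r p q k)
    (hr1 : ∀ (p q : Fin 2) (k : ℤ), 1 ≤ k → |r p q k| < 1) (p : Fin 2) (j : ℤ) :
    ∀ᵐ ω ∂P, Function.Injective (cumsum h fun i : Fin h => Y (j + (i : ℕ)) ω p) := by
  have : ∀ᵐ ω ∂P, ∀ i n : ℕ, 0 < n →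
      ∑ l ∈ Finset.range n, Y (j + ((i + l : ℕ) : ℤ)) ω p ≠ 0 := by
    refine ae_all_iff.2 fun i => ae_all_iff.2 fun n => ?_
    by_cases hn : 0 < n
    · filter_upwards [ae_sum_range_ne_zero hV hvar hr hr1 p (j + i) hn] with ω hω _
      simpa only [Nat.cast_add, ← add_assoc] using hω
    · exact Eventually.of_forall fun ω h' => absurd h' hn
  filter_upwards [this] with ω hω
  exact injective_cumsum (u := fun l : ℕ => Y (j + (l : ℤ)) ω p) hω

/-- The indicator of coincidence of the ordinal patterns of the two components. -/
noncomputable def coincidence (Pat : ∀ m : ℕ, (Fin (m + 1) → ℝ) → Equiv.Perm (Fin (m + 1)))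
    (h : ℕ) (z : EuclideanSpace ℝ (Fin h × Fin 2)) : ℝ :=
  if Pat h (cumsum h fun i => z (i, 0)) = Pat h (cumsum h fun i => z (i, 1)) then 1 else 0

variable {Pat : ∀ m : ℕ, (Fin (m + 1) → ℝ) → Equiv.Perm (Fin (m + 1))}

lemma measurable_coincidence
    (hPat : ∀ (m : ℕ) (x : Fin (m + 1) → ℝ), IsOrdPat x (Pat m x)) :
    Measurable (coincidence Pat h) := by
  have hm : ∀ p : Fin 2, Measurable fun z : EuclideanSpace ℝ (Fin h × Fin 2) =>
      cumsum h fun i => z (i, p) := fun p =>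
    measurable_cumsum.comp (measurable_pi_lambda _ fun i =>
      (measurable_pi_apply (i, p)).comp (WithLp.measurable_ofLp 2 _))
  exact Measurable.ite (measurableSet_pat_eq hPat (hm 0) (hm 1)) measurable_const measurable_const

lemma isCosApproximable_coincidence
    (hPat : ∀ (m : ℕ) (x : Fin (m + 1) → ℝ), IsOrdPat x (Pat m x))
    (hmeas : ∀ j, Measurable (Y j)) (hV : IsGaussianSpace (processSpan Y) P)
    (hvar : ∀ (j : ℤ) (p : Fin 2), ∫ ω, (Y j ω p) ^ 2 ∂P = 1)
    (hr : ∀ (p q : Fin 2) (j k : ℤ), ∫ ω, Y j ω p * Y (j + k) ω q ∂P = r p q k)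
    (hr1 : ∀ (p q : Fin 2) (k : ℤ), 1 ≤ k → |r p q k| < 1) :
    IsCosApproximable (P.map (window Y h 0)) (coincidence Pat h) := by
  have hF := measurable_coincidence (h := h) hPat
  refine isCosApproximable_of_even (C := 1) hF (fun z => ?_) ?_
  · unfold coincidence
    split_ifs <;> simp
  · refine (ae_map_iff (measurable_window hmeas 0).aemeasurable
      (measurableSet_eq_fun (hF.comp measurable_neg) hF)).2 ?_
    filter_upwards [ae_injective_cumsum (h := h) hV hvar hr hr1 0 (0 + 1),
      ae_injective_cumsum (h := h) hV hvar hr hr1 1 (0 + 1)] with ω h0 h1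
    have := pat_neg_eq_iff hPat h0 h1
    rw [← cumsum_neg, ← cumsum_neg] at this
    exact if_congr this rfl rfl

end Ties

/-- central limit theorem for the estimator `p̂_n` of the probability `p` of
coincident ordinal patterns, for a stationary bivariate centered Gaussian process with unit
variances, `|r^{(p,q)}(k)| < 1`, whose cross-correlations satisfy the short-range condition
`r^{(p,q)}(k) = L_{p,q}(k)·k^{d_p+d_q−1}` with `d_1, d_2 ∈ (−∞,0) ∪ (0,1/4)` and
`L_{p,q}(k) → L_{p,q} ∈ ℝ`.  Then `σ² = Σ_{k∈ℤ} E[(f_1 − p)(f_{1+k} − p)]` converges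
(absolutely, i.e. the family is summable), `σ² ≥ 0`, and `√n (p̂_n − p)` converges in
distribution (tested against bounded continuous functions) to `N(0,σ²)`.
Gaussianity is expressed by all linear combinations of finite-dimensional marginals being
(centered) Gaussian, stationarity by shift invariance of finite-dimensional distributions;
`Pat` is the ordinal pattern map `Π` characterized by `hPat`, `Π̃ y = Pat (cumsum y)`. -/
theorem clt_for_coincident_pattern_estimator_short_range
    {Ω : Type*} [MeasurableSpace Ω] (P : Measure Ω) [IsProbabilityMeasure P]
    (Pat : ∀ m : ℕ, (Fin (m + 1) → ℝ) → Equiv.Perm (Fin (m + 1)))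
    (hPat : ∀ (m : ℕ) (x : Fin (m + 1) → ℝ), IsOrdPat x (Pat m x))
    (Y : ℤ → Ω → Fin 2 → ℝ)
    (hmeas : ∀ j, Measurable (Y j))
    (hgauss : ∀ (n : ℕ) (js : Fin n → ℤ) (ps : Fin n → Fin 2) (a : Fin n → ℝ),
      ∃ v : NNReal, Measure.map (fun ω => ∑ i, a i * Y (js i) ω (ps i)) P = gaussianReal 0 v)
    (hstat : ∀ (n : ℕ) (js : Fin n → ℤ) (ps : Fin n → Fin 2) (k : ℤ),
      Measure.map (fun ω (i : Fin n) => Y (js i + k) ω (ps i)) P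
        = Measure.map (fun ω (i : Fin n) => Y (js i) ω (ps i)) P)
    (hmean : ∀ (j : ℤ) (p : Fin 2), ∫ ω, Y j ω p ∂P = 0)
    (hvar : ∀ (j : ℤ) (p : Fin 2), ∫ ω, (Y j ω p) ^ 2 ∂P = 1)
    (r : Fin 2 → Fin 2 → ℤ → ℝ)
    (hr : ∀ (p q : Fin 2) (j k : ℤ), ∫ ω, Y j ω p * Y (j + k) ω q ∂P = r p q k)
    (hr1 : ∀ (p q : Fin 2) (k : ℤ), 1 ≤ k → |r p q k| < 1)
    (d : Fin 2 → ℝ) (hd : ∀ p, d p < 0 ∨ (0 < d p ∧ d p < 1 / 4))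
    (L : Fin 2 → Fin 2 → ℕ → ℝ) (Lc : Fin 2 → Fin 2 → ℝ)
    (hrL : ∀ (p q : Fin 2) (k : ℕ), 1 ≤ k →
      r p q (k : ℤ) = L p q k * (k : ℝ) ^ (d p + d q - 1))
    (hLlim : ∀ p q : Fin 2, Tendsto (L p q) atTop (nhds (Lc p q)))
    (h : ℕ) (hh : 0 < h) :
    let f : ℤ → Ω → ℝ := fun j ω =>
      if Pat h (cumsum h fun i : Fin h => Y (j + (i : ℕ)) ω 0)
          = Pat h (cumsum h fun i : Fin h => Y (j + (i : ℕ)) ω 1) then 1 else 0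
    let pc : ℝ := ∫ ω, f 1 ω ∂P
    let g : ℤ → ℝ := fun k => ∫ ω, (f 1 ω - pc) * (f (1 + k) ω - pc) ∂P
    let phat : ℕ → Ω → ℝ := fun n ω =>
      ((n - h : ℕ) : ℝ)⁻¹ * ∑ j ∈ Finset.range (n - h), f ((j : ℕ) + 1 : ℤ) ω
    Summable g ∧ 0 ≤ ∑' k : ℤ, g k ∧
    ∀ gbc : BoundedContinuousFunction ℝ ℝ,
      Tendsto (fun n : ℕ => ∫ ω, gbc (Real.sqrt (n : ℝ) * (phat n ω - pc)) ∂P) atTop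
        (nhds (∫ x, gbc x ∂(gaussianReal 0 (Real.toNNReal (∑' k : ℤ, g k))))) := by
  intro f pc g phat
  have hV := isGaussianSpace_processSpan hmeas hgauss
  have hsum : ∀ p q, Summable fun k => r p q k ^ 2 := fun p q => by
    have he : ∀ p q, 2 * (d p + d q - 1) < -1 := fun p q => by
      have h4 : ∀ p, d p < 1 / 4 := fun p => (hd p).elim (fun h => by linarith) fun h => h.2
      linarith [h4 p, h4 q]
    have hneg : ∀ k : ℤ, r p q (-k) = r q p k := fun k => by
      rw [← hr p q k, ← hr q p 0]
      simp only [add_neg_cancel, zero_add, mul_comm]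
    refine summable_int_iff_summable_nat_and_neg.2 ⟨?_, ?_⟩
    · exact summable_sq_of_rpow_decay (he p q) (hrL p q) (hLlim p q)
    · simp only [hneg]
      exact summable_sq_of_rpow_decay (he q p) (hrL q p) (hLlim q p)
  obtain ⟨ρ, hZ⟩ := exists_isShortRangeGaussian_window hmeas hV hr hsum h
  have hF := isCosApproximable_coincidence (h := h) hPat hmeas hV hvar hr hr1
  have hf : ∀ (j : ℤ) ω, f (j + 1) ω = coincidence Pat h (window Y h j ω) := fun j ω => by
    simp only [f, coincidence, window]
    congr
  have hf1 : ∀ ω, f 1 ω = coincidence Pat h (window Y h 0 ω) := fun ω => hf 0 ω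
  have hpc : pc = ∫ ω, coincidence Pat h (window Y h 0 ω) ∂P := by simp only [pc, hf1]
  have hg : g = fun k => cov[fun ω => coincidence Pat h (window Y h 0 ω),
      fun ω => coincidence Pat h (window Y h k ω); P] := by
    ext k
    rw [covariance, hZ.integral_comp hF.measurable k]
    simp only [g, hpc, hf1, add_comm 1 k, hf]
  rw [hg]
  refine ⟨hZ.summable_covariance_comp hF, hZ.tsum_covariance_nonneg hF, fun gbc => ?_⟩
  have := hZ.tendsto_integral_comp hF h gbc
  simpa only [phat, hf, hpc] using this
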